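/- Let M be a finitely generated A-module with dim M = d ≥ 1, 𝓜 = {M_n}_{n≥0} a good I-filtration of M, D(I,M) an arbitrary extended degree of M with respect to I, and q an ideal with I ⊆ q and M_{n+1} ⊆ q M_n for all n ≥ 0. Then for the fiber cone F_q(𝓜): (i) if d = 1, a_0(F_q(𝓜)) ≤ D(I,M) + r(𝓜); (ii) if d ≥ 2, a_0(F_q(𝓜)) ≤ (D(I,M) + r(𝓜) + 2)^{3(d−1)!−1} − d. -/

import Mathlib

/-!
Formalization of results from:
L.X. Dung, L.T. Hoa, "Castelnuovo-Mumford regularity of associated graded modules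
and fiber cones of filtered modules".

Setting: `(A, 𝔪)` is a Noetherian local ring with infinite residue field, `I` an
`𝔪`-primary ideal, `M` a finitely generated `A`-module, and `𝓜 = {M_n}` a good
`I`-filtration of `M`.

Notions that are not available in Mathlib (the Castelnuovo–Mumford regularity of the
associated graded module `G(𝓜) = ⊕ M_n/M_{n+1}` over `G_I(A)`, defined via graded local
cohomology, and similar graded invariants) are taken as explicit parameters of the
theorems, documented where they occur.  Everything else is defined concretely below.
-/

open Filter IsLocalRing

universe u

section Preliminaries

variable {A : Type u} [CommRing A] {M : Type u} [AddCommGroup M] [Module A M]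

/-- The length `ℓ(M)` of a module, as the Krull dimension of its lattice of submodules. -/
noncomputable def moduleLength (A : Type u) (M : Type u) [CommRing A] [AddCommGroup M]
    [Module A M] : WithBot ℕ∞ :=
  Order.krullDim (Submodule A M)

/-- The zeroth local cohomology `H⁰_J(M)`, i.e. the `J`-torsion submodule
`{m ∈ M ∣ J^k • m = 0 for some k}`. -/
noncomputable def lcZero (J : Ideal A) (M : Type u) [AddCommGroup M] [Module A M] :
    Submodule A M :=
  ⨆ k : ℕ, Submodule.torsionBySet A M ((J ^ k : Ideal A) : Set A)

/-- `I` is an `𝔪`-primary (proper) ideal of the local ring `A`. -/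
def IsMaxPrimary [IsLocalRing A] (I : Ideal A) : Prop :=
  I ≠ ⊤ ∧ I.radical = maximalIdeal A

/-- A good `I`-filtration `𝓜 : M = M₀ ⊇ M₁ ⊇ ⋯`: an `I`-filtration
(`I • M_n ⊆ M_{n+1}`, packaged in Mathlib's `Ideal.Filtration`) which starts at `M`
and satisfies `I • M_n = M_{n+1}` for all large `n` (stability). -/
def Ideal.Filtration.IsGood {I : Ideal A} (F : I.Filtration M) : Prop :=
  F.N 0 = ⊤ ∧ F.Stable

/-- `r(𝓜) = min {t ≥ 0 ∣ M_{n+1} = I•M_n for all n ≥ t}`, the maximal generating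
degree of `G(𝓜)` over `G_I(A)`. -/
noncomputable def Ideal.Filtration.genDeg {I : Ideal A} (F : I.Filtration M) : ℕ :=
  sInf {t | ∀ n, t ≤ n → F.N (n + 1) = I • F.N n}

/-- The initial form `x*` of `x ∈ I` is a (linear) filter-regular element on `G(𝓜)`,
expressed elementwise: `(M_{n+2} :_M x) ∩ M_n = M_{n+1}` for all `n ≫ 0`. -/
def Ideal.Filtration.FilterRegular {I : Ideal A} (F : I.Filtration M) (x : A) : Prop :=
  ∀ᶠ n : ℕ in atTop,
    (F.N (n + 2)).comap (LinearMap.lsmul A M x) ⊓ F.N n = F.N (n + 1)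

/-- The quotient filtration `𝓜/p = {(M_n + p)/p}` on `M/p`. -/
def Ideal.Filtration.quot {I : Ideal A} (F : I.Filtration M) (p : Submodule A M) :
    I.Filtration (M ⧸ p) where
  N n := (F.N n).map p.mkQ
  mono n := Submodule.map_mono (F.mono n)
  smul_le n := by
    rw [← Submodule.map_smul'']
    exact Submodule.map_mono (F.smul_le n)

/-- Vanishing of the degree-`n` graded piece of `H⁰_{G₊}(G(𝓜))`, expressed elementwise:
every `m ∈ M_n` with `I^k • m ⊆ M_{n+k+1}` for some `k` lies in `M_{n+1}`. -/
def Ideal.Filtration.H0GradedVanish {I : Ideal A} (F : I.Filtration M) (n : ℕ) : Prop :=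
  ∀ m ∈ F.N n, (∃ k : ℕ, ∀ c ∈ I ^ k, c • m ∈ F.N (n + k + 1)) → m ∈ F.N (n + 1)

/-- An extended degree `D(I,·)` on finitely generated `A`-modules with respect to an
`𝔪`-primary ideal `I`:
(i) `D(I,N) = D(I,N/H⁰_𝔪(N)) + ℓ(H⁰_𝔪(N))`;
(ii) `D(I,N) ≥ D(I,N/xN)` for a generic element `x ∈ I ∖ 𝔪I` on `N` (genericity is
     rendered as the existence of such an `x` which is moreover filter-regular);
(iii) `D(I,N) = e(I,N)`, the multiplicity, if `N` is Cohen–Macaulay (Cohen–Macaulayness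
      is rendered via the existence of a regular sequence of parameters, and the
      multiplicity via the leading coefficient of the Hilbert–Samuel polynomial). -/
structure IsExtendedDegree [IsLocalRing A] (I : Ideal A)
    (D : (N : Type u) → [AddCommGroup N] → [Module A N] → ℕ) : Prop where
  h0_add : ∀ (N : Type u) [AddCommGroup N] [Module A N] [Module.Finite A N],
    (D N : WithBot ℕ∞) =
      (D (N ⧸ lcZero (maximalIdeal A) N) : WithBot ℕ∞) +
        moduleLength A (lcZero (maximalIdeal A) N)
  generic : ∀ (N : Type u) [AddCommGroup N] [Module A N] [Module.Finite A N],
    Nontrivial N →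
    ∃ x ∈ I, x ∉ maximalIdeal A * I ∧
      (Ideal.stableFiltration I (⊤ : Submodule A N)).FilterRegular x ∧
      D (N ⧸ (Ideal.span {x} • (⊤ : Submodule A N))) ≤ D N
  cohenMacaulay : ∀ (N : Type u) [AddCommGroup N] [Module A N] [Module.Finite A N]
    (d : ℕ) (c : ℕ → ℤ) (H : ℕ → ℕ),
    (∃ rs : List A, (∀ y ∈ rs, y ∈ maximalIdeal A) ∧ RingTheory.Sequence.IsRegular N rs ∧
        moduleLength A (N ⧸ (Ideal.ofList rs • (⊤ : Submodule A N))) ≠ ⊤) →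
    ringKrullDim (A ⧸ Module.annihilator A N) = (d : WithBot ℕ∞) →
    (∀ n : ℕ, moduleLength A (N ⧸ ((I ^ (n + 1)) • (⊤ : Submodule A N))) = (H n : WithBot ℕ∞)) →
    (∀ᶠ n : ℕ in atTop,
      (H n : ℤ) = ∑ i ∈ Finset.range (d + 1),
        (-1) ^ i * c i * ((n + d - i).choose (d - i) : ℤ)) →
    (D N : ℤ) = c 0

end Preliminaries

section FiberCone

variable {A : Type u} [CommRing A] {M : Type u} [AddCommGroup M] [Module A M]

/-- Vanishing of the degree-`n` graded piece of `H⁰_{G₊}(F_q(𝓜))`, where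
`F_q(𝓜) = ⊕ M_n/q•M_n` is the fiber cone of the filtration `𝓜` with respect to `q`,
a graded module over `G_I(A)`; expressed elementwise: every `m ∈ M_n` with
`I^k • m ⊆ q•M_{n+k}` for some `k` lies in `q•M_n`. -/
def Ideal.Filtration.FiberH0Vanish {I : Ideal A} (F : I.Filtration M) (q : Ideal A)
    (n : ℕ) : Prop :=
  ∀ m ∈ F.N n, (∃ k : ℕ, ∀ c ∈ I ^ k, c • m ∈ q • F.N (n + k)) → m ∈ q • F.N n

end FiberCone


section RelLength

variable {A : Type*} [CommRing A] {M : Type*} [AddCommGroup M] [Module A M]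
  {E : Type*} [AddCommGroup E] [Module A E] {E' : Type*} [AddCommGroup E'] [Module A E']

lemma length_map_le (L : Submodule A M) (φ : M →ₗ[A] E) (ψ : M →ₗ[A] E')
    (h : ∀ u ∈ L, φ u = 0 → ψ u = 0) :
    Module.length A (L.map ψ) ≤ Module.length A (L.map φ) := by
  have h1 : LinearMap.ker (φ.submoduleMap L) ≤ LinearMap.ker (ψ.submoduleMap L) := by
    intro u hu
    rw [LinearMap.mem_ker, Subtype.ext_iff] at hu ⊢
    exact h u u.2 hu
  let e := (φ.submoduleMap L).quotKerEquivOfSurjective (φ.submoduleMap_surjective L)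
  let g := (LinearMap.ker (φ.submoduleMap L)).liftQ (ψ.submoduleMap L) h1
  have hg : Function.Surjective g := by
    intro y
    obtain ⟨u, rfl⟩ := ψ.submoduleMap_surjective L y
    exact ⟨Submodule.Quotient.mk u, rfl⟩
  exact (Module.length_le_of_surjective g hg).trans e.length_eq.le

/-- relative length `ℓ((L+K)/K)` -/
noncomputable def rl (K L : Submodule A M) : ℕ∞ := Module.length A (L.map K.mkQ)

lemma rl_le_of_map {K L : Submodule A M} {K' L' : Submodule A E} (g : M →ₗ[A] E)
    (h1 : L' ≤ L.map g ⊔ K') (h2 : ∀ u ∈ L, u ∈ K → g u ∈ K') : rl K' L' ≤ rl K L := by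
  have : L'.map K'.mkQ ≤ L.map (K'.mkQ ∘ₗ g) := by
    rintro _ ⟨y, hy, rfl⟩
    obtain ⟨z, hz, w, hw, rfl⟩ := Submodule.mem_sup.mp (h1 hy)
    obtain ⟨u, hu, rfl⟩ := hz
    refine ⟨u, hu, ?_⟩
    simpa using hw
  refine (Module.length_le_of_injective (Submodule.inclusion this)
    (Submodule.inclusion_injective this)).trans (length_map_le L K.mkQ _ ?_)
  intro u hu h0
  simpa using h2 u hu (by simpa using h0)

lemma rl_le_of_inj {K L : Submodule A M} {K' L' : Submodule A E} (g : M →ₗ[A] E)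
    (h1 : L.map g ≤ L') (h2 : ∀ u ∈ L, g u ∈ K' → u ∈ K) : rl K L ≤ rl K' L' := by
  have : L.map (K'.mkQ ∘ₗ g) ≤ L'.map K'.mkQ := by
    rw [Submodule.map_comp]; exact Submodule.map_mono h1
  refine (length_map_le L (K'.mkQ ∘ₗ g) K.mkQ ?_).trans (Module.length_le_of_injective
    (Submodule.inclusion this) (Submodule.inclusion_injective this))
  intro u hu h0
  simpa using h2 u hu (by simpa using h0)

lemma rl_mono {K L K' L' : Submodule A M} (hK : K ≤ K') (hL : L' ≤ L) : rl K' L' ≤ rl K L :=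
  rl_le_of_map LinearMap.id (by simpa using le_sup_of_le_left hL) (fun u _ h => hK h)

lemma rl_eq_zero {K L : Submodule A M} : rl K L = 0 ↔ L ≤ K := by
  rw [rl, Module.length_eq_zero_iff, Submodule.subsingleton_iff_eq_bot, eq_bot_iff,
    Submodule.map_le_iff_le_comap, Submodule.comap_bot, Submodule.ker_mkQ]

lemma rl_add {K L H : Submodule A M} (h2 : L ≤ H) (h1 : K ≤ L) :
    rl K H = rl K L + rl L H := by
  have hle : L.map K.mkQ ≤ H.map K.mkQ := Submodule.map_mono h2
  let f := Submodule.inclusion hle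
  let π : (M ⧸ K) →ₗ[A] (M ⧸ L) := K.liftQ L.mkQ (by simpa using h1)
  have hp : ∀ y ∈ H.map K.mkQ, π y ∈ H.map L.mkQ := by
    rintro _ ⟨y, hy, rfl⟩
    exact ⟨y, hy, by simp [π]⟩
  let g : H.map K.mkQ →ₗ[A] H.map L.mkQ := π.restrict hp
  refine Module.length_eq_add_of_exact f g (Submodule.inclusion_injective hle) ?_ ?_
  · rintro ⟨_, y, hy, rfl⟩
    exact ⟨⟨K.mkQ y, y, hy, rfl⟩, Subtype.ext (by simp [g, π])⟩
  · rintro ⟨_, y, hy, rfl⟩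
    constructor
    · intro h
      have h' : L.mkQ y = 0 := by
        have := congrArg Subtype.val h
        simpa [g, π] using this
      have hyL : y ∈ L := by simpa using h'
      exact ⟨⟨K.mkQ y, y, hyL, rfl⟩, rfl⟩
    · rintro ⟨⟨_, z, hz, rfl⟩, h⟩
      have h' : K.mkQ z = K.mkQ y := congrArg Subtype.val h
      apply Subtype.ext
      change π (K.mkQ y) = 0
      rw [← h']
      simpa [π] using hz

lemma rl_top (K : Submodule A M) : rl K ⊤ = Module.length A (M ⧸ K) := by
  rw [rl, Submodule.map_top, Submodule.range_mkQ, Module.length_top]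

lemma rl_bot (L : Submodule A M) : rl ⊥ L = Module.length A L := by
  apply le_antisymm
  · have := length_map_le L LinearMap.id (Submodule.mkQ (⊥ : Submodule A M))
      (by intro u _ h; simpa using h)
    rwa [Submodule.map_id] at this
  · have := length_map_le L (Submodule.mkQ (⊥ : Submodule A M)) LinearMap.id
      (by intro u _ h; simpa using h)
    rwa [Submodule.map_id] at this

end RelLength

section PDsec

variable {A : Type*} [CommRing A] {M : Type*} [AddCommGroup M] [Module A M]
  {P : Type*} [AddCommGroup P] [Module A P]

/-- `I`-saturation of a submodule. -/
def isat (I : Ideal A) (K : Submodule A M) : Submodule A M where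
  carrier := {u | ∃ k : ℕ, ∀ c ∈ I ^ k, c • u ∈ K}
  add_mem' := by
    rintro u v ⟨k, hk⟩ ⟨j, hj⟩
    refine ⟨k + j, fun c hc => ?_⟩
    rw [smul_add]
    exact K.add_mem (hk c (Ideal.pow_le_pow_right (Nat.le_add_right _ _) hc))
      (hj c (Ideal.pow_le_pow_right (Nat.le_add_left _ _) hc))
  zero_mem' := ⟨0, fun c _ => by simp⟩
  smul_mem' := by
    rintro a u ⟨k, hk⟩
    refine ⟨k, fun c hc => ?_⟩
    rw [smul_comm]
    exact K.smul_mem a (hk c hc)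

lemma mem_isat {I : Ideal A} {K : Submodule A M} {u : M} :
    u ∈ isat I K ↔ ∃ k : ℕ, ∀ c ∈ I ^ k, c • u ∈ K := Iff.rfl

lemma le_isat (I : Ideal A) (K : Submodule A M) : K ≤ isat I K :=
  fun u hu => ⟨0, fun c _ => K.smul_mem c hu⟩

lemma isat_mono {I : Ideal A} {K K' : Submodule A M} (h : K ≤ K') : isat I K ≤ isat I K' :=
  fun _ ⟨k, hk⟩ => ⟨k, fun c hc => h (hk c hc)⟩

lemma isat_comap (I : Ideal A) (f : M →ₗ[A] P) (K : Submodule A P) :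
    isat I (K.comap f) = (isat I K).comap f := by
  ext u
  simp [mem_isat]

lemma exists_pow_smul_le_of_le_isat {I : Ideal A} {K L : Submodule A M} (hL : L.FG)
    (h : L ≤ isat I K) : ∃ k : ℕ, I ^ k • L ≤ K := by
  revert h
  refine Submodule.fg_induction (motive := fun L _ => L ≤ isat I K → ∃ k : ℕ, I ^ k • L ≤ K)
    ?_ ?_ L hL
  · intro u hu
    obtain ⟨k, hk⟩ := hu (Submodule.mem_span_singleton_self u)
    refine ⟨k, Submodule.smul_le.mpr fun c hc v hv => ?_⟩
    obtain ⟨a, rfl⟩ := Submodule.mem_span_singleton.mp hv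
    rw [smul_comm]
    exact K.smul_mem _ (hk c hc)
  · intro L₁ L₂ _ _ h₁ h₂ h
    obtain ⟨k, hk⟩ := h₁ (le_sup_left.trans h)
    obtain ⟨j, hj⟩ := h₂ (le_sup_right.trans h)
    refine ⟨k + j, ?_⟩
    rw [Submodule.smul_sup]
    exact sup_le ((Submodule.smul_mono_left (Ideal.pow_le_pow_right (Nat.le_add_right _ _))).trans hk)
      ((Submodule.smul_mono_left (Ideal.pow_le_pow_right (Nat.le_add_left _ _))).trans hj)

lemma isat_isat [IsNoetherianRing A] (I : Ideal A) (K : Submodule A M) :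
    isat I (isat I K) = isat I K := by
  refine le_antisymm ?_ (le_isat _ _)
  rintro u ⟨k, hk⟩
  have hfg : ((I ^ k) • (Submodule.span A {u})).FG :=
    Submodule.FG.smul ((isNoetherianRing_iff_ideal_fg A).mp inferInstance _)
      (Submodule.fg_span_singleton u)
  obtain ⟨j, hj⟩ := exists_pow_smul_le_of_le_isat (K := K) (I := I) hfg (by
    refine Submodule.smul_le.mpr fun c hc v hv => ?_
    obtain ⟨a, rfl⟩ := Submodule.mem_span_singleton.mp hv
    rw [smul_comm]
    exact Submodule.smul_mem _ _ (hk c hc))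
  refine ⟨j + k, fun c hc => hj ?_⟩
  rw [← mul_smul, ← pow_add]
  exact Submodule.smul_mem_smul hc (Submodule.mem_span_singleton_self u)

lemma isat_eq_of_between [IsNoetherianRing A] {I : Ideal A} {K L : Submodule A M} (h : K ≤ L)
    (h' : L ≤ isat I K) : isat I L = isat I K :=
  le_antisymm ((isat_mono h').trans (isat_isat I K).le) (isat_mono h)

/-- `x N` -/
def xm (x : A) (N : Submodule A M) : Submodule A M := N.map (LinearMap.lsmul A M x)

lemma mem_xm {x : A} {N : Submodule A M} {v : M} : v ∈ xm x N ↔ ∃ u ∈ N, x • u = v := Iff.rfl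

lemma smul_mem_xm {x : A} {N : Submodule A M} {u : M} (h : u ∈ N) : x • u ∈ xm x N := ⟨u, h, rfl⟩

lemma xm_mono {x : A} {N N' : Submodule A M} (h : N ≤ N') : xm x N ≤ xm x N' :=
  Submodule.map_mono h

lemma xm_le {x : A} {N : Submodule A M} : xm x N ≤ N := by
  rintro _ ⟨u, hu, rfl⟩
  exact N.smul_mem x hu

lemma map_xm (f : M →ₗ[A] P) (x : A) (N : Submodule A M) : (xm x N).map f = xm x (N.map f) := by
  ext v
  constructor
  · rintro ⟨_, ⟨u, hu, rfl⟩, rfl⟩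
    exact ⟨f u, ⟨u, hu, rfl⟩, by simp⟩
  · rintro ⟨_, ⟨u, hu, rfl⟩, rfl⟩
    exact ⟨x • u, ⟨u, hu, rfl⟩, by simp⟩

/-- partial degree data: existence of a parameter-like sequence with controlled lengths -/
def PD (I : Ideal A) : ℕ → ℕ → Submodule A M → Prop
  | 0, δ, K => rl K ⊤ ≤ (δ : ℕ∞)
  | d + 1, δ, K => ∃ x ∈ I, ∃ l e : ℕ, l + e ≤ δ ∧ rl K (isat I K) ≤ (l : ℕ∞) ∧
      (∀ u, x • u ∈ isat I K → u ∈ isat I K) ∧ PD I d e (isat I K ⊔ xm x ⊤)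

lemma PD.mono {I : Ideal A} {d δ δ' : ℕ} {K : Submodule A M} (h : PD I d δ K) (hδ : δ ≤ δ') :
    PD I d δ' K := by
  cases d with
  | zero => exact le_trans (show rl K ⊤ ≤ (δ : ℕ∞) from h) (by exact_mod_cast hδ)
  | succ d =>
    obtain ⟨x, hx, l, e, hle, h⟩ := h
    exact ⟨x, hx, l, e, hle.trans hδ, h⟩

lemma comap_sup_xm_top {f : M →ₗ[A] P} (hf : Function.Surjective f) (S : Submodule A P) (x : A) :
    (S ⊔ xm x ⊤).comap f = S.comap f ⊔ xm x ⊤ := by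
  apply le_antisymm
  · intro u hu
    obtain ⟨s, hs, _, ⟨p, -, rfl⟩, h⟩ := Submodule.mem_sup.mp hu
    obtain ⟨m, rfl⟩ := hf p
    refine Submodule.mem_sup.mpr ⟨u - x • m, ?_, x • m, smul_mem_xm trivial, by abel⟩
    rw [Submodule.mem_comap, map_sub, map_smul, ← h]
    simpa using hs
  · refine sup_le (Submodule.comap_mono le_sup_left) ?_
    rintro _ ⟨u, -, rfl⟩
    refine Submodule.mem_sup_right ?_
    exact ⟨f u, trivial, by simp⟩

lemma rl_comap {f : M →ₗ[A] P} (hf : Function.Surjective f) (K L : Submodule A P) :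
    rl (K.comap f) (L.comap f) = rl K L := by
  apply le_antisymm
  · exact rl_le_of_inj f (Submodule.map_comap_le _ _) (fun u _ h => h)
  · refine rl_le_of_map f ?_ (fun u _ h => h)
    rw [Submodule.map_comap_eq_of_surjective hf]
    exact le_sup_left

lemma PD_comap {I : Ideal A} {f : M →ₗ[A] P} (hf : Function.Surjective f) {d δ : ℕ}
    {K : Submodule A P} : PD I d δ (K.comap f) ↔ PD I d δ K := by
  induction d generalizing δ K with
  | zero =>
    have := rl_comap hf K ⊤
    rw [Submodule.comap_top] at this
    change rl (K.comap f) ⊤ ≤ _ ↔ rl K ⊤ ≤ _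
    rw [this]
  | succ d ih =>
    simp only [PD]
    simp only [isat_comap, rl_comap hf, ← comap_sup_xm_top hf, ih, Submodule.mem_comap, map_smul]
    constructor
    · rintro ⟨x, hx, l, e, h1, h2, h3, h4⟩
      refine ⟨x, hx, l, e, h1, h2, fun p hp => ?_, h4⟩
      obtain ⟨u, rfl⟩ := hf p
      exact h3 u hp
    · rintro ⟨x, hx, l, e, h1, h2, h3, h4⟩
      exact ⟨x, hx, l, e, h1, h2, fun u hu => h3 _ hu, h4⟩

lemma PD_T [IsNoetherianRing A] {I : Ideal A} {d ε κ : ℕ} {K₁ K₂ : Submodule A M} (h : K₁ ≤ K₂)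
    (h' : K₂ ≤ isat I K₁) (hκ : rl K₁ K₂ ≤ (κ : ℕ∞)) (hP : PD I d ε K₂) :
    PD I d (ε + κ) K₁ := by
  cases d with
  | zero =>
    have hP' : rl K₂ ⊤ ≤ (ε : ℕ∞) := hP
    change rl K₁ ⊤ ≤ _
    rw [rl_add le_top h]
    push_cast
    rw [add_comm]
    gcongr
  | succ d =>
    obtain ⟨x, hx, l, e, h1, h2, h3, h4⟩ := hP
    rw [isat_eq_of_between h h'] at h2 h3 h4
    refine ⟨x, hx, l + κ, e, by omega, ?_, h3, h4⟩
    rw [rl_add h' h]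
    push_cast
    rw [add_comm]
    gcongr

lemma PD_T' [IsNoetherianRing A] {I : Ideal A} {d ε : ℕ} {K₁ K₂ : Submodule A M} (h : K₁ ≤ K₂)
    (h' : K₂ ≤ isat I K₁) (hP : PD I d ε K₁) : PD I d ε K₂ := by
  cases d with
  | zero => exact (rl_mono h le_rfl).trans hP
  | succ d =>
    obtain ⟨x, hx, l, e, h1, h2, h3, h4⟩ := hP
    have := isat_eq_of_between h h'
    refine ⟨x, hx, l, e, h1, ?_, ?_, ?_⟩
    · rw [this]; exact (rl_mono h le_rfl).trans h2
    · rwa [this]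
    · rwa [this]

lemma PD_length {I : Ideal A} {d δ : ℕ} {K : Submodule A M} (h : PD I d δ K) (k : ℕ) :
    rl (K ⊔ I ^ (k + 1) • ⊤) ⊤ ≤ ((δ * (k + d).choose d : ℕ) : ℕ∞) := by
  induction d generalizing δ K k with
  | zero =>
    have h' : rl K ⊤ ≤ (δ : ℕ∞) := h
    simpa using (rl_mono le_sup_left le_rfl).trans h'
  | succ d ih =>
    obtain ⟨x, hx, l, e, h1, h2, h3, h4⟩ := h
    set S := isat I K with hS
    have key : ∀ k : ℕ, rl (S ⊔ I ^ k • ⊤) ⊤ ≤ ((e * (k + d).choose (d + 1) : ℕ) : ℕ∞) := by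
      intro k
      induction k with
      | zero =>
        have : rl (S ⊔ I ^ 0 • ⊤) ⊤ = 0 := rl_eq_zero.mpr (by simp)
        rw [this]; simp
      | succ k ihk =>
        have hle : S ⊔ I ^ (k + 1) • ⊤ ≤ S ⊔ xm x ⊤ ⊔ I ^ (k + 1) • ⊤ :=
          sup_le_sup_right le_sup_left _
        rw [rl_add le_top hle]
        have hb : rl (S ⊔ I ^ (k + 1) • ⊤) (S ⊔ xm x ⊤ ⊔ I ^ (k + 1) • ⊤) ≤
            rl (S ⊔ I ^ k • ⊤) ⊤ := by
          refine rl_le_of_map (LinearMap.lsmul A M x) ?_ ?_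
          · refine sup_le (sup_le ?_ ?_) ?_
            · exact le_sup_left.trans le_sup_right
            · exact le_sup_left
            · exact le_sup_right.trans le_sup_right
          · intro u _ hu
            have : S ⊔ I ^ k • ⊤ ≤ (S ⊔ I ^ (k + 1) • ⊤).comap (LinearMap.lsmul A M x) := by
              refine sup_le ?_ ?_
              · intro s hs
                exact Submodule.mem_sup_left (S.smul_mem x hs)
              · intro s hs
                refine Submodule.mem_sup_right ?_
                rw [pow_succ', mul_smul]
                exact Submodule.smul_mem_smul hx hs
            exact this hu
        refine (add_le_add (hb.trans ihk) (ih h4 k)).trans ?_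
        norm_cast
        rw [← mul_add, show k + 1 + d = (k + d) + 1 by ring, Nat.choose_succ_succ, add_comm]
    have hKS : K ≤ S := le_isat I K
    have hle : K ⊔ I ^ (k + 1) • ⊤ ≤ S ⊔ I ^ (k + 1) • ⊤ := sup_le_sup_right hKS _
    rw [rl_add le_top hle]
    have hb : rl (K ⊔ I ^ (k + 1) • ⊤) (S ⊔ I ^ (k + 1) • ⊤) ≤ rl K S := by
      refine rl_le_of_map LinearMap.id ?_ ?_
      · simp only [Submodule.map_id]
        exact sup_le le_sup_left (le_sup_right.trans le_sup_right)
      · intro u _ hu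
        exact Submodule.mem_sup_left hu
    refine (add_le_add (hb.trans h2) (key (k + 1))).trans ?_
    norm_cast
    have hc : 1 ≤ (k + (d + 1)).choose (d + 1) := Nat.choose_pos (by omega)
    rw [show k + 1 + d = k + (d + 1) by ring]
    calc l + e * (k + (d + 1)).choose (d + 1) ≤ l * (k + (d + 1)).choose (d + 1)
          + e * (k + (d + 1)).choose (d + 1) := by
            gcongr; exact Nat.le_mul_of_pos_right _ hc
      _ = (l + e) * (k + (d + 1)).choose (d + 1) := by ring
      _ ≤ _ := by gcongr

end PDsec


section RegSec

variable {A : Type*} [CommRing A] {M : Type*} [AddCommGroup M] [Module A M]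
  {P : Type*} [AddCommGroup P] [Module A P]

lemma smr (I : Ideal A) {N N' : Submodule A M} (h : N ≤ N') : I • N ≤ I • N' :=
  Submodule.smul_mono le_rfl h

/-- `I`-filtration data -/
structure Fil (I : Ideal A) (N : ℕ → Submodule A M) (R : ℕ) : Prop where
  anti : ∀ n, N (n + 1) ≤ N n
  smul : ∀ n, I • N n ≤ N (n + 1)
  stab : ∀ n, R ≤ n → N (n + 1) ≤ I • N n

lemma Fil.antitone {I : Ideal A} {N : ℕ → Submodule A M} {R : ℕ} (h : Fil I N R) : Antitone N :=
  antitone_nat_of_succ_le h.anti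

lemma Fil.smul_mem {I : Ideal A} {N : ℕ → Submodule A M} {R : ℕ} (h : Fil I N R) {x : A}
    (hx : x ∈ I) {n : ℕ} {u : M} (hu : u ∈ N n) : x • u ∈ N (n + 1) :=
  h.smul n (Submodule.smul_mem_smul hx hu)

lemma Fil.pow_smul_mem {I : Ideal A} {N : ℕ → Submodule A M} {R : ℕ} (h : Fil I N R) {k : ℕ}
    {x : A} (hx : x ∈ I ^ k) {n : ℕ} {u : M} (hu : u ∈ N n) : x • u ∈ N (n + k) := by
  have key : I ^ k • N n ≤ N (n + k) := by
    clear hx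
    induction k with
    | zero => simp
    | succ k ih =>
      rw [pow_succ', mul_smul]
      exact (smr _ ih).trans (h.smul _)
  exact key (Submodule.smul_mem_smul hx hu)

lemma Fil.map {I : Ideal A} {N : ℕ → Submodule A M} {R : ℕ} (h : Fil I N R) (f : M →ₗ[A] P) :
    Fil I (fun n => (N n).map f) R where
  anti n := Submodule.map_mono (h.anti n)
  smul n := by
    rw [← Submodule.map_smul'']
    exact Submodule.map_mono (h.smul n)
  stab n hn := by
    rw [← Submodule.map_smul'']
    exact Submodule.map_mono (h.stab n hn)

/-- `(xs) N` -/
def QN : List A → Submodule A M → Submodule A M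
  | [], _ => ⊥
  | x :: xs, N => xm x N ⊔ QN xs N

lemma xm_sup (x : A) (N N' : Submodule A M) : xm x (N ⊔ N') = xm x N ⊔ xm x N' :=
  Submodule.map_sup _ _ _

lemma QN_sup (xs : List A) (N N' : Submodule A M) : QN xs (N ⊔ N') = QN xs N ⊔ QN xs N' := by
  induction xs with
  | nil => simp [QN]
  | cons x xs ih => simp only [QN, ih, xm_sup]; ac_rfl

lemma QN_mono (xs : List A) {N N' : Submodule A M} (h : N ≤ N') : QN xs N ≤ QN xs N' := by
  induction xs with
  | nil => simp [QN]
  | cons x xs ih => exact sup_le_sup (xm_mono h) ih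

lemma QN_le (xs : List A) (N : Submodule A M) : QN xs N ≤ N := by
  induction xs with
  | nil => simp [QN]
  | cons x xs ih => exact sup_le xm_le ih

lemma xm_le_smul {I : Ideal A} {x : A} (hx : x ∈ I) (N : Submodule A M) : xm x N ≤ I • N := by
  rintro _ ⟨u, hu, rfl⟩
  exact Submodule.smul_mem_smul hx hu

lemma QN_le_smul {I : Ideal A} {xs : List A} (hxs : ∀ x ∈ xs, x ∈ I) (N : Submodule A M) :
    QN xs N ≤ I • N := by
  induction xs with
  | nil => simp [QN]
  | cons x xs ih =>
    exact sup_le (xm_le_smul (hxs x (by simp)) N) (ih fun y hy => hxs y (by simp [hy]))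

lemma smul_xm_le (I : Ideal A) (x : A) (N : Submodule A M) : I • xm x N ≤ xm x (I • N) := by
  refine Submodule.smul_le.mpr ?_
  rintro c hc _ ⟨u, hu, rfl⟩
  exact ⟨c • u, Submodule.smul_mem_smul hc hu, by simp only [LinearMap.lsmul_apply]; rw [smul_comm]⟩

lemma xm_xm (x y : A) (N : Submodule A M) : xm x (xm y N) = xm y (xm x N) := by
  ext v
  constructor
  · rintro ⟨_, ⟨u, hu, rfl⟩, rfl⟩
    exact ⟨x • u, ⟨u, hu, rfl⟩, by simp only [LinearMap.lsmul_apply]; rw [smul_comm]⟩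
  · rintro ⟨_, ⟨u, hu, rfl⟩, rfl⟩
    exact ⟨y • u, ⟨u, hu, rfl⟩, by simp only [LinearMap.lsmul_apply]; rw [smul_comm]⟩

lemma xm_bot (x : A) : xm x (⊥ : Submodule A M) = ⊥ := Submodule.map_bot _

lemma QN_xm (xs : List A) (x : A) (N : Submodule A M) : QN xs (xm x N) = xm x (QN xs N) := by
  induction xs with
  | nil => simp [QN, xm_bot]
  | cons y xs ih => simp only [QN, ih, xm_sup, xm_xm x y]

lemma smul_QN_le (I : Ideal A) (xs : List A) (N : Submodule A M) :
    I • QN xs N ≤ QN xs (I • N) := by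
  induction xs with
  | nil => simp [QN]
  | cons x xs ih =>
    simp only [QN, Submodule.smul_sup]
    exact sup_le_sup (smul_xm_le I x N) ih

/-- partial regularity -/
def Reg (N : ℕ → Submodule A M) (m : ℕ) : List A → (ℕ → Submodule A M) → Prop
  | [], K => ∀ n, m ≤ n → N n ≤ K n
  | x :: xs, K => (∀ n, m ≤ n → ∀ u ∈ N n, x • u ∈ K (n + 1) → u ∈ K n) ∧
      Reg N m xs (fun n => K n ⊔ xm x (N (n - 1)))

lemma Reg.mono {N : ℕ → Submodule A M} {m m' : ℕ} (hm : m ≤ m') {xs : List A}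
    {K : ℕ → Submodule A M} (h : Reg N m xs K) : Reg N m' xs K := by
  induction xs generalizing K with
  | nil => exact fun n hn => h n (hm.trans hn)
  | cons x xs ih => exact ⟨fun n hn => h.1 n (hm.trans hn), ih h.2⟩

lemma Fil.xm_pred {I : Ideal A} {N : ℕ → Submodule A M} {R : ℕ} (h : Fil I N R) {x : A}
    (hx : x ∈ I) (n : ℕ) : xm x (N (n - 1)) ≤ N n := by
  cases n with
  | zero => exact xm_le
  | succ n => exact (xm_le_smul hx _).trans (h.smul n)

lemma Reg.congr {I : Ideal A} {N : ℕ → Submodule A M} {R m : ℕ} (hN : Fil I N R) {xs : List A}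
    (hxs : ∀ x ∈ xs, x ∈ I) {K K' : ℕ → Submodule A M}
    (hK : ∀ n, m ≤ n → K n ⊓ N n = K' n ⊓ N n) (h : Reg N m xs K) : Reg N m xs K' := by
  induction xs generalizing K K' with
  | nil =>
    intro n hn u hu
    have : u ∈ K n ⊓ N n := ⟨h n hn hu, hu⟩
    rw [hK n hn] at this
    exact this.1
  | cons x xs ih =>
    have hx : x ∈ I := hxs x (by simp)
    refine ⟨fun n hn u hu hxu => ?_, ih (fun y hy => hxs y (by simp [hy])) (fun n hn => ?_) h.2⟩
    · have h1 : x • u ∈ K' (n + 1) ⊓ N (n + 1) := ⟨hxu, hN.smul_mem hx hu⟩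
      rw [← hK (n + 1) (by omega)] at h1
      have h2 : u ∈ K n ⊓ N n := ⟨h.1 n hn u hu h1.1, hu⟩
      rw [hK n hn] at h2
      exact h2.1
    · have hle := hN.xm_pred hx n
      have e : ∀ J : Submodule A M, (J ⊔ xm x (N (n - 1))) ⊓ N n = xm x (N (n - 1)) ⊔ J ⊓ N n := by
        intro J
        rw [sup_comm, ← sup_inf_assoc_of_le _ hle]
      rw [e, e, hK n hn]

lemma Reg.map {f : M →ₗ[A] P} {N : ℕ → Submodule A M} {m : ℕ} {xs : List A}
    {K : ℕ → Submodule A M} (hK : ∀ n, LinearMap.ker f ≤ K n) :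
    Reg (fun n => (N n).map f) m xs (fun n => (K n).map f) ↔ Reg N m xs K := by
  have hmem : ∀ n u, f u ∈ (K n).map f ↔ u ∈ K n := by
    intro n u
    constructor
    · rintro ⟨v, hv, hvu⟩
      have : u - v ∈ LinearMap.ker f := by simp [hvu]
      simpa using (K n).add_mem (hK n this) hv
    · intro h
      exact ⟨u, h, rfl⟩
  induction xs generalizing K with
  | nil =>
    constructor
    · intro h n hn u hu
      exact (hmem n u).mp (h n hn ⟨u, hu, rfl⟩)
    · intro h n hn
      exact Submodule.map_mono (h n hn)
  | cons x xs ih =>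
    have hK' : ∀ n, LinearMap.ker f ≤ K n ⊔ xm x (N (n - 1)) :=
      fun n => (hK n).trans le_sup_left
    have e := ih hK' (by
      intro n u
      constructor
      · rintro ⟨v, hv, hvu⟩
        have : u - v ∈ LinearMap.ker f := by simp [hvu]
        simpa using (K n ⊔ xm x (N (n - 1))).add_mem (hK' n this) hv
      · intro h
        exact ⟨u, h, rfl⟩)
    simp only [Submodule.map_sup, map_xm] at e
    simp only [Reg]
    refine and_congr ?_ e
    constructor
    · intro h n hn u hu hxu
      have := h n hn (f u) ⟨u, hu, rfl⟩ (by rw [← map_smul]; exact ⟨_, hxu, rfl⟩)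
      exact (hmem n u).mp this
    · rintro h n hn _ ⟨u, hu, rfl⟩ hxu
      rw [← map_smul] at hxu
      exact ⟨u, h n hn u hu ((hmem _ _).mp hxu), rfl⟩

lemma Reg.red {N : ℕ → Submodule A M} {m : ℕ} {xs : List A}
    {K : ℕ → Submodule A M} (h : Reg N m xs K) {n : ℕ} (hn : m ≤ n) :
    N n ≤ K n ⊔ QN xs (N (n - 1)) := by
  induction xs generalizing K with
  | nil => exact (h n hn).trans le_sup_left
  | cons x xs ih =>
    refine (ih h.2).trans ?_
    simp only [QN]
    rw [sup_assoc]

lemma Reg.syz {I : Ideal A} {N : ℕ → Submodule A M} {R m : ℕ} (hN : Fil I N R) (hm : 1 ≤ m)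
    {xs : List A} (hxs : ∀ x ∈ xs, x ∈ I) {K : ℕ → Submodule A M}
    (hK : ∀ n, I • K n ≤ K (n + 1)) (h : Reg N m xs K) {p : ℕ} (hp : m ≤ p) :
    QN xs (N p) ⊓ K (p + 1) ≤ QN xs (K p ⊓ N p) := by
  induction xs generalizing K with
  | nil => simp [QN]
  | cons x xs ih =>
    have hx : x ∈ I := hxs x (by simp)
    have hxs' : ∀ y ∈ xs, y ∈ I := fun y hy => hxs y (by simp [hy])
    obtain ⟨p, rfl⟩ : ∃ p', p = p' + 1 := ⟨p - 1, by omega⟩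
    have ih' := ih hxs' (K := fun n => K n ⊔ xm x (N (n - 1))) (by
      intro n
      rw [Submodule.smul_sup]
      refine sup_le_sup (hK n) ((smul_xm_le _ _ _).trans (xm_mono ?_))
      cases n with
      | zero => exact Submodule.smul_le_right
      | succ n => exact hN.smul n) h.2
    simp only [Nat.add_sub_cancel] at ih'
    rintro v ⟨hv, hvK⟩
    obtain ⟨_, ⟨a, ha, rfl⟩, w, hw, rfl⟩ := Submodule.mem_sup.mp hv
    have hw' : w ∈ QN xs (N (p + 1)) ⊓ (K (p + 1 + 1) ⊔ xm x (N (p + 1))) := by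
      refine ⟨hw, Submodule.mem_sup.mpr ⟨_, hvK, x • (-a), smul_mem_xm (neg_mem ha), ?_⟩⟩
      simp
    have h2 := ih' hw'
    have hle := hN.xm_pred hx (p + 1)
    simp only [Nat.add_sub_cancel] at hle
    have e : (K (p + 1) ⊔ xm x (N p)) ⊓ N (p + 1) = xm x (N p) ⊔ K (p + 1) ⊓ N (p + 1) := by
      rw [sup_comm, ← sup_inf_assoc_of_le _ hle]
    rw [e, QN_sup, QN_xm] at h2
    obtain ⟨_, ⟨w2, hw2, rfl⟩, w1, hw1, rfl⟩ := Submodule.mem_sup.mp h2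
    have hw2' : w2 ∈ N (p + 1) := hN.smul p (QN_le_smul hxs' _ hw2)
    have hw1' : w1 ∈ K (p + 1 + 1) :=
      hK _ (smr _ inf_le_left (QN_le_smul hxs' _ hw1))
    simp only [LinearMap.lsmul_apply] at hvK ⊢
    have h3 : x • (a + w2) ∈ K (p + 1 + 1) := by
      have := (K (p + 1 + 1)).sub_mem hvK hw1'
      convert this using 1
      rw [smul_add]; abel
    have h4 : a + w2 ∈ K (p + 1) := h.1 _ hp _ (add_mem ha hw2') h3
    refine Submodule.mem_sup.mpr ⟨x • (a + w2), smul_mem_xm ⟨h4, add_mem ha hw2'⟩, w1, hw1, ?_⟩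
    rw [smul_add]; abel

lemma Reg.r0 {I : Ideal A} {N : ℕ → Submodule A M} {R m : ℕ} (hN : Fil I N R)
    {xs : List A} (hxs : ∀ x ∈ xs, x ∈ I) {K : ℕ → Submodule A M} (h : Reg N m xs K)
    {n j : ℕ} (hn : m ≤ n) {u : M} (hu : u ∈ N n) (hj : ∀ c ∈ I ^ j, c • u ∈ K (n + j)) :
    u ∈ K n := by
  cases xs with
  | nil => exact h n hn hu
  | cons x xs =>
    have hx : x ∈ I := hxs x (by simp)
    have : x ^ j • u ∈ K (n + j) := hj _ (Ideal.pow_mem_pow hx j)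
    clear hj
    induction j with
    | zero => simpa using this
    | succ j ih =>
      apply ih
      refine h.1 (n + j) (by omega) _ (hN.pow_smul_mem (Ideal.pow_mem_pow hx j) hu) ?_
      rw [← mul_smul, ← pow_succ']
      exact this

lemma le_of_le_sup_smul {I : Ideal A} {K B : Submodule A M} (h : B ≤ K ⊔ I • B) {j : ℕ}
    (hj : I ^ j • B ≤ K) : B ≤ K := by
  have key : ∀ i : ℕ, B ≤ K ⊔ I ^ i • B := by
    intro i
    induction i with
    | zero => simp
    | succ i ih =>
      calc B ≤ K ⊔ I ^ i • B := ih
        _ ≤ K ⊔ I ^ i • (K ⊔ I • B) := sup_le_sup_left (smr _ h) _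
        _ ≤ K ⊔ I ^ (i + 1) • B := by
          rw [Submodule.smul_sup, ← mul_smul, ← pow_succ]
          exact sup_le le_sup_left (sup_le (Submodule.smul_le_right.trans le_sup_left) le_sup_right)
  exact (key j).trans (sup_le le_rfl hj)

lemma Reg.torsion [IsNoetherianRing A] [Module.Finite A M] {I : Ideal A}
    {N : ℕ → Submodule A M} {R m l : ℕ}
    (hN : Fil I N R) (hm : 1 ≤ m) (hmR : R ≤ m) {xs : List A} (hxs : ∀ x ∈ xs, x ∈ I)
    {K : Submodule A M} (h : Reg N m xs (fun _ => isat I K))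
    (hl : rl K (isat I K) ≤ (l : ℕ∞)) : Reg N (m + l) xs (fun _ => K) := by
  set L := isat I K with hL
  have hKL : K ≤ L := le_isat I K
  have hstep : ∀ p, m ≤ p → N (p + 1) ⊓ L ≤ I • (N p ⊓ L) := by
    rintro p hp v ⟨hv, hvL⟩
    obtain ⟨p, rfl⟩ : ∃ p', p = p' + 1 := ⟨p - 1, by omega⟩
    have h1 : N (p + 1) ≤ (N (p + 1) ⊓ L) ⊔ QN xs (N p) := by
      have hle : QN xs (N p) ≤ N (p + 1) := (QN_le_smul hxs _).trans (hN.smul p)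
      have := h.red hp
      simp only [Nat.add_sub_cancel] at this
      have h2 : N (p + 1) ≤ (QN xs (N p) ⊔ L) ⊓ N (p + 1) :=
        le_inf (by rw [sup_comm]; exact this) le_rfl
      rwa [sup_inf_assoc_of_le _ hle, sup_comm, inf_comm] at h2
    have h2 : N (p + 1 + 1) ≤ I • (N (p + 1) ⊓ L) ⊔ QN xs (N (p + 1)) := by
      refine (hN.stab (p + 1) (by omega)).trans ((smr _ h1).trans ?_)
      rw [Submodule.smul_sup]
      exact sup_le_sup_left ((smul_QN_le _ _ _).trans (QN_mono _ (hN.smul p))) _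
    obtain ⟨b, hb, w, hw, rfl⟩ := Submodule.mem_sup.mp (h2 hv)
    have hbL : b ∈ L := (Submodule.smul_le_right.trans inf_le_right : I • (N (p + 1) ⊓ L) ≤ L) hb
    have hwL : w ∈ L := by simpa using L.sub_mem hvL hbL
    have := h.syz hN hm hxs (fun _ => Submodule.smul_le_right) hp ⟨hw, hwL⟩
    refine add_mem hb ?_
    rw [inf_comm]
    exact QN_le_smul hxs _ this
  have hdrop : ∀ i, N (m + i) ⊓ L ≤ K ∨ rl K (K ⊔ N (m + i) ⊓ L) + i ≤ l := by
    intro i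
    induction i with
    | zero =>
      right
      simpa using (rl_mono le_rfl (sup_le hKL inf_le_right)).trans hl
    | succ i ih =>
      have hanti : N (m + (i + 1)) ⊓ L ≤ N (m + i) ⊓ L := inf_le_inf_right _ (hN.anti (m + i))
      rcases ih with ih | ih
      · exact Or.inl (hanti.trans ih)
      · rcases eq_or_ne (rl (K ⊔ N (m + (i + 1)) ⊓ L) (K ⊔ N (m + i) ⊓ L)) 0 with h0 | h0
        · left
          rw [rl_eq_zero] at h0
          refine hanti.trans ?_
          obtain ⟨j, hj⟩ := exists_pow_smul_le_of_le_isat (I := I) (K := K)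
            (L := N (m + i) ⊓ L) (IsNoetherian.noetherian _) inf_le_right
          refine le_of_le_sup_smul (I := I) (j := j) ?_ hj
          exact le_sup_right.trans (h0.trans (sup_le_sup_left (hstep (m + i) (Nat.le_add_right _ _)) _))
        · right
          rw [rl_add (sup_le_sup_left hanti K) le_sup_left] at ih
          refine le_trans ?_ ih
          push_cast
          rw [add_assoc, add_comm (i : ℕ∞) 1]
          gcongr
          exact Order.one_le_iff_pos.mpr (pos_iff_ne_zero.mpr h0)
  have hfin : ∀ n, m + l ≤ n → N n ⊓ L ≤ K := by
    intro n hn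
    refine (inf_le_inf_right _ (hN.antitone hn)).trans ?_
    rcases hdrop l with h0 | h0
    · exact h0
    · have : rl K (K ⊔ N (m + l) ⊓ L) = 0 := by
        have hh : rl K (K ⊔ N (m + l) ⊓ L) + l ≤ 0 + l := by simpa using h0
        have := (ENat.add_le_add_iff_right (ENat.natCast_ne_top l)).mp hh
        simpa using this
      rw [rl_eq_zero] at this
      exact le_sup_right.trans this
  refine Reg.congr hN hxs ?_ (h.mono (Nat.le_add_right m l))
  intro n hn
  apply le_antisymm
  · exact le_inf (by rw [inf_comm]; exact hfin n hn) inf_le_right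
  · exact inf_le_inf_right _ hKL

end RegSec


section MainStep

variable {A : Type*} [CommRing A] {P : Type*} [AddCommGroup P] [Module A P]

/-- setting of the main step: `x` acts bijectively on `P` and is superficial for `N` -/
structure MS (I : Ideal A) (N : ℕ → Submodule A P) (R N0 : ℕ) (x : A) : Prop where
  fil : Fil I N R
  hx : x ∈ I
  inj : ∀ u : P, x • u = 0 → u = 0
  surj : ∀ u : P, ∃ v, x • v = u
  sup : ∀ n, N0 ≤ n → ∀ u ∈ N 0, x • u ∈ N (n + 1) → u ∈ N n

lemma Fil.pow_step {I : Ideal A} {N : ℕ → Submodule A P} {R : ℕ} (hN : Fil I N R) {n j j' : ℕ}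
    (hj : j ≤ j') {w : P} (h : ∀ c ∈ I ^ j, c • w ∈ N (n + j)) :
    ∀ c ∈ I ^ j', c • w ∈ N (n + j') := by
  obtain ⟨i, rfl⟩ := Nat.exists_eq_add_of_le hj
  intro c hc
  rw [pow_add, mul_comm] at hc
  refine Submodule.mul_induction_on hc ?_ ?_
  · intro a ha b hb
    rw [mul_smul, ← add_assoc]
    exact hN.pow_smul_mem ha (h b hb)
  · intro a b ha hb
    rw [add_smul]
    exact add_mem ha hb

/-- the saturation of the filtration -/
def Wf {I : Ideal A} {N : ℕ → Submodule A P} {R : ℕ} (hN : Fil I N R) (n : ℕ) :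
    Submodule A P where
  carrier := {w | ∃ j : ℕ, ∀ c ∈ I ^ j, c • w ∈ N (n + j)}
  add_mem' := by
    rintro u v ⟨j, hj⟩ ⟨i, hi⟩
    refine ⟨j + i, fun c hc => ?_⟩
    rw [smul_add]
    exact add_mem (hN.pow_step (Nat.le_add_right j i) hj c hc)
      (hN.pow_step (Nat.le_add_left i j) hi c hc)
  zero_mem' := ⟨0, fun c _ => by simp⟩
  smul_mem' := by
    rintro a u ⟨j, hj⟩
    refine ⟨j, fun c hc => ?_⟩
    rw [smul_comm]
    exact Submodule.smul_mem _ _ (hj c hc)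

section
variable {I : Ideal A} {N : ℕ → Submodule A P} {R : ℕ} (hN : Fil I N R)

lemma mem_Wf {n : ℕ} {w : P} : w ∈ Wf hN n ↔ ∃ j : ℕ, ∀ c ∈ I ^ j, c • w ∈ N (n + j) := Iff.rfl

lemma le_Wf (n : ℕ) : N n ≤ Wf hN n := fun _ hw => ⟨0, fun c _ => Submodule.smul_mem _ c hw⟩

lemma Wf_anti : Antitone (Wf hN) := by
  intro n n' h w ⟨j, hj⟩
  exact ⟨j, fun c hc => hN.antitone (by omega) (hj c hc)⟩

lemma smul_mem_Wf {a : A} (ha : a ∈ I) {n : ℕ} {w : P} (hw : w ∈ Wf hN n) :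
    a • w ∈ Wf hN (n + 1) := by
  obtain ⟨j, hj⟩ := hw
  refine ⟨j, fun c hc => ?_⟩
  rw [smul_smul, show n + 1 + j = n + (j + 1) by ring]
  refine hN.pow_step (Nat.le_succ j) hj _ ?_
  rw [pow_succ]
  exact Ideal.mul_mem_mul hc ha

lemma smul_Wf_le (n : ℕ) : I • Wf hN n ≤ Wf hN (n + 1) :=
  Submodule.smul_le.mpr fun _ ha _ hw => smul_mem_Wf hN ha hw

lemma xm_Wf_le {x : A} (hx : x ∈ I) (n : ℕ) : xm x (Wf hN n) ≤ Wf hN (n + 1) :=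
  (xm_le_smul hx _).trans (smul_Wf_le hN n)

end

namespace MS

variable {I : Ideal A} {N : ℕ → Submodule A P} {R N0 m : ℕ} {x : A}

lemma cancel (h : MS I N R N0 x) {u v : P} (huv : x • u = x • v) : u = v :=
  sub_eq_zero.mp (h.inj _ (by rw [smul_sub, huv, sub_self]))

lemma mem_of_xm (h : MS I N R N0 x) {N' : Submodule A P} {u : P} (hu : x • u ∈ xm x N') : u ∈ N' := by
  obtain ⟨v, hv, hvu⟩ := hu
  rw [← h.cancel hvu]
  exact hv

/-- descend from `x w ∈ W (n+1)` when `I^j w ⊆ N 0` -/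
lemma desc (h : MS I N R N0 x) {n j : ℕ} {w : P} (hw : x • w ∈ Wf h.fil (n + 1)) (hj : ∀ c ∈ I ^ j, c • w ∈ N 0) :
    w ∈ Wf h.fil n := by
  obtain ⟨i, hi⟩ := hw
  refine ⟨j + i + N0, fun c hc => ?_⟩
  have h1 : c ∈ I ^ j := Ideal.pow_le_pow_right (by omega) hc
  refine h.sup _ (by omega) _ (hj c h1) ?_
  have := h.fil.pow_step (show i ≤ j + i + N0 by omega) hi c hc
  rw [smul_comm]
  convert this using 2
  ring

lemma mem_Wf_of_mem_zero (h : MS I N R N0 x) {n : ℕ} {u : P} (hu : u ∈ N 0) (hxu : x • u ∈ N (n + 1)) :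
    u ∈ Wf h.fil n :=
  h.desc (j := 0) (le_Wf _ _ hxu) (fun c _ => Submodule.smul_mem _ _ hu)

lemma pow_smul_zero (h : MS I N R N0 x) {n : ℕ} {w : P} (hw : w ∈ Wf h.fil n) : ∃ j : ℕ, ∀ c ∈ I ^ j, c • w ∈ N 0 := by
  obtain ⟨j, hj⟩ := hw
  exact ⟨j, fun c hc => h.fil.antitone (Nat.zero_le _) (hj c hc)⟩

/-- `x W ∩ N_n ⊆ x N` -/
lemma r0x (h : MS I N R N0 x) {xs : List A} (hxs : ∀ y ∈ xs, y ∈ I)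
    (hreg : Reg N m xs (fun _ => xm x (N 0))) {n k : ℕ} (hn : m ≤ n) {w : P} (hw : w ∈ Wf h.fil k) (hxw : x • w ∈ N n) :
    w ∈ N 0 := by
  obtain ⟨j, hj⟩ := h.pow_smul_zero hw
  apply h.mem_of_xm
  refine hreg.r0 h.fil hxs hn hxw (j := j) fun c hc => ?_
  rw [smul_comm]
  exact smul_mem_xm (hj c hc)

lemma step1 (h : MS I N R N0 x) {xs : List A} (hxs : ∀ y ∈ xs, y ∈ I)
    (hreg : Reg N m xs (fun _ => xm x (N 0))) {n : ℕ} (hn : N0 ≤ n) (hn' : m ≤ n + 1) : Wf h.fil n ≤ N n := by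
  rintro w ⟨j, hj⟩
  induction j generalizing n w with
  | zero => simpa using hj 1 (by simp)
  | succ j ih =>
    have ha : ∀ a ∈ I, a • w ∈ N (n + 1) := by
      intro a ha
      refine ih (n := n + 1) (by omega) (by omega) fun c hc => ?_
      rw [smul_smul, show n + 1 + j = n + (j + 1) by ring]
      exact hj _ (by rw [pow_succ]; exact Ideal.mul_mem_mul hc ha)
    refine h.sup n hn w ?_ (ha x h.hx)
    apply h.mem_of_xm
    refine hreg.r0 h.fil hxs hn' (ha x h.hx) (j := 1) fun c hc => ?_
    rw [smul_comm]
    exact smul_mem_xm (h.fil.antitone (Nat.zero_le _) (ha c (by simpa using hc)))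

lemma step2 (h : MS I N R N0 x) {y : A} {ys : List A} (hxs : ∀ z ∈ y :: ys, z ∈ I)
    (hreg : Reg N m (y :: ys) (fun _ => xm x (N 0))) (hI : I.FG) {p : ℕ} (hp : m ≤ p + 1) :
    Wf h.fil (p + 1) ≤ N (p + 1) ⊔ xm x (Wf h.fil p) := by
  have hy : y ∈ I := hxs y (by simp)
  have hys : ∀ z ∈ ys, z ∈ I := fun z hz => hxs z (by simp [hz])
  rintro w ⟨j, hj⟩
  induction j generalizing p w with
  | zero => exact Submodule.mem_sup_left (by simpa using hj 1 (by simp))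
  | succ j ih =>
    have hwW : w ∈ Wf h.fil (p + 1) := ⟨_, hj⟩
    replace ih := fun (q : ℕ) (hq : m ≤ q + 1) (v : P) => @ih q hq v
    have ha : ∀ a ∈ I, ∃ g ∈ N (p + 2), ∃ v ∈ Wf h.fil (p + 1), a • w = g + x • v := by
      intro a ha
      have := ih (p + 1) (by omega) (a • w) fun c hc => by
        rw [smul_smul, show p + 1 + 1 + j = p + 1 + (j + 1) by ring]
        exact hj _ (by rw [pow_succ]; exact Ideal.mul_mem_mul hc ha)
      obtain ⟨g, hg, _, ⟨v, hv, rfl⟩, hh⟩ := Submodule.mem_sup.mp this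
      exact ⟨g, hg, v, hv, hh.symm⟩
    obtain ⟨gy, hgy, wy, hwy, hyw⟩ := ha y hy
    -- commutation
    have hcomm : ∀ a ∈ I, ∀ g ∈ N (p + 2), ∀ v ∈ Wf h.fil (p + 1), a • w = g + x • v →
        a • gy - y • g ∈ xm x (N 0) := by
      intro a ha g hg v hv hav
      have e : a • gy - y • g = x • (y • v - a • wy) := by
        have e1 : gy = y • w - x • wy := by rw [hyw]; abel
        have e2 : g = a • w - x • v := by rw [hav]; abel
        rw [e1, e2]
        simp only [smul_sub, smul_smul]
        rw [mul_comm a y, mul_comm a x, mul_comm y x]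
        abel
      rw [e]
      refine smul_mem_xm (h.r0x hxs hreg (n := p + 3) (by omega)
        (k := p + 2) (sub_mem (smul_mem_Wf _ hy hv) (smul_mem_Wf _ ha hwy)) ?_)
      rw [← e]
      exact sub_mem (h.fil.smul_mem ha hgy) (h.fil.smul_mem hy hg)
    have hgy' : gy ∈ xm x (N 0) ⊔ xm y (N (p + 1)) := by
      have := hreg.2.r0 h.fil hys (n := p + 2) (j := 1) (by omega) hgy (fun c hc => by
        have hc' : c ∈ I := by simpa using hc
        obtain ⟨g, hg, v, hv, hcv⟩ := ha c hc'
        have h1 := hcomm c hc' g hg v hv hcv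
        refine Submodule.mem_sup.mpr ⟨_, h1, y • g, smul_mem_xm hg, by abel⟩)
      exact this
    obtain ⟨_, ⟨u0, hu0, rfl⟩, _, ⟨g, hg, rfl⟩, hsum⟩ := Submodule.mem_sup.mp hgy'
    simp only [LinearMap.lsmul_apply] at hsum
    obtain ⟨w', hw'⟩ := h.surj (w - g)
    have hIw' : ∀ a ∈ I, a • w' ∈ Wf h.fil 0 := by
      intro a haI
      obtain ⟨ga, hga, va, hva, hav⟩ := ha a haI
      have h1 := hcomm a haI ga hga va hva hav
      have h2 : a • g - ga ∈ xm x (N 0) := by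
        refine hreg.1 (p + 2) (by omega) _ (sub_mem (h.fil.smul_mem haI hg) hga) ?_
        have e : y • (a • g - ga) = (a • gy - y • ga) - x • (a • u0) := by
          rw [← hsum]
          simp only [smul_sub, smul_smul, smul_add]
          rw [mul_comm a y, mul_comm a x]
          abel
        rw [e]
        exact sub_mem h1 (smul_mem_xm (Submodule.smul_mem _ _ hu0))
      obtain ⟨t, ht, hta⟩ := h2
      simp only [LinearMap.lsmul_apply] at hta
      have e : a • w' = va - t := by
        apply h.cancel
        rw [smul_comm x a, hw', smul_sub, smul_sub, hta, hav]
        abel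
      rw [e]
      exact sub_mem (Wf_anti h.fil (Nat.zero_le _) hva) (le_Wf _ _ ht)
    have hj' : ∃ j, ∀ c ∈ I ^ j, c • w' ∈ N 0 := by
      have hle : I • Submodule.span A {w'} ≤ isat I (N 0) := by
        refine Submodule.smul_le.mpr fun a ha v hv => ?_
        obtain ⟨b, rfl⟩ := Submodule.mem_span_singleton.mp hv
        rw [smul_comm]
        exact Submodule.smul_mem _ _ (h.pow_smul_zero (hIw' a ha))
      obtain ⟨k, hk⟩ := exists_pow_smul_le_of_le_isat
        (Submodule.FG.smul hI (Submodule.fg_span_singleton w')) hle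
      refine ⟨k + 1, fun c hc => hk ?_⟩
      rw [← mul_smul, ← pow_succ]
      exact Submodule.smul_mem_smul hc (Submodule.mem_span_singleton_self _)
    obtain ⟨j', hj'⟩ := hj'
    have hw'W : w' ∈ Wf h.fil p :=
      h.desc (by rw [hw']; exact sub_mem hwW (le_Wf _ _ hg)) hj'
    exact Submodule.mem_sup.mpr ⟨g, hg, x • w', smul_mem_xm hw'W, by rw [hw']; abel⟩

/-- counting lemma -/
lemma count (h : MS I N R N0 x) {c T : ℕ} (hi : ∀ n, m ≤ n → Wf h.fil (n + 1) ≤ N (n + 1) ⊔ xm x (Wf h.fil n))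
    (hii : ∀ n, m ≤ n →
      (∀ w ∈ Wf h.fil n, x • w ∈ N (n + 1) ⊔ Wf h.fil (n + 2) → w ∈ N n ⊔ Wf h.fil (n + 1)) →
      (∀ w ∈ Wf h.fil (n + 1), x • w ∈ N (n + 2) ⊔ Wf h.fil (n + 3) →
        w ∈ N (n + 1) ⊔ Wf h.fil (n + 2)))
    (hiii : ∀ n, T ≤ n → Wf h.fil n ≤ N n)
    (hiv : rl (N m ⊔ Wf h.fil (m + 1)) (Wf h.fil m) ≤ (c : ℕ∞)) {n : ℕ} (hn : m + c ≤ n) :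
    Wf h.fil n ≤ N n := by
  set W := Wf h.fil with hW
  let Z : ℕ → Prop := fun n => ∀ w ∈ W n, x • w ∈ N (n + 1) ⊔ W (n + 2) → w ∈ N n ⊔ W (n + 1)
  have hZ : ∀ n, m ≤ n → Z n → Z (n + 1) := hii
  have hZ' : ∀ n n', m ≤ n → n ≤ n' → Z n → Z n' := by
    intro n n' hmn hnn' hz
    induction n', hnn' using Nat.le_induction with
    | base => exact hz
    | succ k hk ih => exact hZ k (by omega) ih
  have hcle : ∀ n, m ≤ n → (Z n ∨ rl (N (n + 1) ⊔ W (n + 2)) (W (n + 1)) + 1 ≤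
      rl (N n ⊔ W (n + 1)) (W n)) := by
    intro n hmn
    by_cases hz : Z n
    · exact Or.inl hz
    · right
      let U : Submodule A P := W n ⊓ (N (n + 1) ⊔ W (n + 2)).comap (LinearMap.lsmul A P x)
      have hU1 : N n ⊔ W (n + 1) ≤ U := by
        refine sup_le (le_inf (le_Wf _ _) ?_) (le_inf (Wf_anti _ (Nat.le_succ n)) ?_)
        · intro u hu
          exact Submodule.mem_sup_left (h.fil.smul_mem h.hx hu)
        · intro u hu
          exact Submodule.mem_sup_right (smul_mem_Wf _ h.hx hu)
      rw [rl_add (inf_le_left : U ≤ W n) hU1, add_comm]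
      refine add_le_add ?_ ?_
      · rw [Order.one_le_iff_pos, pos_iff_ne_zero]
        intro h0
        rw [rl_eq_zero] at h0
        exact hz fun w hw hxw => h0 ⟨hw, hxw⟩
      · refine rl_le_of_map (LinearMap.lsmul A P x) ?_ ?_
        · refine (hi n hmn).trans (sup_le ?_ le_sup_left)
          exact le_sup_of_le_right le_sup_left
        · intro u _ hu
          exact hu.2
  have hdrop : ∀ i, Z (m + i) ∨ rl (N (m + i + 1) ⊔ W (m + i + 2)) (W (m + i + 1)) + (i + 1 : ℕ)
      ≤ (c : ℕ∞) := by
    intro i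
    induction i with
    | zero =>
      rcases hcle m le_rfl with hz | hz
      · exact Or.inl hz
      · right
        simpa using hz.trans hiv
    | succ i ih =>
      rcases ih with hz | hz
      · exact Or.inl (hZ (m + i) (Nat.le_add_right _ _) hz)
      · rcases hcle (m + i + 1) (by omega) with hz' | hz'
        · exact Or.inl hz'
        · right
          refine le_trans ?_ hz
          refine le_trans (le_of_eq ?_) (add_le_add_left hz' _)
          push_cast
          rw [add_assoc (rl _ _) 1, add_comm (1 : ℕ∞) ((i : ℕ∞) + 1)]
          rfl
  have hzc : Z (m + c) := by
    rcases hdrop c with hz | hz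
    · exact hz
    · exfalso
      have : ((c + 1 : ℕ) : ℕ∞) ≤ c := le_trans (by simp) hz
      have := ENat.natCast_le_natCast.mp this
      omega
  have hstab : ∀ k n, m + c ≤ n → T ≤ n + k → W n ≤ N n ⊔ W (n + 1) := by
    intro k
    induction k with
    | zero => exact fun n _ hT => (hiii n hT).trans le_sup_left
    | succ k ih =>
      intro n hn hT w hw
      refine hZ' _ n (by omega) hn hzc w hw ?_
      exact ih (n + 1) (by omega) (by omega) (smul_mem_Wf _ h.hx hw)
  have hfin : ∀ k, W n ≤ N n ⊔ W (n + k) := by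
    intro k
    induction k with
    | zero => exact le_sup_right
    | succ k ih =>
      refine ih.trans (sup_le le_sup_left ?_)
      refine (hstab T (n + k) (by omega) (by omega)).trans (sup_le ?_ le_sup_right)
      exact (h.fil.antitone (Nat.le_add_right n k)).trans le_sup_left
  refine (hfin T).trans (sup_le le_rfl ((hiii _ (by omega)).trans (h.fil.antitone (by omega))))

lemma persist (h : MS I N R N0 x) {y : A} {ys : List A} (hxs : ∀ z ∈ y :: ys, z ∈ I)
    (hreg : Reg N m (y :: ys) (fun _ => xm x (N 0))) (hI : I.FG) (hm : 1 ≤ m) (hmR : R ≤ m)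
    {n : ℕ} (hn : m ≤ n)
    (hz : ∀ w ∈ Wf h.fil n, x • w ∈ N (n + 1) ⊔ Wf h.fil (n + 2) → w ∈ N n ⊔ Wf h.fil (n + 1)) :
    ∀ w ∈ Wf h.fil (n + 1), x • w ∈ N (n + 2) ⊔ Wf h.fil (n + 3) →
        w ∈ N (n + 1) ⊔ Wf h.fil (n + 2) := by
  set W := Wf h.fil with hW
  have hZ : ∀ u ∈ N 0, x • u ∈ N (n + 1) → u ∈ N n ⊔ W (n + 1) := fun u hu hxu =>
    hz u (h.mem_Wf_of_mem_zero hu hxu) (Submodule.mem_sup_left hxu)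
  have hred : N (n + 1) ≤ QN (y :: ys) (N n) ⊔ (xm x (N n) ⊔ xm x (W (n + 1))) := by
    intro v hv
    obtain ⟨_, ⟨s, hs, rfl⟩, q, hq, rfl⟩ := Submodule.mem_sup.mp (hreg.red (by omega) hv)
    simp only [Nat.add_sub_cancel] at hq
    simp only [LinearMap.lsmul_apply] at hv ⊢
    have hq' : q ∈ N (n + 1) := h.fil.smul n (QN_le_smul hxs _ hq)
    have hxs' : x • s ∈ N (n + 1) := by simpa using sub_mem hv hq'
    rw [← xm_sup]
    exact add_mem (Submodule.mem_sup_right (smul_mem_xm (hZ s hs hxs'))) (Submodule.mem_sup_left hq)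
  have hred2 : N (n + 2) ≤ QN (y :: ys) (N (n + 1)) ⊔ (xm x (N (n + 1)) ⊔ xm x (W (n + 2))) := by
    refine (h.fil.stab (n + 1) (by omega)).trans ((smr I hred).trans ?_)
    rw [Submodule.smul_sup, Submodule.smul_sup]
    refine sup_le_sup ((smul_QN_le _ _ _).trans (QN_mono _ (h.fil.smul n)))
      (sup_le_sup ((smul_xm_le _ _ _).trans (xm_mono (h.fil.smul n)))
      ((smul_xm_le _ _ _).trans (xm_mono (smul_Wf_le _ _))))
  have hZ1 : ∀ u ∈ N 0, x • u ∈ N (n + 2) → u ∈ N (n + 1) ⊔ W (n + 2) := by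
    intro u hu hxu
    obtain ⟨q, hq, r, hr, hqr⟩ := Submodule.mem_sup.mp (hred2 hxu)
    rw [← xm_sup] at hr
    obtain ⟨r, hr, rfl⟩ := hr
    simp only [LinearMap.lsmul_apply] at hqr
    have e : q = x • (u - r) := by rw [smul_sub, ← hqr]; abel
    have hrW : r ∈ W (n + 1) :=
      (sup_le (le_Wf _ _) (Wf_anti _ (Nat.le_succ _)) : N (n + 1) ⊔ W (n + 2) ≤ W (n + 1)) hr
    have hqN : q ∈ N (n + 2) := h.fil.smul _ (QN_le_smul hxs _ hq)
    have hur : u - r ∈ N 0 := by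
      refine h.r0x hxs hreg (n := n + 2) (by omega) (k := 0) ?_ (by rw [← e]; exact hqN)
      exact sub_mem (le_Wf _ _ hu) (Wf_anti _ (Nat.zero_le _) hrW)
    have hq2 := hreg.syz h.fil hm hxs (fun _ => Submodule.smul_le_right) (p := n + 1) (by omega)
      ⟨hq, by rw [e]; exact smul_mem_xm hur⟩
    have hle : xm x (N 0) ⊓ N (n + 1) ≤ xm x (N n ⊔ W (n + 1)) := by
      rintro _ ⟨⟨s, hs, rfl⟩, hs2⟩
      exact smul_mem_xm (hZ s hs hs2)
    have hq3 := QN_mono (y :: ys) hle hq2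
    rw [QN_xm, e] at hq3
    have hq4 := h.mem_of_xm hq3
    rw [QN_sup] at hq4
    have hle2 : QN (y :: ys) (N n) ⊔ QN (y :: ys) (W (n + 1)) ≤ N (n + 1) ⊔ W (n + 2) :=
      sup_le_sup ((QN_le_smul hxs _).trans (h.fil.smul n))
        ((QN_le_smul hxs _).trans (smul_Wf_le _ _))
    have := add_mem (hle2 hq4) hr
    simpa using this
  intro w hw hxw
  obtain ⟨g, hg, v, hv, hgv⟩ := Submodule.mem_sup.mp hxw
  obtain ⟨g', hg', _, ⟨w1, hw1, rfl⟩, hgv'⟩ := Submodule.mem_sup.mp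
    (h.step2 hxs hreg hI (p := n + 2) (by omega) hv)
  simp only [LinearMap.lsmul_apply] at hgv'
  have e : x • (w - w1) = g + g' := by
    rw [smul_sub, ← hgv, ← hgv']; abel
  have hmem : x • (w - w1) ∈ N (n + 2) := by
    rw [e]; exact add_mem hg (h.fil.anti _ hg')
  have h0 : w - w1 ∈ N 0 := h.r0x hxs hreg (n := n + 2) (by omega) (k := n + 1)
    (sub_mem hw (Wf_anti _ (Nat.le_succ _) hw1)) hmem
  have := add_mem (hZ1 _ h0 hmem) (Submodule.mem_sup_right hw1)
  simpa using this

lemma base_bound (h : MS I N R N0 x) (hfin : ∀ n, rl (N n) (N 0) ≠ ⊤) (T : ℕ) :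
    rl (N (T + 1)) (N T) ≤ rl (xm x (N 0) ⊔ N (T + 1)) (N 0) := by
  have h1 : rl (N (T + 1)) (N 0) = rl (N (T + 1)) (N T) + rl (N T) (N 0) :=
    rl_add (h.fil.antitone (Nat.zero_le _)) (h.fil.anti T)
  have hle : xm x (N 0) ⊔ N (T + 1) ≤ N 0 := sup_le xm_le (h.fil.antitone (Nat.zero_le _))
  have h2 : rl (N (T + 1)) (N 0) = rl (N (T + 1)) (xm x (N 0) ⊔ N (T + 1)) +
      rl (xm x (N 0) ⊔ N (T + 1)) (N 0) := rl_add hle le_sup_right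
  have h3 : rl (N (T + 1)) (xm x (N 0) ⊔ N (T + 1)) ≤ rl (N T) (N 0) := by
    refine rl_le_of_map (LinearMap.lsmul A P x) le_rfl ?_
    intro u _ hu
    exact h.fil.smul_mem h.hx hu
  refine (ENat.add_le_add_iff_right (hfin T)).mp ?_
  rw [← h1, h2, add_comm]
  gcongr

lemma length_bound (h : MS I N R N0 x) {y : A} {ys : List A} (hxs : ∀ z ∈ y :: ys, z ∈ I)
    (hreg : Reg N m (y :: ys) (fun _ => xm x (N 0))) (hI : I.FG)
    (hfin : ∀ n, rl (N n) (N 0) ≠ ⊤) :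
    rl (Wf h.fil (m + 1)) (Wf h.fil m) ≤ rl (xm x (N 0) ⊔ N (m + 1)) (N 0) := by
  set W := Wf h.fil with hW
  have key : ∀ k n, m ≤ n → N0 ≤ n + k → rl (W (n + 1)) (W n) ≤
      rl (xm x (N 0) ⊔ N (n + 1)) (N 0) := by
    intro k
    induction k with
    | zero =>
      intro n hn hT
      refine le_trans ?_ (h.base_bound hfin n)
      exact rl_mono (le_Wf _ _) (h.step1 hxs hreg hT (by omega))
    | succ k ih =>
      intro n hn hT
      have h1 := ih (n + 1) (by omega) (by omega)
      have hle : xm x (W n) ⊔ W (n + 2) ≤ W (n + 1) :=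
        sup_le (xm_Wf_le _ h.hx n) (Wf_anti _ (Nat.le_succ _))
      rw [rl_add hle le_sup_right] at h1
      have hle2 : xm x (N 0) ⊔ N (n + 1) ≤ N 0 := sup_le xm_le (h.fil.antitone (Nat.zero_le _))
      have hle3 : xm x (N 0) ⊔ N (n + 2) ≤ xm x (N 0) ⊔ N (n + 1) :=
        sup_le_sup_left (h.fil.anti _) _
      rw [rl_add hle2 hle3] at h1
      have ha : rl (W (n + 1)) (W n) ≤ rl (W (n + 2)) (xm x (W n) ⊔ W (n + 2)) := by
        refine rl_le_of_inj (LinearMap.lsmul A P x) le_sup_left ?_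
        intro u hu hxu
        obtain ⟨j, hj⟩ := h.pow_smul_zero hu
        exact h.desc hxu hj
      have hb : rl (xm x (N 0) ⊔ N (n + 2)) (xm x (N 0) ⊔ N (n + 1)) ≤
          rl (xm x (W n) ⊔ W (n + 2)) (W (n + 1)) := by
        have hb1 : rl (xm x (N 0) ⊔ N (n + 2)) (xm x (N 0) ⊔ N (n + 1)) ≤
            rl (xm x (N 0) ⊔ N (n + 2)) (N (n + 1)) := by
          refine rl_le_of_map LinearMap.id ?_ (fun u _ hu => hu)
          rw [Submodule.map_id]
          exact sup_le (le_sup_left.trans le_sup_right) le_sup_left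
        refine hb1.trans (rl_le_of_inj LinearMap.id ?_ ?_)
        · rw [Submodule.map_id]; exact le_Wf _ _
        · intro u hu hu2
          simp only [LinearMap.id_apply] at hu2
          obtain ⟨_, ⟨w, hw, rfl⟩, v, hv, rfl⟩ := Submodule.mem_sup.mp hu2
          obtain ⟨g', hg', _, ⟨w1, hw1, rfl⟩, rfl⟩ := Submodule.mem_sup.mp
            (h.step2 hxs hreg hI (p := n + 1) (by omega) hv)
          simp only [LinearMap.lsmul_apply] at hu ⊢
          have e : x • w + (g' + x • w1) = x • (w + w1) + g' := by rw [smul_add]; abel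
          rw [e] at hu ⊢
          have hx2 : x • (w + w1) ∈ N (n + 1) := by simpa using sub_mem hu (h.fil.anti _ hg')
          exact add_mem (Submodule.mem_sup_left (smul_mem_xm (h.r0x hxs hreg (n := n + 1)
            (by omega) (k := n) (add_mem hw (Wf_anti _ (Nat.le_succ _) hw1)) hx2)))
            (Submodule.mem_sup_right hg')
      have hne : rl (xm x (N 0) ⊔ N (n + 2)) (xm x (N 0) ⊔ N (n + 1)) ≠ ⊤ :=
        ne_top_of_le_ne_top (hfin (n + 2)) (rl_mono le_sup_right hle2)
      refine (ENat.add_le_add_iff_right hne).mp ?_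
      refine (add_le_add ha hb).trans (h1.trans ?_)
      rw [add_comm]
  exact key N0 m le_rfl (by omega)

/-- main step in dimension at least two -/
lemma main2 (h : MS I N R N0 x) {y : A} {ys : List A} (hxs : ∀ z ∈ y :: ys, z ∈ I)
    (hreg : Reg N m (y :: ys) (fun _ => xm x (N 0))) (hI : I.FG)
    (hfin : ∀ n, rl (N n) (N 0) ≠ ⊤) (hm : 1 ≤ m) (hmR : R ≤ m) {c : ℕ}
    (hc : rl (xm x (N 0) ⊔ N (m + 1)) (N 0) ≤ (c : ℕ∞)) :
    Reg N (m + c + 1) (x :: y :: ys) (fun _ => ⊥) := by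
  have hWN : ∀ n, m + c ≤ n → Wf h.fil n ≤ N n := fun n hn =>
    h.count (m := m) (c := c) (T := N0 + m) (fun n hn => h.step2 hxs hreg hI (by omega))
      (fun n hn hz => h.persist hxs hreg hI hm hmR hn hz)
      (fun n hn => h.step1 hxs hreg (by omega) (by omega))
      ((rl_mono le_sup_right le_rfl).trans ((h.length_bound hxs hreg hI hfin).trans hc)) hn
  refine ⟨fun n _ u _ hxu => by simpa using h.inj u (by simpa using hxu), ?_⟩
  refine Reg.congr h.fil hxs ?_ (hreg.mono (by omega : m ≤ m + c + 1))
  intro n hn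
  obtain ⟨n, rfl⟩ : ∃ n', n = n' + 1 := ⟨n - 1, by omega⟩
  simp only [Nat.add_sub_cancel, bot_sup_eq]
  apply le_antisymm
  · rintro _ ⟨⟨u, hu, rfl⟩, hu2⟩
    exact ⟨smul_mem_xm (hWN n (by omega) (h.mem_Wf_of_mem_zero hu hu2)), hu2⟩
  · exact inf_le_inf_right _ (xm_mono (h.fil.antitone (Nat.zero_le _)))

/-- main step in dimension one -/
lemma main1 (h : MS I N R N0 x) [IsNoetherianRing A] (hJ : I ≤ Ideal.jacobson ⊥) (hfg : (N 0).FG) {n1 : ℕ}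
    (hn1 : ∀ n, n1 ≤ n → N n ≤ xm x (N 0))
    (hfin : ∀ n, rl (N n) (N 0) ≠ ⊤) {lam : ℕ}
    (hc : rl (xm x (N 0)) (N 0) ≤ (lam : ℕ∞)) :
    Reg N (R + lam) [x] (fun _ => ⊥) := by
  have hfgn : ∀ n, (N n).FG := fun n => Submodule.FG.of_le hfg (h.fil.antitone (Nat.zero_le n))
  have hreg : Reg N n1 [] (fun _ => xm x (N 0)) := hn1
  have hxs : ∀ y ∈ ([] : List A), y ∈ I := by simp
  have hW1 : ∀ n, Wf h.fil (n + 1) ≤ xm x (Wf h.fil n) := by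
    intro n w hw
    obtain ⟨w', rfl⟩ := h.surj w
    refine smul_mem_xm ?_
    have hw0 := hw
    obtain ⟨j, hj⟩ := hw
    refine h.desc (j := j + n1) hw0 fun c hc => ?_
    apply h.mem_of_xm
    rw [smul_comm]
    exact hn1 _ (by omega) (h.fil.pow_step (Nat.le_add_right j n1) hj c hc)
  have hT : ∀ n, N0 + n1 ≤ n → Wf h.fil n ≤ N n := fun n hn =>
    h.step1 hxs hreg (by omega) (by omega)
  have hpers : ∀ n, R ≤ n →
      (∀ w ∈ Wf h.fil n, x • w ∈ N (n + 1) ⊔ Wf h.fil (n + 2) → w ∈ N n ⊔ Wf h.fil (n + 1)) →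
      (∀ w ∈ Wf h.fil (n + 1), x • w ∈ N (n + 2) ⊔ Wf h.fil (n + 3) →
        w ∈ N (n + 1) ⊔ Wf h.fil (n + 2)) := by
    intro n hn hz
    have h1 : N (n + 1) ≤ xm x (N n) ⊔ Wf h.fil (n + 2) := by
      intro v hv
      obtain ⟨w, hw, rfl⟩ := hW1 n (le_Wf _ _ hv)
      obtain ⟨a, ha, b, hb, rfl⟩ := Submodule.mem_sup.mp (hz w hw (Submodule.mem_sup_left hv))
      simp only [LinearMap.lsmul_apply, smul_add]
      exact add_mem (Submodule.mem_sup_left (smul_mem_xm ha))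
        (Submodule.mem_sup_right (smul_mem_Wf _ h.hx hb))
    have h2 : N (n + 2) ≤ xm x (N (n + 1)) ⊔ Wf h.fil (n + 3) := by
      refine (h.fil.stab (n + 1) (by omega)).trans ((smr I h1).trans ?_)
      rw [Submodule.smul_sup]
      exact sup_le_sup ((smul_xm_le _ _ _).trans (xm_mono (h.fil.smul n))) (smul_Wf_le _ _)
    intro w hw hxw
    apply h.mem_of_xm
    rw [xm_sup]
    exact (sup_le (h2.trans (sup_le_sup_left (hW1 _) _)) ((hW1 _).trans le_sup_right) :
      N (n + 2) ⊔ Wf h.fil (n + 3) ≤ _) hxw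
  have hbd : ∀ k n, N0 + n1 ≤ n + k → rl (Wf h.fil (n + 1)) (Wf h.fil n) ≤ (lam : ℕ∞) := by
    intro k
    induction k with
    | zero =>
      intro n hn
      refine (rl_mono (le_Wf _ _) (hT n hn)).trans ((h.base_bound hfin n).trans ?_)
      exact (rl_mono le_sup_left le_rfl).trans hc
    | succ k ih =>
      intro n hn
      refine le_trans ?_ (ih (n + 1) (by omega))
      refine rl_le_of_inj (LinearMap.lsmul A P x) (xm_Wf_le _ h.hx n) ?_
      intro u hu hxu
      obtain ⟨j, hj⟩ := h.pow_smul_zero hu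
      exact h.desc hxu hj
  refine ⟨fun n _ u _ hxu => by simpa using h.inj u (by simpa using hxu), ?_⟩
  by_cases hN0 : N 0 = ⊥
  · intro n _
    refine (h.fil.antitone (Nat.zero_le n)).trans ?_
    rw [hN0]
    exact bot_le
  have hnot : ¬ N R ≤ Wf h.fil (R + 1) := by
    intro hle
    apply hN0
    set j := N0 + n1
    have h1 : ∀ i, I ^ i • Wf h.fil (R + 1) ≤ Wf h.fil (R + 1 + i) := by
      intro i
      induction i with
      | zero => simp
      | succ i ih =>
        rw [pow_succ', mul_smul]
        exact (smr I ih).trans (smul_Wf_le _ _)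
    have h2 : ∀ i, N (R + i) ≤ I ^ i • N R := by
      intro i
      induction i with
      | zero => simp
      | succ i ih =>
        rw [pow_succ', mul_smul]
        exact (h.fil.stab (R + i) (by omega)).trans (smr I ih)
    have h3 : N (R + j) ≤ I • N (R + j) := by
      refine (h2 j).trans ((smr _ hle).trans ((h1 j).trans ((hT _ (by omega)).trans ?_)))
      rw [show R + 1 + j = R + j + 1 by ring]
      exact h.fil.stab _ (by omega)
    have h4 : N (R + j) = ⊥ := Submodule.eq_bot_of_le_smul_of_le_jacobson_bot I _ (hfgn _) h3 hJ
    rw [eq_bot_iff]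
    intro u hu
    have h5 : x ^ (R + j) • u ∈ N (0 + (R + j)) :=
      h.fil.pow_smul_mem (Ideal.pow_mem_pow h.hx _) hu
    rw [zero_add, h4, Submodule.mem_bot] at h5
    have h6 : ∀ i, x ^ i • u = 0 → u = 0 := by
      intro i
      induction i with
      | zero => simp
      | succ i ih =>
        intro hi
        apply ih
        apply h.inj
        rw [← mul_smul, ← pow_succ', hi]
    simpa using h6 _ h5
  have hcR : rl (N R ⊔ Wf h.fil (R + 1)) (Wf h.fil R) + 1 ≤ (lam : ℕ∞) := by
    refine le_trans ?_ (hbd (N0 + n1) R (by omega))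
    rw [rl_add (sup_le (le_Wf _ _) (Wf_anti _ (Nat.le_succ _)) :
      N R ⊔ Wf h.fil (R + 1) ≤ Wf h.fil R) le_sup_right, add_comm]
    gcongr
    rw [Order.one_le_iff_pos, pos_iff_ne_zero]
    intro h0
    rw [rl_eq_zero] at h0
    exact hnot (le_sup_left.trans h0)
  cases lam with
  | zero => simp at hcR
  | succ l =>
    have hcR' : rl (N R ⊔ Wf h.fil (R + 1)) (Wf h.fil R) ≤ (l : ℕ∞) := by
      push_cast at hcR
      exact (ENat.add_le_add_iff_right ENat.one_ne_top).mp hcR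
    have hWN : ∀ n, R + l ≤ n → Wf h.fil n ≤ N n := fun n hn =>
      h.count (m := R) (c := l) (T := N0 + n1) (fun n _ => (hW1 n).trans le_sup_right)
        hpers hT hcR' hn
    intro n hn
    obtain ⟨n, rfl⟩ : ∃ n', n = n' + 1 := ⟨n - 1, by omega⟩
    simp only [Nat.add_sub_cancel, bot_sup_eq]
    exact (le_Wf h.fil _).trans ((hW1 n).trans (xm_mono (hWN n (by omega))))

end MS

end MainStep


open Filter IsLocalRing
set_option linter.unusedSectionVars false

section Gen

open Polynomial

variable {A : Type*} [CommRing A] [IsLocalRing A]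

/-- generic elements of a local ring (cofinitely many residue classes) -/
noncomputable def gen (A : Type*) [CommRing A] [IsLocalRing A] : Filter A :=
  Filter.comap (residue A) Filter.cofinite

lemma gen_neBot [Infinite (ResidueField A)] : (gen A).NeBot :=
  Filter.NeBot.comap_of_surj inferInstance (residue_surjective (R := A))

lemma gen_line {S : Set A} (h : ∀ τ ∈ S, ∀ τ' ∈ S, residue A τ = residue A τ') :
    ∀ᶠ τ in gen A, τ ∉ S := by
  have hs : (Set.image (residue A) S).Subsingleton := by
    rintro _ ⟨a, ha, rfl⟩ _ ⟨b, hb, rfl⟩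
    exact h a ha b hb
  have : ∀ᶠ c in Filter.cofinite, c ∉ Set.image (residue A) S := by
    rw [Filter.eventually_cofinite]
    simp only [not_not]
    exact hs.finite
  exact (this.comap (residue A)).mono fun τ hτ hS => hτ ⟨τ, hS, rfl⟩

lemma residue_ne_isUnit {τ τ' : A} (h : residue A τ ≠ residue A τ') : IsUnit (τ - τ') := by
  rw [← IsLocalRing.residue_ne_zero_iff_isUnit, map_sub]
  exact sub_ne_zero.mpr h

lemma gen_reg {R E : Type*} [CommRing R] [IsNoetherianRing R] [AddCommGroup E] [Module R E]
    [Module.Finite R E] (φ : A → R)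
    (h : ∀ p ∈ associatedPrimes R E, ∀ τ τ', φ τ ∈ p → φ τ' ∈ p → residue A τ = residue A τ') :
    ∀ᶠ τ in gen A, ∀ u : E, φ τ • u = 0 → u = 0 := by
  have hfin := associatedPrimes.finite R E
  have : ∀ᶠ τ in gen A, ∀ p ∈ associatedPrimes R E, τ ∉ {τ | φ τ ∈ p} := by
    rw [Filter.eventually_all_finite hfin]
    intro p hp
    exact gen_line fun τ hτ τ' hτ' => h p hp τ τ' hτ hτ'
  refine this.mono fun τ hτ u hu => ?_
  by_contra hne
  have hmem : φ τ ∈ {r : R | ∃ x : E, x ≠ 0 ∧ r • x = 0} := ⟨u, hne, hu⟩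
  rw [← biUnion_associatedPrimes_eq_zero_divisors] at hmem
  obtain ⟨p, hp, hpm⟩ := Set.mem_iUnion₂.mp hmem
  exact hτ p hp hpm

/-- E0 -/
lemma gen_eval {f : A[X]} (hf : f.map (residue A) ≠ 0) : ∀ᶠ τ in gen A, IsUnit (f.eval τ) := by
  have : ∀ᶠ c in Filter.cofinite, ¬ (f.map (residue A)).IsRoot c := by
    rw [Filter.eventually_cofinite]
    simpa using Polynomial.finite_setOfPred_isRoot hf
  refine (this.comap (residue A)).mono fun τ hτ => ?_
  rw [← IsLocalRing.residue_ne_zero_iff_isUnit]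
  intro h
  apply hτ
  rw [Polynomial.IsRoot, Polynomial.eval_map_apply, h]

lemma gen_unit : ∀ᶠ τ in gen A, IsUnit τ := by
  have := gen_eval (A := A) (f := Polynomial.X) (by simp)
  simpa using this

variable {𝓕 : Type*} [AddCommGroup 𝓕] [Module A[X] 𝓕]

/-- E1 -/
lemma gen_X_reg [IsNoetherianRing A] [Module.Finite A[X] 𝓕] (𝓚 : Submodule A[X] 𝓕) :
    ∀ᶠ τ in gen A, ∀ u : 𝓕, (X - C τ) • u ∈ 𝓚 → u ∈ 𝓚 := by
  have := gen_reg (A := A) (R := A[X]) (E := 𝓕 ⧸ 𝓚) (fun τ => X - C τ) (by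
    intro p hp τ τ' h1 h2
    by_contra hne
    have hu := residue_ne_isUnit hne
    have hpp := (show IsAssociatedPrime p _ from hp).isPrime
    apply hpp.ne_top
    refine Ideal.eq_top_of_isUnit_mem p ?_ (hu.map C)
    have := p.sub_mem h2 h1
    rw [map_sub]
    simpa using this)
  refine this.mono fun τ hτ u hu => ?_
  rw [← Submodule.Quotient.mk_eq_zero] at hu ⊢
  exact hτ _ hu

/-- if `f(τ)` is a unit and `f L ≤ K` then `L ≤ K + (X - τ) L`. -/
lemma le_of_eval_unit {𝓚 L : Submodule A[X] 𝓕} {f : A[X]} {τ : A} (hu : IsUnit (f.eval τ))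
    (h : ∀ u ∈ L, f • u ∈ 𝓚) : L ≤ 𝓚 ⊔ xm (X - C τ) L := by
  intro u hu'
  have hd : X - C τ ∣ f - C (f.eval τ) := X_sub_C_dvd_sub_C_eval
  obtain ⟨g, hg⟩ := hd
  have h1 : C (f.eval τ) • u ∈ 𝓚 ⊔ xm (X - C τ) L := by
    have : C (f.eval τ) • u = f • u + (X - C τ) • (-(g • u)) := by
      rw [smul_neg, ← mul_smul, ← hg, sub_smul]; abel
    rw [this]
    exact Submodule.add_mem_sup (h u hu') (smul_mem_xm (L.neg_mem (L.smul_mem _ hu')))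
  have hu2 := hu.map (C : A →+* A[X])
  exact (Submodule.smul_mem_iff_of_isUnit _ hu2).mp h1

lemma exists_common_f {𝓚 L : Submodule A[X] 𝓕} (hL : L.FG)
    (h : ∀ u ∈ L, ∃ f : A[X], f.map (residue A) ≠ 0 ∧ f • u ∈ 𝓚) :
    ∃ f : A[X], f.map (residue A) ≠ 0 ∧ ∀ u ∈ L, f • u ∈ 𝓚 := by
  revert h
  refine Submodule.fg_induction (motive := fun L _ => (∀ u ∈ L, ∃ f : A[X], f.map (residue A) ≠ 0
    ∧ f • u ∈ 𝓚) → ∃ f : A[X], f.map (residue A) ≠ 0 ∧ ∀ u ∈ L, f • u ∈ 𝓚) ?_ ?_ L hL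
  · intro u h
    obtain ⟨f, hf, hfu⟩ := h u (Submodule.mem_span_singleton_self u)
    refine ⟨f, hf, fun v hv => ?_⟩
    obtain ⟨a, rfl⟩ := Submodule.mem_span_singleton.mp hv
    rw [smul_comm]
    exact 𝓚.smul_mem _ hfu
  · intro L₁ L₂ _ _ h₁ h₂ h
    obtain ⟨f, hf, hfu⟩ := h₁ fun u hu => h u (Submodule.mem_sup_left hu)
    obtain ⟨g, hg, hgu⟩ := h₂ fun u hu => h u (Submodule.mem_sup_right hu)
    refine ⟨f * g, by rw [Polynomial.map_mul]; exact mul_ne_zero hf hg, fun u hu => ?_⟩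
    obtain ⟨a, ha, b, hb, rfl⟩ := Submodule.mem_sup.mp hu
    rw [smul_add]
    refine 𝓚.add_mem ?_ ?_
    · rw [mul_comm, mul_smul]; exact 𝓚.smul_mem _ (hfu a ha)
    · rw [mul_smul]; exact 𝓚.smul_mem _ (hgu b hb)

/-- saturation of `W` in `L` with respect to polynomials not in `𝔪[X]` -/
def fsat (L W : Submodule A[X] 𝓕) : Submodule A[X] 𝓕 where
  carrier := {u | u ∈ L ∧ ∃ f : A[X], f.map (residue A) ≠ 0 ∧ f • u ∈ W}
  add_mem' := by
    rintro u v ⟨hu, f, hf, hfu⟩ ⟨hv, g, hg, hgv⟩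
    refine ⟨L.add_mem hu hv, f * g, by rw [Polynomial.map_mul]; exact mul_ne_zero hf hg, ?_⟩
    rw [smul_add]
    refine W.add_mem ?_ ?_
    · rw [mul_comm, mul_smul]; exact W.smul_mem _ hfu
    · rw [mul_smul]; exact W.smul_mem _ hgv
  zero_mem' := ⟨L.zero_mem, 1, by simp, by simp⟩
  smul_mem' := by
    rintro a u ⟨hu, f, hf, hfu⟩
    exact ⟨L.smul_mem _ hu, f, hf, by rw [smul_comm]; exact W.smul_mem _ hfu⟩

lemma le_fsat {L W : Submodule A[X] 𝓕} (h : W ≤ L) : W ≤ fsat L W :=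
  fun u hu => ⟨h hu, 1, by simp, by simpa using hu⟩

lemma fsat_sat {L W : Submodule A[X] 𝓕} {f : A[X]} (hf : f.map (residue A) ≠ 0) {u : 𝓕}
    (hu : u ∈ L) (h : f • u ∈ fsat L W) : u ∈ fsat L W := by
  obtain ⟨_, g, hg, hgu⟩ := h
  exact ⟨hu, g * f, by rw [Polynomial.map_mul]; exact mul_ne_zero hg hf, by rwa [mul_smul]⟩

variable [Module A 𝓕] [IsScalarTower A A[X] 𝓕]

/-- length of the fibre of `L/𝓚` at `τ` -/
noncomputable def fl (𝓚 L : Submodule A[X] 𝓕) (τ : A) : ℕ∞ :=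
  rl ((𝓚 ⊔ xm (X - C τ) L).restrictScalars A) (L.restrictScalars A)

lemma C_smul (a : A) (u : 𝓕) : (C a : A[X]) • u = a • u := by
  rw [← Polynomial.algebraMap_eq, algebraMap_smul]

end Gen


open Filter IsLocalRing
set_option linter.unusedSectionVars false

section GR

open Polynomial

lemma nak_xm {B E : Type*} [CommRing B] [AddCommGroup E] [Module B E] {K L : Submodule B E}
    (hL : L.FG) (g : B) (h : L ≤ K ⊔ xm g L) :
    ∃ r : B, r - 1 ∈ Ideal.span {g} ∧ ∀ u ∈ L, r • u ∈ K := by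
  obtain ⟨r, hr, hru⟩ := Submodule.exists_sub_one_mem_and_smul_eq_zero_of_fg_of_le_smul
    (Ideal.span {g}) (L.map K.mkQ) (hL.map _) (by
      rintro _ ⟨u, hu, rfl⟩
      obtain ⟨k, hk, _, ⟨v, hv, rfl⟩, rfl⟩ := Submodule.mem_sup.mp (h hu)
      have : K.mkQ (k + LinearMap.lsmul B E g v) = g • K.mkQ v := by
        rw [map_add, (Submodule.Quotient.mk_eq_zero K).mpr hk |> (show K.mkQ k = 0 from ·)]
        simp
      rw [this]
      exact Submodule.smul_mem_smul (Ideal.mem_span_singleton_self g) ⟨v, hv, rfl⟩)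
  refine ⟨r, hr, fun u hu => ?_⟩
  rw [← Submodule.Quotient.mk_eq_zero]
  exact hru _ ⟨u, hu, rfl⟩

variable {A : Type*} [CommRing A] [IsLocalRing A]

lemma map_ne_zero_of_sub_one_mem {r : A[X]} {τ : A} (h : r - 1 ∈ Ideal.span {X - C τ}) :
    r.map (residue A) ≠ 0 := by
  intro h0
  obtain ⟨g, hg⟩ := Ideal.mem_span_singleton.mp h
  have h1 : r.eval τ = 1 := by
    have : r = 1 + (X - C τ) * g := by rw [← hg]; ring
    rw [this]; simp
  have h2 : residue A (r.eval τ) = 0 := by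
    rw [← Polynomial.eval_map_apply, h0, eval_zero]
  rw [h1, map_one] at h2
  exact one_ne_zero h2

lemma XC_map_ne_zero (τ : A) : (X - C τ).map (residue A) ≠ 0 := by
  rw [Polynomial.map_sub, map_X, map_C]
  exact X_sub_C_ne_zero _

lemma rl_max : rl (maximalIdeal A : Submodule A A) ⊤ = 1 := by
  rw [rl_top, Module.length_eq_one_iff, isSimpleModule_iff_isCoatom]
  exact Ideal.isMaximal_def.mp (maximalIdeal.isMaximal A)

variable {𝓕 : Type*} [AddCommGroup 𝓕] [Module A[X] 𝓕]
variable [Module A 𝓕] [IsScalarTower A A[X] 𝓕]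

lemma fl_step_zero {𝓚 L L1 : Submodule A[X] 𝓕} (h1 : 𝓚 ≤ L1) (h2 : L1 ≤ L) (hne : L1 ≠ L)
    (hL : L.FG) (τ : A)
    (hs : ∀ f : A[X], f.map (residue A) ≠ 0 → ∀ u ∈ L, f • u ∈ L1 → u ∈ L1) :
    fl 𝓚 L1 τ + 1 ≤ fl 𝓚 L τ := by
  have hHL : (L1 ⊔ xm (X - C τ) L) ≤ L := sup_le h2 xm_le
  have hQH : (𝓚 ⊔ xm (X - C τ) L) ≤ (L1 ⊔ xm (X - C τ) L) := sup_le_sup_right h1 _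
  have e := rl_add (K := (𝓚 ⊔ xm (X - C τ) L).restrictScalars A)
    (L := (L1 ⊔ xm (X - C τ) L).restrictScalars A) (H := L.restrictScalars A) hHL hQH
  rw [fl, fl, e]
  refine add_le_add ?_ ?_
  · refine rl_le_of_inj LinearMap.id ?_ ?_
    · rw [Submodule.map_id]
      exact fun u hu => Submodule.mem_sup_left (S := L1) hu
    · intro u hu hu'
      obtain ⟨k, hk, _, ⟨v, hv, rfl⟩, hkv⟩ := Submodule.mem_sup.mp
        (show u ∈ 𝓚 ⊔ xm (X - C τ) L from hu')
      have hv1 : v ∈ L1 := by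
        refine hs _ (XC_map_ne_zero τ) v hv ?_
        have : (X - C τ) • v = u - k := by rw [← hkv, LinearMap.lsmul_apply]; abel
        rw [this]
        exact L1.sub_mem hu (h1 hk)
      exact Submodule.mem_sup.mpr ⟨k, hk, _, ⟨v, hv1, rfl⟩, hkv⟩
  · rw [Order.one_le_iff_ne_zero, Ne, rl_eq_zero]
    intro hle
    obtain ⟨r, hr, hru⟩ := nak_xm hL (X - C τ) (K := L1) (show L ≤ _ from hle)
    exact hne (le_antisymm h2 fun u hu => hs r (map_ne_zero_of_sub_one_mem hr) u hu (hru u hu))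

lemma fl_step {𝓚 L L1 : Submodule A[X] 𝓕} (h1 : 𝓚 ≤ L1) (h2 : L1 ≤ L) {f : A[X]} {v : 𝓕} {τ : A}
    (hv : v ∈ L) (hf : ∀ u ∈ L, f • u ∈ Submodule.span A[X] {v} ⊔ L1) (hτ : IsUnit (f.eval τ))
    (hm : ∀ c ∈ maximalIdeal A, c • v ∈ L1) :
    fl 𝓚 L τ ≤ fl 𝓚 L1 τ + 1 := by
  have hHL : (L1 ⊔ xm (X - C τ) L) ≤ L := sup_le h2 xm_le
  have hQH : (𝓚 ⊔ xm (X - C τ) L) ≤ (L1 ⊔ xm (X - C τ) L) := sup_le_sup_right h1 _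
  have e := rl_add (K := (𝓚 ⊔ xm (X - C τ) L).restrictScalars A)
    (L := (L1 ⊔ xm (X - C τ) L).restrictScalars A) (H := L.restrictScalars A) hHL hQH
  rw [fl, fl, e]
  refine add_le_add ?_ ?_
  · refine rl_le_of_map LinearMap.id ?_ ?_
    · rw [Submodule.map_id]
      intro u hu
      obtain ⟨k, hk, w, hw, rfl⟩ := Submodule.mem_sup.mp
        (show u ∈ L1 ⊔ xm (X - C τ) L from hu)
      exact Submodule.add_mem_sup hk (Submodule.mem_sup_right (S := 𝓚) hw)
    · intro u hu hu'
      have : 𝓚 ⊔ xm (X - C τ) L1 ≤ 𝓚 ⊔ xm (X - C τ) L := sup_le_sup_left (xm_mono h2) _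
      exact this hu'
  · rw [← rl_max (A := A)]
    refine rl_le_of_map (LinearMap.toSpanSingleton A 𝓕 v) ?_ ?_
    · intro u hu
      obtain ⟨w, hw, y, hy, rfl⟩ := Submodule.mem_sup.mp (le_of_eval_unit hτ hf hu)
      obtain ⟨w1, hw1, w2, hw2, rfl⟩ := Submodule.mem_sup.mp hw
      obtain ⟨p, rfl⟩ := Submodule.mem_span_singleton.mp hw1
      obtain ⟨g, hg⟩ : X - C τ ∣ p - C (p.eval τ) := X_sub_C_dvd_sub_C_eval
      have : p • v = p.eval τ • v + (X - C τ) • (g • v) := by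
        rw [← mul_smul, ← hg, sub_smul, C_smul]; abel
      rw [this, add_assoc, add_assoc]
      refine Submodule.add_mem_sup ⟨p.eval τ, trivial, rfl⟩ ?_
      have h3 : (X - C τ) • (g • v) + (w2 + y) ∈ L1 ⊔ xm (X - C τ) L :=
        Submodule.add_mem _ (Submodule.mem_sup_right (smul_mem_xm (L.smul_mem _ hv)))
          (Submodule.add_mem_sup hw2 hy)
      exact h3
    · intro c _ hc
      exact Submodule.mem_sup_left (S := L1) (hm c hc)

lemma GR1 [IsNoetherian A[X] 𝓕] (N b : ℕ) : ∀ 𝓚 L : Submodule A[X] 𝓕, 𝓚 ≤ L →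
    ((maximalIdeal A).map C) ^ N • L ≤ 𝓚 → fl 𝓚 L 0 ≤ (b : ℕ∞) →
    ∀ᶠ τ in gen A, fl 𝓚 L τ ≤ (b : ℕ∞) := by
  induction b with
  | zero => ?_
  | succ b ih => ?_
  all_goals
    intro 𝓚 L hKL hN h0
    set J := (maximalIdeal A).map (C : A →+* A[X]) with hJ
    have hLfg : L.FG := IsNoetherian.noetherian L
    set W0 := J • L ⊔ 𝓚 with hW0
    have hW0L : W0 ≤ L := sup_le Submodule.smul_le_right hKL
    let S : Set (Submodule A[X] 𝓕) := {W | W0 ≤ W ∧ W ≤ L ∧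
      (∀ f : A[X], f.map (residue A) ≠ 0 → ∀ u ∈ L, f • u ∈ W → u ∈ W) ∧ W ≠ L}
    have hsat : ∀ W, W0 ≤ W → W ≤ L → fsat L W ∉ S → fsat L W = L := by
      intro W hW hWL hnot
      by_contra hne
      exact hnot ⟨hW.trans (le_fsat hWL), fun u hu => hu.1, fun f hf u hu => fsat_sat hf hu, hne⟩
    rcases S.eq_empty_or_nonempty with hS | hS
    · have hE := hsat W0 le_rfl hW0L (by rw [hS]; exact Set.notMem_empty _)
      obtain ⟨f, hf, hfu⟩ := exists_common_f (𝓚 := W0) hLfg (fun u hu => by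
        rw [← hE] at hu; exact hu.2)
      have key : ∀ n : ℕ, ∀ u ∈ L, f ^ n • u ∈ J ^ n • L ⊔ 𝓚 := by
        intro n
        induction n with
        | zero => intro u hu; simpa using Submodule.mem_sup_left (T := 𝓚) hu
        | succ n ihn =>
          intro u hu
          obtain ⟨w, hw, k, hk, e⟩ := Submodule.mem_sup.mp (ihn u hu)
          rw [pow_succ' f, mul_smul, ← e, smul_add]
          refine Submodule.add_mem _ ?_ (Submodule.mem_sup_right (𝓚.smul_mem _ hk))
          refine Submodule.smul_induction_on hw ?_ ?_
          · intro c hc v hv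
            rw [smul_comm]
            obtain ⟨w', hw', k', hk', e'⟩ := Submodule.mem_sup.mp (hfu v hv)
            rw [← e', smul_add]
            refine Submodule.add_mem_sup ?_ (𝓚.smul_mem _ hk')
            rw [pow_succ J, Submodule.mul_smul]
            exact Submodule.smul_mem_smul hc hw'
          · intro a b ha hb
            rw [smul_add]
            exact Submodule.add_mem _ ha hb
      have hfN : (f ^ N).map (residue A) ≠ 0 := by
        rw [Polynomial.map_pow]; exact pow_ne_zero _ hf
      refine (gen_eval hfN).mono fun τ hτ => ?_
      have : fl 𝓚 L τ = 0 := by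
        rw [fl, rl_eq_zero]
        exact le_of_eval_unit hτ fun u hu => by
          have := key N u hu
          rwa [sup_eq_right.mpr hN] at this
      rw [this]; exact bot_le
    · obtain ⟨L1, ⟨h1, h2, h3, h4⟩, hmax⟩ := set_has_maximal_iff_noetherian.mpr
        (inferInstance : IsNoetherian A[X] 𝓕) S hS
      have hK1 : 𝓚 ≤ L1 := le_sup_right.trans h1
      have hz := (fl_step_zero hK1 h2 h4 hLfg 0 h3).trans h0
      first
      | (exfalso
         rw [Nat.cast_zero, nonpos_iff_eq_zero] at hz
         simp at hz)
      | (have hb : fl 𝓚 L1 0 ≤ (b : ℕ∞) := by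
           push_cast at hz
           exact (ENat.add_le_add_iff_right (by simp)).mp hz
         have hev := ih 𝓚 L1 hK1 ((Submodule.smul_mono le_rfl h2).trans hN) hb
         obtain ⟨v, hv, hv1⟩ := Set.not_subset.mp
           (show ¬ (L : Set 𝓕) ⊆ L1 from fun h => h4 (le_antisymm h2 h))
         have hspan : Submodule.span A[X] {v} ⊔ L1 ≤ L :=
           sup_le (by simpa using hv) h2
         have hE := hsat (Submodule.span A[X] {v} ⊔ L1) (h1.trans le_sup_right) hspan (by
           intro hin
           refine hmax _ hin (lt_of_le_of_ne (le_sup_right.trans (le_fsat hspan)) ?_)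
           intro e
           apply hv1
           have : v ∈ fsat L (Submodule.span A[X] {v} ⊔ L1) :=
             le_fsat hspan (Submodule.mem_sup_left (Submodule.mem_span_singleton_self v))
           rwa [← e] at this)
         obtain ⟨f, hf, hfu⟩ := exists_common_f (𝓚 := Submodule.span A[X] {v} ⊔ L1) hLfg
           (fun u hu => by rw [← hE] at hu; exact hu.2)
         filter_upwards [hev, gen_eval hf] with τ hτ1 hτ2
         refine (fl_step hK1 h2 hv hfu hτ2 ?_).trans ?_
         · intro c hc
           apply h1
           apply Submodule.mem_sup_left
           rw [← C_smul]
           exact Submodule.smul_mem_smul (Ideal.mem_map_of_mem _ hc) hv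
         · push_cast
           gcongr)

end GR


open Filter IsLocalRing
set_option linter.unusedSectionVars false

section GR2

open Polynomial

variable {A : Type*} [CommRing A] [IsLocalRing A] [IsNoetherianRing A]

lemma nk {E : Type*} [AddCommGroup E] [Module A E] {Q W0 : Submodule A E} (hfg : W0.FG) {b : ℕ}
    (h : rl (Q ⊔ maximalIdeal A ^ (b + 1) • W0) (Q ⊔ W0) ≤ (b : ℕ∞)) :
    maximalIdeal A ^ b • W0 ≤ Q ∧ rl Q (Q ⊔ W0) ≤ (b : ℕ∞) := by
  set m := maximalIdeal A
  have hanti : ∀ {i j : ℕ}, i ≤ j → m ^ j • W0 ≤ m ^ i • W0 := fun hij =>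
    Submodule.smul_mono (Ideal.pow_le_pow_right hij) le_rfl
  have hex : ∃ j ≤ b, m ^ j • W0 ≤ Q ⊔ m ^ (j + 1) • W0 := by
    by_contra! hno
    have key : ∀ j ≤ b + 1, (j : ℕ∞) ≤ rl (Q ⊔ m ^ j • W0) (Q ⊔ W0) := by
      intro j
      induction j with
      | zero => intro _; simp
      | succ j ih =>
        intro hj
        have h1 : Q ⊔ m ^ (j + 1) • W0 ≤ Q ⊔ m ^ j • W0 := sup_le_sup_left (hanti (Nat.le_succ j)) _
        have h2 : Q ⊔ m ^ j • W0 ≤ Q ⊔ W0 := sup_le_sup_left Submodule.smul_le_right _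
        rw [rl_add h2 h1]
        push_cast
        rw [add_comm]
        refine add_le_add ?_ (ih (by omega))
        rw [Order.one_le_iff_ne_zero, Ne, rl_eq_zero]
        exact fun hle => hno j (by omega) (le_sup_right.trans hle)
    have := (key (b + 1) le_rfl).trans h
    have h' : b + 1 ≤ b := by exact_mod_cast this
    omega
  obtain ⟨j, hj, hle⟩ := hex
  have hmfg : ((m ^ j : Ideal A)).FG := (isNoetherianRing_iff_ideal_fg A).mp inferInstance _
  have hQ : m ^ j • W0 ≤ Q := by
    refine Submodule.le_of_le_smul_of_le_jacobson_bot (I := m) (Submodule.FG.smul hmfg hfg)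
      (IsLocalRing.maximalIdeal_le_jacobson _) ?_
    rwa [← Submodule.mul_smul, ← pow_succ']
  refine ⟨(hanti hj).trans hQ, ?_⟩
  have : Q ⊔ m ^ (b + 1) • W0 = Q := sup_eq_left.mpr ((hanti (by omega)).trans hQ)
  rwa [this] at h

variable {𝓕 : Type*} [AddCommGroup 𝓕] [Module A[X] 𝓕]
variable [Module A 𝓕] [IsScalarTower A A[X] 𝓕]

lemma map_pow_smul_rs (n : ℕ) (L : Submodule A[X] 𝓕) :
    (((maximalIdeal A).map (C : A →+* A[X])) ^ n • L).restrictScalars A =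
      maximalIdeal A ^ n • L.restrictScalars A := by
  rw [← Ideal.map_pow, ← Polynomial.algebraMap_eq, Ideal.smul_restrictScalars]

lemma GR2 [Module.Finite A[X] 𝓕] {𝓚 L : Submodule A[X] 𝓕} (hKL : 𝓚 ≤ L) {b : ℕ}
    (h0 : fl 𝓚 L 0 ≤ (b : ℕ∞)) : ∀ᶠ τ in gen A, fl 𝓚 L τ ≤ (b : ℕ∞) ∧
      ((maximalIdeal A).map C) ^ b • L ≤ 𝓚 ⊔ xm (X - C τ) L := by
  set J := (maximalIdeal A).map (C : A →+* A[X]) with hJ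
  have hz : fl (𝓚 ⊔ J ^ (b + 1) • L) L 0 ≤ (b : ℕ∞) := by
    refine (rl_mono ?_ le_rfl).trans h0
    have : 𝓚 ⊔ xm (X - C 0) L ≤ 𝓚 ⊔ J ^ (b + 1) • L ⊔ xm (X - C 0) L :=
      sup_le_sup_right le_sup_left _
    exact this
  refine (GR1 (b + 1) b _ L (sup_le hKL Submodule.smul_le_right) le_sup_right hz).mono
    fun τ hτ => ?_
  obtain ⟨s, hs⟩ := IsNoetherian.noetherian L
  set W0 := Submodule.span A (s : Set 𝓕) with hW0
  set Q := (𝓚 ⊔ xm (X - C τ) L).restrictScalars A with hQ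
  have hsL : (s : Set 𝓕) ⊆ L := by rw [← hs]; exact Submodule.subset_span
  have hQL : Q ⊔ W0 = L.restrictScalars A := by
    apply le_antisymm
    · refine sup_le ?_ (Submodule.span_le.mpr hsL)
      have : 𝓚 ⊔ xm (X - C τ) L ≤ L := sup_le hKL xm_le
      exact this
    · intro u hu
      have hu' : u ∈ Submodule.span A[X] (s : Set 𝓕) := by rw [hs]; exact hu
      induction hu' using Submodule.span_induction with
      | mem x hx => exact Submodule.mem_sup_right (Submodule.subset_span hx)
      | zero => exact Submodule.zero_mem _
      | add x y hx hy h1 h2 =>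
        rw [hs] at hx hy
        exact Submodule.add_mem _ (h1 hx) (h2 hy)
      | smul p x hx h1 =>
        rw [hs] at hx
        obtain ⟨g, hg⟩ : X - C τ ∣ p - C (p.eval τ) := X_sub_C_dvd_sub_C_eval
        have : p • x = p.eval τ • x + (X - C τ) • (g • x) := by
          rw [← mul_smul, ← hg, sub_smul, C_smul]; abel
        rw [this]
        refine Submodule.add_mem _ (Submodule.smul_mem _ _ (h1 hx)) (Submodule.mem_sup_left ?_)
        exact Submodule.mem_sup_right (S := 𝓚) (smul_mem_xm (L.smul_mem _ hx))
  have hmul : ∀ n : ℕ, (J ^ n • L).restrictScalars A ≤ Q ⊔ maximalIdeal A ^ n • W0 := by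
    intro n
    rw [hJ, map_pow_smul_rs, ← hQL, Submodule.smul_sup]
    exact sup_le_sup_right Submodule.smul_le_right _
  have hnk := nk (Q := Q) (W0 := W0) ⟨s, rfl⟩ (b := b) (by
    rw [hQL]
    refine (rl_mono ?_ le_rfl).trans hτ
    intro u hu
    obtain ⟨w, hw, y, hy, rfl⟩ := Submodule.mem_sup.mp
      (show u ∈ 𝓚 ⊔ J ^ (b + 1) • L ⊔ xm (X - C τ) L from hu)
    obtain ⟨k, hk, v, hv, rfl⟩ := Submodule.mem_sup.mp hw
    refine Submodule.add_mem _ (Submodule.add_mem _ ?_ (hmul _ hv)) ?_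
    · exact Submodule.mem_sup_left (Submodule.mem_sup_left (S := 𝓚) hk)
    · exact Submodule.mem_sup_left (Submodule.mem_sup_right (S := 𝓚) hy))
  rw [hQL] at hnk
  refine ⟨hnk.2, fun u hu => ?_⟩
  have := (hmul b).trans (sup_le le_rfl hnk.1)
  exact this hu

lemma GRf [Infinite (ResidueField A)] [Module.Finite A[X] 𝓕] {𝓚 L : Submodule A[X] 𝓕}
    (hKL : 𝓚 ≤ L) {b : ℕ}
    (h0 : fl 𝓚 L 0 ≤ (b : ℕ∞)) : ∃ f : A[X], f.map (residue A) ≠ 0 ∧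
      ∀ u ∈ ((maximalIdeal A).map C) ^ b • L, f • u ∈ 𝓚 := by
  set J := (maximalIdeal A).map (C : A →+* A[X]) with hJ
  have hne := gen_neBot (A := A)
  obtain ⟨τ, h1, h2⟩ := ((GR2 hKL h0).and (gen_X_reg (J ^ b • L ⊔ 𝓚))).exists
  set W := J ^ b • L ⊔ 𝓚 with hW
  obtain ⟨r, hr, hru⟩ := nak_xm (K := 𝓚) (L := W) (IsNoetherian.noetherian W) (X - C τ) (by
    refine sup_le ?_ le_sup_left
    intro w hw
    obtain ⟨k, hk, _, ⟨v, hv, rfl⟩, e⟩ := Submodule.mem_sup.mp (h1.2 hw)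
    refine Submodule.mem_sup.mpr ⟨k, hk, _, ⟨v, h2 v ?_, rfl⟩, e⟩
    have : (X - C τ) • v = w - k := by rw [← e, LinearMap.lsmul_apply]; abel
    rw [this]
    exact W.sub_mem (Submodule.mem_sup_left hw) (Submodule.mem_sup_right hk))
  exact ⟨r, map_ne_zero_of_sub_one_mem hr, fun u hu => hru u (Submodule.mem_sup_left hu)⟩

end GR2


open Filter IsLocalRing
set_option linter.unusedSectionVars false

section Semi

open Polynomial

variable {A : Type*} [CommRing A] [IsLocalRing A] [IsNoetherianRing A]
variable {𝓕 : Type*} [AddCommGroup 𝓕] [Module A[X] 𝓕]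
variable [Module A 𝓕] [IsScalarTower A A[X] 𝓕]

/-- preimage of the fibre submodule -/
noncomputable def Fib (𝓚 : Submodule A[X] 𝓕) (τ : A) : Submodule A 𝓕 :=
  (𝓚 ⊔ xm (X - C τ) ⊤).restrictScalars A

lemma mem_Fib {𝓚 : Submodule A[X] 𝓕} {τ : A} {u : 𝓕} :
    u ∈ Fib 𝓚 τ ↔ ∃ k ∈ 𝓚, ∃ v : 𝓕, k + (X - C τ) • v = u := by
  constructor
  · intro h
    obtain ⟨k, hk, _, ⟨v, -, rfl⟩, e⟩ := Submodule.mem_sup.mp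
      (show u ∈ 𝓚 ⊔ xm (X - C τ) ⊤ from h)
    exact ⟨k, hk, v, e⟩
  · rintro ⟨k, hk, v, e⟩
    exact Submodule.mem_sup.mpr ⟨k, hk, _, ⟨v, trivial, rfl⟩, e⟩

lemma mem_Fib_left {𝓚 : Submodule A[X] 𝓕} {τ : A} {u : 𝓕} (h : u ∈ 𝓚) : u ∈ Fib 𝓚 τ :=
  mem_Fib.mpr ⟨u, h, 0, by simp⟩

lemma mem_Fib_right {𝓚 : Submodule A[X] 𝓕} {τ : A} (u : 𝓕) : (X - C τ) • u ∈ Fib 𝓚 τ :=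
  mem_Fib.mpr ⟨0, 𝓚.zero_mem, u, by simp⟩

lemma Fib_mono {𝓚 L : Submodule A[X] 𝓕} (h : 𝓚 ≤ L) (τ : A) : Fib 𝓚 τ ≤ Fib L τ := by
  intro u hu
  obtain ⟨k, hk, v, e⟩ := mem_Fib.mp hu
  exact mem_Fib.mpr ⟨k, h hk, v, e⟩

lemma mem_isatB {I : Ideal A} {L : Submodule A[X] 𝓕} {u : 𝓕} :
    u ∈ isat (I.map (C : A →+* A[X])) L ↔ ∃ k : ℕ, ∀ c ∈ I ^ k, (C c : A[X]) • u ∈ L := by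
  constructor
  · rintro ⟨k, hk⟩
    refine ⟨k, fun c hc => hk _ ?_⟩
    rw [← Ideal.map_pow]
    exact Ideal.mem_map_of_mem _ hc
  · rintro ⟨k, hk⟩
    refine ⟨k, fun c hc => ?_⟩
    rw [← Ideal.map_pow] at hc
    have : (I ^ k).map (C : A →+* A[X]) ≤ LinearMap.ker (L.mkQ ∘ₗ LinearMap.toSpanSingleton A[X] 𝓕 u) := by
      rw [Ideal.map_le_iff_le_comap]
      intro a ha
      have : (Submodule.Quotient.mk (C a • u) : 𝓕 ⧸ L) = 0 :=
        (Submodule.Quotient.mk_eq_zero L).mpr (hk a ha)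
      simpa using this
    have h2 := this hc
    rw [← Submodule.Quotient.mk_eq_zero]
    simpa using h2

lemma isatB_le {I : Ideal A} {L : Submodule A[X] 𝓕} {u : 𝓕} (τ : A)
    (h : u ∈ isat (I.map (C : A →+* A[X])) L) : u ∈ isat I (Fib L τ) := by
  obtain ⟨k, hk⟩ := mem_isatB.mp h
  refine ⟨k, fun c hc => mem_Fib_left ?_⟩
  rw [← C_smul]
  exact hk c hc

lemma fl_le_rl_Fib {𝓚 L : Submodule A[X] 𝓕} {τ : A} (hKL : 𝓚 ≤ L)
    (hX : ∀ v : 𝓕, (X - C τ) • v ∈ L → v ∈ L) {H : Submodule A 𝓕}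
    (hH : ∀ u ∈ L, u ∈ H) : fl 𝓚 L τ ≤ rl (Fib 𝓚 τ) H := by
  refine rl_le_of_inj LinearMap.id ?_ ?_
  · rw [Submodule.map_id]; exact hH
  · intro u hu hu'
    obtain ⟨k, hk, v, e⟩ := mem_Fib.mp hu'
    refine Submodule.mem_sup.mpr ⟨k, hk, _, ⟨v, hX v ?_, rfl⟩, e⟩
    have : (X - C τ) • v = u - k := by
      rw [show u = LinearMap.id (R := A) u from rfl, ← e]; abel
    rw [this]
    exact L.sub_mem hu (hKL hk)

lemma rl_Fib_le_fl {𝓚 L : Submodule A[X] 𝓕} {τ : A} :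
    rl (Fib 𝓚 τ) (Fib L τ) ≤ fl 𝓚 L τ := by
  refine rl_le_of_map LinearMap.id ?_ ?_
  · rw [Submodule.map_id]
    intro u hu
    obtain ⟨k, hk, v, rfl⟩ := mem_Fib.mp hu
    exact Submodule.add_mem_sup hk (mem_Fib_right v)
  · intro u _ hu'
    obtain ⟨k, hk, _, ⟨v, -, rfl⟩, e⟩ := Submodule.mem_sup.mp
      (show u ∈ 𝓚 ⊔ xm (X - C τ) L from hu')
    exact mem_Fib.mpr ⟨k, hk, v, e⟩

theorem semi [Infinite (ResidueField A)] [Module.Finite A[X] 𝓕] {I : Ideal A}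
    (hIm : I ≤ maximalIdeal A) (d : ℕ) : ∀ (δ : ℕ) (𝓚 : Submodule A[X] 𝓕),
    (∀ u : 𝓕, (X - C (0 : A)) • u ∈ 𝓚 → u ∈ 𝓚) → PD I d δ (Fib 𝓚 0) →
    ∀ᶠ τ in gen A, PD I d δ (Fib 𝓚 τ) := by
  induction d with
  | zero =>
    intro δ 𝓚 _ hP
    have hP' : rl (Fib 𝓚 0) ⊤ ≤ (δ : ℕ∞) := hP
    exact (GR2 (𝓚 := 𝓚) (L := ⊤) le_top hP').mono fun τ hτ => hτ.1
  | succ d ih =>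
    rintro δ 𝓚 hX ⟨x, hx, l, e, hle, hl, hreg, hP⟩
    set J := I.map (C : A →+* A[X]) with hJ
    set L := isat J 𝓚 with hL
    set Λ := isat I (Fib 𝓚 0) with hΛ
    have hKL : 𝓚 ≤ L := le_isat _ _
    have hLL : isat J L = L := isat_isat _ _
    have hLX : ∀ u : 𝓕, (X - C (0 : A)) • u ∈ L → u ∈ L := by
      intro u hu
      obtain ⟨k, hk⟩ := mem_isatB.mp hu
      refine mem_isatB.mpr ⟨k, fun c hc => hX _ ?_⟩
      rw [smul_comm]
      exact hk c hc
    have hLΛ : ∀ u ∈ L, u ∈ Λ := fun u hu => isatB_le 0 hu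
    have hFLΛ : Fib L 0 ≤ Λ := by
      intro u hu
      obtain ⟨k, hk, v, rfl⟩ := mem_Fib.mp hu
      exact Λ.add_mem (hLΛ k hk) (le_isat _ _ (mem_Fib_right v))
    set 𝓜 := L ⊔ xm (C x) ⊤ with h𝓜
    have hF𝓜 : ∀ τ : A, Fib 𝓜 τ = Fib L τ ⊔ xm x ⊤ := by
      intro τ
      apply le_antisymm
      · intro u hu
        obtain ⟨k, hk, v, rfl⟩ := mem_Fib.mp hu
        obtain ⟨w, hw, _, ⟨y, -, rfl⟩, rfl⟩ := Submodule.mem_sup.mp hk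
        refine Submodule.add_mem _ (Submodule.add_mem_sup (mem_Fib_left hw) ?_)
          (Submodule.mem_sup_left (mem_Fib_right v))
        rw [LinearMap.lsmul_apply, C_smul]
        exact smul_mem_xm trivial
      · refine sup_le (Fib_mono le_sup_left τ) ?_
        rintro _ ⟨u, -, rfl⟩
        refine mem_Fib_left (Submodule.mem_sup_right ?_)
        rw [LinearMap.lsmul_apply, ← C_smul]
        exact smul_mem_xm trivial
    have hsum := rl_add hFLΛ (Fib_mono hKL 0)
    rw [hsum] at hl
    have hfin0 : rl (Fib 𝓚 0) (Fib L 0) ≠ ⊤ := by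
      intro h; rw [h, top_add] at hl; exact ENat.natCast_ne_top l (top_le_iff.mp hl)
    have hfin1 : rl (Fib L 0) Λ ≠ ⊤ := by
      intro h; rw [h, add_top] at hl; exact ENat.natCast_ne_top l (top_le_iff.mp hl)
    obtain ⟨l0, hl0⟩ := ENat.ne_top_iff_exists.mp hfin0
    obtain ⟨l1, hl1⟩ := ENat.ne_top_iff_exists.mp hfin1
    rw [← hl0, ← hl1] at hl
    have hll : l0 + l1 ≤ l := by exact_mod_cast hl
    have hP1 : PD I d (e + l1) (Fib 𝓜 0) := by
      refine PD_T (K₂ := Λ ⊔ xm x ⊤) ?_ ?_ ?_ hP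
      · rw [hF𝓜]; exact sup_le_sup_right hFLΛ _
      · refine sup_le (isat_mono (Fib_mono (hKL.trans le_sup_left) 0)) ?_
        refine le_trans ?_ (le_isat _ _)
        rw [hF𝓜]; exact le_sup_right
      · rw [hl1]
        refine rl_le_of_map LinearMap.id ?_ ?_
        · rw [Submodule.map_id, hF𝓜]
          exact sup_le le_sup_left (le_sup_right.trans le_sup_right)
        · intro u _ hu
          rw [hF𝓜]
          exact Submodule.mem_sup_left hu
    have key0 : ∀ u : 𝓕, (X - C (0 : A)) • u ∈ 𝓜 → u ∈ isat J 𝓜 := by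
      intro u hu
      obtain ⟨w, hw, _, ⟨v, -, rfl⟩, he⟩ := Submodule.mem_sup.mp hu
      rw [LinearMap.lsmul_apply] at he
      have hv : v ∈ Λ := by
        refine hreg v (hFLΛ ?_)
        refine mem_Fib.mpr ⟨-w, L.neg_mem hw, u, ?_⟩
        rw [← he, C_smul]; abel
      obtain ⟨k, hk⟩ := hv
      refine mem_isatB.mpr ⟨k, fun c hc => ?_⟩
      obtain ⟨w', hw', v', he'⟩ := mem_Fib.mp (hk c hc)
      have h1 : C c • u - C x • v' ∈ L := by
        apply hLX
        have : (X - C (0 : A)) • (C c • u - C x • v') = C c • w + C x • w' := by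
          rw [smul_sub, smul_comm _ (C c), ← he, smul_add, smul_comm (C c) (C x), C_smul c v, ← he',
            smul_add, smul_comm (C x) (X - C (0 : A))]
          abel
        rw [this]
        exact L.add_mem (L.smul_mem _ hw) (L.smul_mem _ (hKL hw'))
      have : C c • u = (C c • u - C x • v') + C x • v' := by abel
      rw [this]
      exact Submodule.add_mem_sup h1 (smul_mem_xm trivial)
    have key1 : ∀ u : 𝓕, (X - C (0 : A)) • u ∈ isat J 𝓜 → u ∈ isat J 𝓜 := by
      intro u hu
      obtain ⟨k, hk⟩ := mem_isatB.mp hu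
      rw [← isat_isat]
      refine mem_isatB.mpr ⟨k, fun c hc => key0 _ ?_⟩
      rw [smul_comm]
      exact hk c hc
    set 𝓩 := isat (Ideal.span {X - C (0 : A)}) 𝓜 with h𝓩
    have h𝓜𝓩 : 𝓜 ≤ 𝓩 := le_isat _ _
    have h𝓩𝓜 : ∀ u ∈ 𝓩, u ∈ isat J 𝓜 := by
      rintro u ⟨k, hk⟩
      have h1 := le_isat J 𝓜 (hk ((X - C (0 : A)) ^ k)
        (Ideal.pow_mem_pow (Ideal.mem_span_singleton_self _) k))
      clear hk
      induction k with
      | zero => simpa using h1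
      | succ k ihk =>
        apply ihk
        apply key1
        rwa [pow_succ', mul_smul] at h1
    have h𝓩X : ∀ u : 𝓕, (X - C (0 : A)) • u ∈ 𝓩 → u ∈ 𝓩 := by
      intro u hu
      rw [h𝓩, ← isat_isat]
      refine ⟨1, fun c hc => ?_⟩
      rw [pow_one] at hc
      obtain ⟨g, rfl⟩ := Ideal.mem_span_singleton'.mp hc
      rw [mul_smul]
      exact 𝓩.smul_mem _ hu
    have hP2 : PD I d (e + l1) (Fib 𝓩 0) := by
      refine PD_T' (Fib_mono h𝓜𝓩 0) ?_ hP1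
      intro u hu
      obtain ⟨k, hk, v, rfl⟩ := mem_Fib.mp hu
      exact Submodule.add_mem _ (isatB_le 0 (h𝓩𝓜 k hk)) (le_isat _ _ (mem_Fib_right v))
    obtain ⟨kz, hkz⟩ := exists_pow_smul_le_of_le_isat (IsNoetherian.noetherian 𝓩) h𝓩.le
    have hkz' : ∀ u ∈ 𝓩, (X - C (0 : A)) ^ kz • u ∈ 𝓜 := fun u hu =>
      hkz (Submodule.smul_mem_smul (Ideal.pow_mem_pow (Ideal.mem_span_singleton_self _) kz) hu)
    have hXk : ((X - C (0 : A)) ^ kz).map (residue A) ≠ 0 := by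
      rw [Polynomial.map_pow]; exact pow_ne_zero _ (XC_map_ne_zero 0)
    -- the colon submodule
    set U := L.comap (LinearMap.lsmul A[X] 𝓕 (C x)) with hU
    have hLU : L ≤ U := fun u hu => L.smul_mem _ hu
    have hUX : ∀ u : 𝓕, (X - C (0 : A)) • u ∈ U → u ∈ U := by
      intro u hu
      refine hLX _ ?_
      have h1 : C x • (X - C (0 : A)) • u ∈ L := hu
      rw [smul_comm] at h1
      exact h1
    have hflU : fl L U 0 ≤ (l1 : ℕ∞) := by
      rw [hl1]
      refine fl_le_rl_Fib hLU hUX fun u hu => hreg u (hLΛ _ ?_)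
      have h1 : C x • u ∈ L := hu
      rwa [C_smul] at h1
    obtain ⟨f, hf, hfU⟩ := GRf hLU hflU
    have hfU' : ∀ u ∈ U, f • u ∈ L := by
      intro u hu
      rw [← hLL]
      refine mem_isatB.mpr ⟨l1, fun c hc => ?_⟩
      rw [smul_comm]
      refine hfU _ (Submodule.smul_mem_smul ?_ hu)
      rw [← Ideal.map_pow]
      exact Ideal.mem_map_of_mem _ (Ideal.pow_right_mono hIm _ hc)
    have hfl0 : fl 𝓚 L 0 ≤ (l0 : ℕ∞) := by
      rw [hl0]
      exact fl_le_rl_Fib hKL hLX fun u hu => mem_Fib_left hu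
    filter_upwards [ih _ 𝓩 h𝓩X hP2, GR2 hKL hfl0, gen_X_reg 𝓜, gen_eval hf, gen_eval hXk]
      with τ t1 t2 t3 t4 t5
    have hZM : Fib 𝓩 τ = Fib 𝓜 τ := by
      refine le_antisymm ?_ (Fib_mono h𝓜𝓩 τ)
      intro u hu
      obtain ⟨k, hk, v, rfl⟩ := mem_Fib.mp hu
      obtain ⟨w, hw, _, ⟨y, -, rfl⟩, rfl⟩ := Submodule.mem_sup.mp (le_of_eval_unit t5 hkz' hk)
      exact Submodule.add_mem _ (Submodule.add_mem _ (mem_Fib_left hw) (mem_Fib_right y))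
        (mem_Fib_right v)
    have hxreg : ∀ u, x • u ∈ Fib L τ → u ∈ Fib L τ := by
      intro u hu
      obtain ⟨w, hw, v, hev⟩ := mem_Fib.mp hu
      have hv : v ∈ 𝓜 := by
        apply t3
        have : (X - C τ) • v = -w + C x • u := by rw [C_smul, ← hev]; abel
        rw [this]
        exact Submodule.add_mem_sup (L.neg_mem hw) (smul_mem_xm trivial)
      obtain ⟨w', hw', _, ⟨v', -, rfl⟩, he'⟩ := Submodule.mem_sup.mp hv
      rw [LinearMap.lsmul_apply] at he'
      have h1 : u - (X - C τ) • v' ∈ U := by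
        change C x • (u - (X - C τ) • v') ∈ L
        have : C x • (u - (X - C τ) • v') = w + (X - C τ) • w' := by
          rw [smul_sub, C_smul x u, ← hev, ← he', smul_add, smul_comm (C x)]; abel
        rw [this]
        exact L.add_mem hw (L.smul_mem _ hw')
      obtain ⟨w2, hw2, _, ⟨y, -, rfl⟩, he2⟩ := Submodule.mem_sup.mp (le_of_eval_unit t4 hfU' h1)
      have : u = w2 + (X - C τ) • y + (X - C τ) • v' := by
        rw [← sub_eq_iff_eq_add, ← he2, LinearMap.lsmul_apply]
      rw [this]
      exact Submodule.add_mem _ (Submodule.add_mem _ (mem_Fib_left hw2) (mem_Fib_right y))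
        (mem_Fib_right v')
    have hsat : isat I (Fib 𝓚 τ) = Fib L τ := by
      apply le_antisymm
      · rintro u ⟨k, hk⟩
        have h1 := Fib_mono hKL τ (hk (x ^ k) (Ideal.pow_mem_pow hx k))
        clear hk
        induction k with
        | zero => simpa using h1
        | succ k ihk =>
          apply ihk
          apply hxreg
          rwa [pow_succ', mul_smul] at h1
      · intro u hu
        obtain ⟨k, hk, v, rfl⟩ := mem_Fib.mp hu
        exact Submodule.add_mem _ (isatB_le τ hk) (le_isat _ _ (mem_Fib_right v))
    refine ⟨x, hx, l0, e + l1, by omega, ?_, ?_, ?_⟩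
    · rw [hsat]
      exact rl_Fib_le_fl.trans t2.1
    · rw [hsat]; exact hxreg
    · rw [hsat, ← hF𝓜, ← hZM]
      exact t1

end Semi


open Filter IsLocalRing
set_option linter.unusedSectionVars false

section SemiS

open Polynomial

variable {A : Type*} [CommRing A] {N : Type*} [AddCommGroup N] [Module A N]

lemma pm_C_smul (a : A) (u : PolynomialModule A N) : (C a : A[X]) • u = a • u := by
  rw [← Polynomial.algebraMap_eq, algebraMap_smul]

lemma pm_X_pow_smul (n : ℕ) (u : N) :
    (X : A[X]) ^ n • PolynomialModule.single A 0 u = PolynomialModule.single A n u := by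
  rw [X_pow_eq_monomial, PolynomialModule.monomial_smul_single]
  simp

lemma pm_sub_eval (τ : A) (u : PolynomialModule A N) : ∃ v : PolynomialModule A N,
    u = PolynomialModule.single A 0 (PolynomialModule.eval τ u) + (X - C τ) • v := by
  induction u using PolynomialModule.induction_linear with
  | zero => exact ⟨0, by simp⟩
  | add u v hu hv =>
    obtain ⟨a, ha⟩ := hu
    obtain ⟨b, hb⟩ := hv
    refine ⟨a + b, ?_⟩
    rw [map_add, PolynomialModule.single_add, smul_add]
    nth_rewrite 1 [ha, hb]
    abel
  | single n u =>
    obtain ⟨g, hg⟩ : (X - C τ : A[X]) ∣ X ^ n - C (τ ^ n) := by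
      rw [C_pow]; exact sub_dvd_pow_sub_pow _ _ _
    refine ⟨g • PolynomialModule.single A 0 u, ?_⟩
    rw [← mul_smul, ← hg, sub_smul, pm_X_pow_smul, PolynomialModule.eval_single,
      PolynomialModule.single_smul, pm_C_smul]
    abel

instance pm_finite [Module.Finite A N] : Module.Finite A[X] (PolynomialModule A N) := by
  obtain ⟨s, hs⟩ := Module.Finite.fg_top (R := A) (M := N)
  classical
  refine ⟨⟨s.image (PolynomialModule.single A 0), ?_⟩⟩
  rw [eq_top_iff]
  intro u _
  set S := Submodule.span A[X] ((s.image (PolynomialModule.single A 0) : Finset _) :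
    Set (PolynomialModule A N))
  have h0 : ∀ v : N, PolynomialModule.single A 0 v ∈ S := by
    intro v
    have hv : v ∈ Submodule.span A (s : Set N) := by rw [hs]; trivial
    induction hv using Submodule.span_induction with
    | mem x hx => exact Submodule.subset_span (by simpa using ⟨x, hx, rfl⟩)
    | zero => simp
    | add x y _ _ h1 h2 => rw [PolynomialModule.single_add]; exact S.add_mem h1 h2
    | smul a x _ h1 =>
      rw [PolynomialModule.single_smul, ← pm_C_smul]
      exact S.smul_mem _ h1
  induction u using PolynomialModule.induction_linear with
  | zero => exact S.zero_mem
  | add u v hu hv => exact S.add_mem (hu trivial) (hv trivial)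
  | single n v => rw [← pm_X_pow_smul]; exact S.smul_mem _ (h0 v)

lemma pm_X_reg (u : PolynomialModule A N) (h : (X : A[X]) • u = 0) : u = 0 := by
  apply PolynomialModule.coeff_injective
  ext n
  have := congrArg (fun w => w.coeff (n + 1)) h
  rw [← monomial_one_one_eq_X] at this
  simp only [PolynomialModule.monomial_smul_apply] at this
  simpa using this

theorem semiS [IsLocalRing A] [IsNoetherianRing A] [Infinite (ResidueField A)] [Module.Finite A N]
    {I : Ideal A} (hIm : I ≤ maximalIdeal A) {d δ : ℕ} {x : A} (z : A)
    (hreg : ∀ u : N, x • u = 0 → u = 0) (hP : PD I d δ (xm x (⊤ : Submodule A N))) :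
    ∀ᶠ τ in gen A, PD I d δ (xm (x + τ * z) (⊤ : Submodule A N)) := by
  set 𝓚 : Submodule A[X] (PolynomialModule A N) := xm (C x + X * C z) ⊤ with h𝓚
  have hsurj : ∀ τ : A, Function.Surjective
      (PolynomialModule.eval τ : PolynomialModule A N →ₗ[A] N) := fun τ u =>
    ⟨PolynomialModule.single A 0 u, by simp⟩
  have hFib : ∀ τ : A, Fib 𝓚 τ = (xm (x + τ * z) (⊤ : Submodule A N)).comap
      (PolynomialModule.eval τ) := by
    intro τ
    ext u
    rw [mem_Fib, Submodule.mem_comap]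
    constructor
    · rintro ⟨_, ⟨k, -, rfl⟩, v, rfl⟩
      refine ⟨PolynomialModule.eval τ k, trivial, ?_⟩
      rw [LinearMap.lsmul_apply, LinearMap.lsmul_apply, map_add, PolynomialModule.eval_smul,
        PolynomialModule.eval_smul]
      simp only [eval_add, eval_C, eval_mul, eval_X, PolynomialModule.eval_smul, eval_sub, sub_self, zero_smul, add_zero]
    · rintro ⟨n, -, hn⟩
      obtain ⟨v, hv⟩ := pm_sub_eval τ u
      obtain ⟨w, hw⟩ := pm_sub_eval τ ((C x + X * C z) • PolynomialModule.single A 0 n)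
      refine ⟨_, smul_mem_xm (x := C x + X * C z) (u := PolynomialModule.single A 0 n) trivial,
        v - w, ?_⟩
      rw [hw, PolynomialModule.eval_smul, hv, ← hn]
      simp only [map_add, PolynomialModule.eval_single, LinearMap.lsmul_apply,
        PolynomialModule.eval_smul, smul_sub]
      simp
      rw [← PolynomialModule.single_add, ← add_smul, mul_comm]
  have h0 : PD I d δ (Fib 𝓚 0) := by
    rw [hFib, PD_comap (hsurj 0)]
    simpa using hP
  refine (semi hIm d δ 𝓚 ?_ h0).mono fun τ hτ => ?_
  · rintro u ⟨v, -, hv⟩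
    rw [LinearMap.lsmul_apply] at hv
    have e0 : PolynomialModule.eval 0 v = 0 := by
      apply hreg
      have := congrArg (PolynomialModule.eval (0 : A)) hv
      rw [PolynomialModule.eval_smul, PolynomialModule.eval_smul] at this
      simpa using this
    obtain ⟨v', hv'⟩ := pm_sub_eval 0 v
    rw [e0, PolynomialModule.single_zero, zero_add] at hv'
    refine ⟨v', trivial, ?_⟩
    rw [LinearMap.lsmul_apply, ← sub_eq_zero]
    apply pm_X_reg
    rw [smul_sub, sub_eq_zero]
    rw [C_0, sub_zero] at hv hv'
    rw [← hv, hv', smul_comm]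
  · rw [hFib, PD_comap (hsurj τ)] at hτ
    exact hτ

end SemiS


open Filter IsLocalRing
set_option linter.unusedSectionVars false

section Superficial

open Polynomial

variable {A : Type*} [CommRing A] {N : Type*} [AddCommGroup N] [Module A N]

lemma exists_avoid [IsLocalRing A] [Infinite (ResidueField A)] (I : Ideal A)
    {S : Set (Submodule A I)} (hS : S.Finite) (h : ∀ V ∈ S, V ≠ ⊤) :
    ∃ z : I, ∀ V ∈ S, z ∉ V := by
  induction S, hS using Set.Finite.induction_on with
  | empty => exact ⟨0, by simp⟩
  | @insert V S hV hS ih =>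
    obtain ⟨z, hz⟩ := ih fun W hW => h W (Set.mem_insert_of_mem _ hW)
    obtain ⟨y, hy⟩ : ∃ y : I, y ∉ V := by
      by_contra! hc
      exact h V (Set.mem_insert _ _) (eq_top_iff.mpr fun u _ => hc u)
    have key : ∀ W : Submodule A I, (z ∉ W ∨ y ∉ W) →
        ∀ᶠ τ in gen A, τ ∉ {τ : A | z + τ • y ∈ W} := by
      intro W hW
      refine gen_line fun τ hτ τ' hτ' => ?_
      by_contra hne
      have hu := residue_ne_isUnit hne
      have h1 : (τ - τ') • y ∈ W := by
        have := W.sub_mem hτ hτ'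
        have e : z + τ • y - (z + τ' • y) = (τ - τ') • y := by rw [sub_smul]; abel
        rwa [e] at this
      have h2 : y ∈ W := (Submodule.smul_mem_iff_of_isUnit _ hu).mp h1
      rcases hW with h3 | h3
      · refine h3 ?_
        have := W.sub_mem hτ (W.smul_mem τ h2)
        rwa [add_sub_cancel_right] at this
      · exact h3 h2
    have h4 : ∀ᶠ τ in gen A, ∀ W ∈ S, τ ∉ {τ : A | z + τ • y ∈ W} := by
      rw [Filter.eventually_all_finite hS]
      exact fun W hW => key W (Or.inl (hz W hW))
    have := gen_neBot (A := A)
    obtain ⟨τ, h5, h6⟩ := (h4.and (key V (Or.inr hy))).exists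
    refine ⟨z + τ • y, ?_⟩
    rintro W (rfl | hW)
    · exact h6
    · exact h5 W hW

/-- `V_n = {u ∈ N_n : I^k u ≤ N_{n+k+1}}` -/
def vfil {I : Ideal A} (F : I.Filtration N) : I.Filtration N where
  N n :=
    { carrier := {u | u ∈ F.N n ∧ ∃ k, ∀ c ∈ I ^ k, c • u ∈ F.N (n + k + 1)}
      zero_mem' := ⟨zero_mem _, 0, fun c _ => by simp⟩
      add_mem' := by
        rintro u v ⟨hu, k, hk⟩ ⟨hv, j, hj⟩
        have key : ∀ (w : N) (k i : ℕ), (∀ c ∈ I ^ k, c • w ∈ F.N (n + k + 1)) →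
            ∀ c ∈ I ^ (k + i), c • w ∈ F.N (n + (k + i) + 1) := by
          intro w k i hw c hc
          rw [pow_add, mul_comm] at hc
          induction hc using Submodule.mul_induction_on' with
          | mem_mul_mem a ha b hb =>
            rw [mul_smul]
            have := F.pow_smul_le i (n + k + 1) (Submodule.smul_mem_smul ha (hw b hb))
            rwa [show i + (n + k + 1) = n + (k + i) + 1 by omega] at this
          | add a _ b _ ha hb => rw [add_smul]; exact add_mem ha hb
        refine ⟨add_mem hu hv, k + j, fun c hc => ?_⟩
        rw [smul_add]
        refine add_mem (key u k j hk c hc) ?_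
        rw [add_comm k j] at hc ⊢
        exact key v j k hj c hc
      smul_mem' := by
        rintro a u ⟨hu, k, hk⟩
        refine ⟨Submodule.smul_mem _ _ hu, k, fun c hc => ?_⟩
        rw [smul_comm]
        exact Submodule.smul_mem _ _ (hk c hc) }
  mono n := by
    rintro u ⟨hu, -⟩
    refine ⟨F.mono n hu, 0, fun c _ => Submodule.smul_mem _ _ hu⟩
  smul_le n := by
    rw [Submodule.smul_le]
    rintro a ha u ⟨hu, k, hk⟩
    refine ⟨F.smul_le n (Submodule.smul_mem_smul ha hu), k, fun c hc => ?_⟩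
    rw [smul_comm]
    have := F.smul_le _ (Submodule.smul_mem_smul ha (hk c hc))
    rwa [show n + k + 1 + 1 = n + 1 + k + 1 by omega] at this

lemma mem_vfil {I : Ideal A} {F : I.Filtration N} {n : ℕ} {u : N} :
    u ∈ (vfil F).N n ↔ u ∈ F.N n ∧ ∃ k, ∀ c ∈ I ^ k, c • u ∈ F.N (n + k + 1) := Iff.rfl

lemma vfil_sat {I : Ideal A} (hI : I.FG) {F : I.Filtration N} {n : ℕ} {u : N} (hu : u ∈ F.N n)
    (h : ∀ a ∈ I, a • u ∈ (vfil F).N (n + 1)) : u ∈ (vfil F).N n := by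
  classical
  have key : ∀ J : Ideal A, J.FG → J ≤ I →
      ∃ k, ∀ a ∈ J, ∀ c ∈ I ^ k, c • a • u ∈ F.N (n + 1 + k + 1) := by
    intro J hJ
    refine Submodule.fg_induction (motive := fun J _ => J ≤ I →
      ∃ k, ∀ a ∈ J, ∀ c ∈ I ^ k, c • a • u ∈ F.N (n + 1 + k + 1)) ?_ ?_ J hJ
    · intro b hb
      obtain ⟨-, k, hk⟩ := h b (hb (Submodule.mem_span_singleton_self b))
      refine ⟨k, fun a ha c hc => ?_⟩
      obtain ⟨r, rfl⟩ := Submodule.mem_span_singleton.mp ha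
      rw [smul_assoc, smul_comm c]
      exact Submodule.smul_mem _ _ (hk c hc)
    · intro J1 J2 _ _ h1 h2 hle
      obtain ⟨k, hk⟩ := h1 (le_sup_left.trans hle)
      obtain ⟨j, hj⟩ := h2 (le_sup_right.trans hle)
      have mon : ∀ (w : N) (k i : ℕ), (∀ c ∈ I ^ k, c • w ∈ F.N (n + 1 + k + 1)) →
            ∀ c ∈ I ^ (k + i), c • w ∈ F.N (n + 1 + (k + i) + 1) := by
          intro w k i hw c hc
          rw [pow_add, mul_comm] at hc
          induction hc using Submodule.mul_induction_on' with
          | mem_mul_mem a ha b hb =>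
            rw [mul_smul]
            have := F.pow_smul_le i (n + 1 + k + 1) (Submodule.smul_mem_smul ha (hw b hb))
            rwa [show i + (n + 1 + k + 1) = n + 1 + (k + i) + 1 by omega] at this
          | add a _ b _ ha hb => rw [add_smul]; exact add_mem ha hb
      refine ⟨k + j, fun a ha c hc => ?_⟩
      obtain ⟨a1, ha1, a2, ha2, rfl⟩ := Submodule.mem_sup.mp ha
      rw [add_smul, smul_add]
      refine add_mem (mon _ _ _ (hk a1 ha1) c hc) ?_
      rw [add_comm k j] at hc ⊢
      exact mon _ _ _ (hj a2 ha2) c hc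
  obtain ⟨k, hk⟩ := key I hI le_rfl
  refine ⟨hu, k + 1, fun c hc => ?_⟩
  rw [pow_succ] at hc
  induction hc using Submodule.mul_induction_on' with
  | mem_mul_mem a ha b hb =>
    rw [mul_smul]
    have := hk b hb a ha
    rwa [show n + 1 + k + 1 = n + (k + 1) + 1 by omega] at this
  | add a _ b _ ha hb => rw [add_smul]; exact add_mem ha hb

/-- for `n ≫ 0`, `V_n ≤ N_{n+1}` -/
lemma vfil_le [IsNoetherianRing A] [Module.Finite A N] {I : Ideal A} {F : I.Filtration N}
    (hF : F.Stable) : ∃ n0, ∀ n, n0 ≤ n → (vfil F).N n ≤ F.N (n + 1) := by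
  have hV : (vfil F).Stable := hF.of_le (fun n u hu => hu.1)
  obtain ⟨n0, h0⟩ := hV.exists_pow_smul_eq
  obtain ⟨s, hs⟩ : ((vfil F).N n0).FG := IsNoetherian.noetherian _
  have : ∀ u ∈ (vfil F).N n0, ∃ k, ∀ j, k ≤ j → ∀ c ∈ I ^ j, c • u ∈ F.N (n0 + j + 1) := by
    rintro u ⟨hu, k, hk⟩
    refine ⟨k, fun j hj c hc => ?_⟩
    obtain ⟨i, rfl⟩ := Nat.exists_eq_add_of_le hj
    rw [pow_add, mul_comm] at hc
    induction hc using Submodule.mul_induction_on' with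
    | mem_mul_mem a ha b hb =>
      rw [mul_smul]
      have := F.pow_smul_le i (n0 + k + 1) (Submodule.smul_mem_smul ha (hk b hb))
      rwa [show i + (n0 + k + 1) = n0 + (k + i) + 1 by omega] at this
    | add a _ b _ ha hb => rw [add_smul]; exact add_mem ha hb
  choose! κ hκ using this
  refine ⟨n0 + s.sup κ, fun n hn => ?_⟩
  obtain ⟨j, rfl⟩ := Nat.exists_eq_add_of_le (show n0 ≤ n by omega)
  rw [h0 j, Submodule.smul_le]
  intro c hc u hu
  rw [← hs] at hu
  induction hu using Submodule.span_induction with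
  | mem u hu =>
    have hu' : u ∈ (vfil F).N n0 := by rw [← hs]; exact Submodule.subset_span hu
    have : κ u ≤ s.sup κ := Finset.le_sup (f := κ) hu
    exact hκ u hu' j (by omega) c hc
  | zero => simp
  | add a b _ _ ha hb => rw [smul_add]; exact add_mem ha hb
  | smul r a _ ha => rw [smul_comm]; exact Submodule.smul_mem _ _ ha

/-- `a t` in the Rees algebra -/
noncomputable def rt (I : Ideal A) : I →ₗ[A] reesAlgebra I where
  toFun a := ⟨monomial 1 (a : A), reesAlgebra.monomial_mem.mpr (by rw [pow_one]; exact a.2)⟩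
  map_add' a b := by ext1; simp
  map_smul' r a := by ext1; simp [smul_monomial]

lemma rt_smul_coeff {I : Ideal A} (a : I) (u : PolynomialModule A N) (n : ℕ) :
    (rt I a • u).coeff (n + 1) = (a : A) • u.coeff n := by
  rw [Subalgebra.smul_def]
  change ((monomial 1 (a : A)) • u).coeff (n + 1) = _
  rw [PolynomialModule.monomial_smul_apply]
  simp

lemma rt_smul_coeff_zero {I : Ideal A} (a : I) (u : PolynomialModule A N) :
    (rt I a • u).coeff 0 = 0 := by
  rw [Subalgebra.smul_def]
  change ((monomial 1 (a : A)) • u).coeff 0 = _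
  rw [PolynomialModule.monomial_smul_apply]
  simp

lemma rt_smul_single {I : Ideal A} (a : I) (u : N) (n : ℕ) :
    rt I a • PolynomialModule.single A n u = PolynomialModule.single A (n + 1) ((a : A) • u) := by
  rw [Subalgebra.smul_def]
  change (monomial 1 (a : A)) • _ = _
  rw [PolynomialModule.monomial_smul_single, add_comm]

lemma single_mem_submodule {I : Ideal A} {F : I.Filtration N} {n : ℕ} {u : N} :
    PolynomialModule.single A n u ∈ F.submodule ↔ u ∈ F.N n := by
  rw [Ideal.Filtration.mem_submodule]
  constructor
  · intro h; simpa using h n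
  · intro h i
    rw [PolynomialModule.coeff_single, Finsupp.single_apply]
    split_ifs with hi
    · rwa [← hi]
    · exact zero_mem _

/-- finitely many primes controlling regularity on `G / W ⊓ G` -/
lemma ass_sub {S P : Type*} [CommRing S] [IsNoetherianRing S] [AddCommGroup P] [Module S P]
    (G W : Submodule S P) (hG : G.FG) : ∃ T : Set (Ideal S), T.Finite ∧
      (∀ p ∈ T, ∃ e ∈ G, e ∉ W ∧ ∀ r ∈ p, r • e ∈ W) ∧
      ∀ r : S, (∀ p ∈ T, r ∉ p) → ∀ u ∈ G, r • u ∈ W → u ∈ W := by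
  have : Module.Finite S G := Module.Finite.iff_fg.mpr hG
  let V : Submodule S G := W.comap G.subtype
  refine ⟨associatedPrimes S (G ⧸ V), associatedPrimes.finite _ _, ?_, ?_⟩
  · intro p hp
    have hp' : IsAssociatedPrime p _ := hp
    rw [isAssociatedPrime_iff] at hp'
    obtain ⟨hpp, e, he⟩ := hp'
    obtain ⟨e, rfl⟩ := Submodule.mkQ_surjective _ e
    refine ⟨e, e.2, fun hmem => ?_, fun r hr => ?_⟩
    · apply hpp.ne_top
      rw [he, eq_top_iff]
      intro r _
      rw [Submodule.mem_colon_singleton, Submodule.mem_bot, Submodule.mkQ_apply,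
        (Submodule.Quotient.mk_eq_zero _).mpr (show e ∈ V from hmem), smul_zero]
    · rw [he, Submodule.mem_colon_singleton, Submodule.mem_bot, ← map_smul,
        Submodule.mkQ_apply, Submodule.Quotient.mk_eq_zero] at hr
      exact hr
  · intro r hr u hu hru
    by_contra hne
    have hmem : r ∈ {r : S | ∃ x : G ⧸ V, x ≠ 0 ∧ r • x = 0} := by
      refine ⟨V.mkQ ⟨u, hu⟩, ?_, ?_⟩
      · rw [Submodule.mkQ_apply, Ne, Submodule.Quotient.mk_eq_zero]; exact hne
      · rw [← map_smul, Submodule.mkQ_apply, Submodule.Quotient.mk_eq_zero]; exact hru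
    rw [← biUnion_associatedPrimes_eq_zero_divisors] at hmem
    obtain ⟨p, hp, hpm⟩ := Set.mem_iUnion₂.mp hmem
    exact hr p hp hpm

theorem superficial [IsLocalRing A] [IsNoetherianRing A] [Infinite (ResidueField A)]
    [Module.Finite A N] {I : Ideal A} {F : ℕ → Submodule A N} {R : ℕ} (hF : Fil I F R)
    (h0 : F 0 = ⊤) (hsat : isat I (⊥ : Submodule A N) = ⊥) :
    ∃ z ∈ I, ∀ x ∈ I, ∀ᶠ τ in gen A, (∀ u : N, (x + τ * z) • u = 0 → u = 0) ∧
      ∃ N0, ∀ n, N0 ≤ n → ∀ u : N, (x + τ * z) • u ∈ F (n + 1) → u ∈ F n := by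
  have hIfg : I.FG := (isNoetherianRing_iff_ideal_fg A).mp inferInstance _
  let G : I.Filtration N := ⟨F, hF.anti, hF.smul⟩
  have hG : G.Stable := ⟨R, fun n hn => le_antisymm (hF.smul n) (hF.stab n hn)⟩
  obtain ⟨n0, hn0⟩ := vfil_le hG
  have hfgG : G.submodule.FG :=
    (Ideal.Filtration.submodule_fg_iff_stable _ fun i => IsNoetherian.noetherian _).mpr hG
  obtain ⟨T1, hT1, hT1e, hT1r⟩ := ass_sub G.submodule (vfil G).submodule hfgG
  obtain ⟨T2, hT2, hT2e, hT2r⟩ := ass_sub (⊤ : Submodule A N) ⊥ (Module.Finite.fg_top)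
  -- primes
  have hp1 : ∀ p ∈ T1, (p.restrictScalars A).comap (rt I) ≠ ⊤ := by
    intro p hp htop
    obtain ⟨e, heG, heW, he⟩ := hT1e p hp
    apply heW
    rw [Ideal.Filtration.mem_submodule]
    intro i
    refine vfil_sat hIfg (heG i) fun a ha => ?_
    have h1 : rt I ⟨a, ha⟩ ∈ p := by
      have : (⟨a, ha⟩ : I) ∈ (p.restrictScalars A).comap (rt I) := by rw [htop]; trivial
      exact this
    have h2 := (Ideal.Filtration.mem_submodule _ _).mp (he _ h1) (i + 1)
    rw [rt_smul_coeff] at h2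
    exact h2
  have hp2 : ∀ p ∈ T2, Submodule.comap I.subtype p ≠ ⊤ := by
    intro p hp htop
    obtain ⟨e, -, heW, he⟩ := hT2e p hp
    apply heW
    rw [← hsat]
    refine ⟨1, fun c hc => ?_⟩
    rw [pow_one] at hc
    have : (⟨c, hc⟩ : I) ∈ Submodule.comap I.subtype p := by rw [htop]; trivial
    exact he c this
  have hS1 := hT1.image (fun p => (p.restrictScalars A).comap (rt I))
  have hS2 := hT2.image (fun p => Submodule.comap I.subtype p)
  obtain ⟨z, hz⟩ := exists_avoid I (hS1.union hS2) (by
    rintro V (⟨p, hp, rfl⟩ | ⟨p, hp, rfl⟩)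
    · exact hp1 p hp
    · exact hp2 p hp)
  refine ⟨z, z.2, fun x hx => ?_⟩
  have line : ∀ V : Submodule A I, z ∉ V → ∀ τ τ' : A, (⟨x, hx⟩ : I) + τ • z ∈ V →
      (⟨x, hx⟩ : I) + τ' • z ∈ V → residue A τ = residue A τ' := by
    intro V hV τ τ' h1 h2
    by_contra hne
    have hu := residue_ne_isUnit hne
    apply hV
    rw [← Submodule.smul_mem_iff_of_isUnit _ hu]
    have := V.sub_mem h1 h2
    have e : (⟨x, hx⟩ : I) + τ • z - ((⟨x, hx⟩ : I) + τ' • z) = (τ - τ') • z := by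
      rw [sub_smul]; abel
    rwa [e] at this
  have g1 : ∀ᶠ τ in gen A, ∀ p ∈ T1, τ ∉ {τ : A | rt I (⟨x, hx⟩ + τ • z) ∈ p} := by
    rw [Filter.eventually_all_finite hT1]
    exact fun p hp => gen_line fun τ h1 τ' h2 => line _ (hz _ (Or.inl ⟨p, hp, rfl⟩)) τ τ' h1 h2
  have g2 : ∀ᶠ τ in gen A, ∀ p ∈ T2, τ ∉ {τ : A | x + τ * z ∈ p} := by
    rw [Filter.eventually_all_finite hT2]
    exact fun p hp => gen_line fun τ h1 τ' h2 => line _ (hz _ (Or.inr ⟨p, hp, rfl⟩)) τ τ' h1 h2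
  filter_upwards [g1, g2] with τ t1 t2
  replace t1 := hT1r _ t1
  replace t2 : ∀ u : N, (x + τ * z) • u = 0 → u = 0 := fun u hu => hT2r _ t2 u trivial hu
  refine ⟨t2, ?_⟩
  set y : A := x + τ * z with hy
  have hyI : y ∈ I := I.add_mem hx (I.mul_mem_left _ z.2)
  have fr : ∀ n, n0 ≤ n → ∀ u ∈ F n, y • u ∈ F (n + 2) → u ∈ F (n + 1) := by
    intro n hn u hu hyu
    apply hn0 n hn
    have hmem : PolynomialModule.single A n u ∈ G.submodule := single_mem_submodule.mpr hu
    have h1 := t1 _ hmem (by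
      rw [rt_smul_single, single_mem_submodule]
      exact ⟨hF.smul_mem hyI hu, 0, fun c _ => Submodule.smul_mem _ _ hyu⟩)
    exact single_mem_submodule.mp h1
  -- Artin-Rees
  obtain ⟨k, hk⟩ := Ideal.exists_pow_inf_eq_pow_smul I (xm y (⊤ : Submodule A N))
  have hpow : ∀ j, F (R + j) ≤ I ^ j • ⊤ := by
    intro j
    induction j with
    | zero => simp
    | succ j ih =>
      refine (hF.stab (R + j) (by omega)).trans ((smr I ih).trans ?_)
      rw [← Submodule.mul_smul, pow_succ']
  have hle : ∀ j, I ^ j • (⊤ : Submodule A N) ≤ F j := by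
    intro j
    rw [Submodule.smul_le]
    intro c hc u _
    have := hF.pow_smul_mem hc (n := 0) (u := u) (by rw [h0]; trivial)
    rwa [zero_add] at this
  have hAR : ∀ u : N, y • u ∈ F (R + k + n0) → u ∈ F n0 := by
    intro u hu
    rw [add_assoc] at hu
    have h1 : y • u ∈ I ^ (k + n0) • ⊤ ⊓ xm y (⊤ : Submodule A N) :=
      ⟨hpow _ hu, smul_mem_xm trivial⟩
    rw [hk _ (by omega), Nat.add_sub_cancel_left] at h1
    have h2 : y • u ∈ xm y (I ^ n0 • (⊤ : Submodule A N)) := by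
      rw [xm, Submodule.map_smul'']
      exact smr _ inf_le_right h1
    obtain ⟨v, hv, hvu⟩ := h2
    have : u = v := by
      rw [← sub_eq_zero]
      apply t2
      rw [smul_sub, ← hvu, LinearMap.lsmul_apply, sub_self]
    rw [this]
    exact hle _ hv
  refine ⟨R + k + n0, fun n hn u hu => ?_⟩
  have key : ∀ j, n0 + j ≤ n → u ∈ F (n0 + j) := by
    intro j
    induction j with
    | zero => intro _; exact hAR u (hF.antitone (by omega) hu)
    | succ j ih =>
      intro hj
      exact fr (n0 + j) (by omega) u (ih (by omega)) (hF.antitone (by omega) hu)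
  obtain ⟨j, rfl⟩ := Nat.exists_eq_add_of_le (show n0 ≤ n by omega)
  exact key j le_rfl

end Superficial


open Filter IsLocalRing
set_option linter.unusedSectionVars false

section ExtDeg

variable {A : Type u} [CommRing A] [IsLocalRing A]

lemma IsMaxPrimary.le {I : Ideal A} (hI : IsMaxPrimary I) : I ≤ maximalIdeal A :=
  hI.2 ▸ Ideal.le_radical

lemma IsMaxPrimary.exists_pow [IsNoetherianRing A] {I : Ideal A} (hI : IsMaxPrimary I) :
    ∃ s, maximalIdeal A ^ s ≤ I :=
  Ideal.exists_pow_le_of_le_radical_of_fg hI.2.ge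
    ((isNoetherianRing_iff_ideal_fg A).mp inferInstance _)

lemma lcZero_eq [IsNoetherianRing A] {I : Ideal A} (hI : IsMaxPrimary I)
    (N : Type u) [AddCommGroup N] [Module A N] :
    lcZero (maximalIdeal A) N = isat I (⊥ : Submodule A N) := by
  obtain ⟨s, hs⟩ := hI.exists_pow
  have hmon : Monotone fun k : ℕ =>
      Submodule.torsionBySet A N ((maximalIdeal A ^ k : Ideal A) : Set A) := by
    intro i j hij
    exact Submodule.torsionBySet_le_torsionBySet_of_subset (Ideal.pow_le_pow_right hij)
  ext u
  rw [lcZero, Submodule.mem_iSup_of_directed _ hmon.directed_le, mem_isat]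
  simp only [Submodule.mem_torsionBySet_iff, Submodule.mem_bot]
  constructor
  · rintro ⟨k, hk⟩
    exact ⟨k, fun c hc => hk ⟨c, Ideal.pow_right_mono hI.le k hc⟩⟩
  · rintro ⟨k, hk⟩
    refine ⟨s * k, fun c => hk c ?_⟩
    have : (c : A) ∈ (maximalIdeal A ^ s) ^ k := by rw [← pow_mul]; exact c.2
    exact Ideal.pow_right_mono hs k this

lemma isat_bot_quot [IsNoetherianRing A] (I : Ideal A) {N : Type*} [AddCommGroup N] [Module A N]
    (K : Submodule A N) :
    isat I (⊥ : Submodule A (N ⧸ isat I K)) = ⊥ := by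
  have hs := Submodule.mkQ_surjective (isat I K)
  apply Submodule.comap_injective_of_surjective hs
  rw [← isat_comap]
  change isat I (LinearMap.ker _) = LinearMap.ker _
  rw [Submodule.ker_mkQ, isat_isat]

lemma PD_top {I : Ideal A} {N : Type*} [AddCommGroup N] [Module A N] (d δ : ℕ) :
    PD I d δ (⊤ : Submodule A N) := by
  induction d generalizing δ with
  | zero => change rl _ _ ≤ _; rw [rl_eq_zero.mpr le_rfl]; exact bot_le
  | succ d ih =>
    have h1 : isat I (⊤ : Submodule A N) = ⊤ := top_le_iff.mp (le_isat I _)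
    refine ⟨0, I.zero_mem, 0, 0, by omega, ?_, ?_, ?_⟩
    · rw [h1, rl_eq_zero.mpr le_rfl]; exact bot_le
    · intro u _; rw [h1]; trivial
    · rw [h1, top_sup_eq]; exact ih 0

lemma pow_smul_eq_bot_of_dim_zero [IsNoetherianRing A] {N : Type*} [AddCommGroup N] [Module A N]
    [Module.Finite A N] (h : Module.supportDim A N ≤ 0) :
    ∃ k, maximalIdeal A ^ k ≤ Module.annihilator A N := by
  apply Ideal.exists_pow_le_of_le_radical_of_fg _
    ((isNoetherianRing_iff_ideal_fg A).mp inferInstance _)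
  rw [Module.supportDim_eq_ringKrullDim_quotient_annihilator] at h
  have : Ring.KrullDimLE 0 (A ⧸ Module.annihilator A N) :=
    (Ring.krullDimLE_iff).mpr (by exact_mod_cast h)
  rw [Ideal.radical_eq_sInf]
  refine le_sInf ?_
  rintro p ⟨hp, hpp⟩
  have h1 : (p.map (Ideal.Quotient.mk (Module.annihilator A N))).IsPrime :=
    Ideal.map_isPrime_of_surjective Ideal.Quotient.mk_surjective (by rwa [Ideal.mk_ker])
  have h2 := h1.isMaximal'
  have h3 : p = (p.map (Ideal.Quotient.mk (Module.annihilator A N))).comap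
      (Ideal.Quotient.mk (Module.annihilator A N)) := by
    rw [Ideal.comap_map_of_surjective _ Ideal.Quotient.mk_surjective, ← RingHom.ker_eq_comap_bot,
      Ideal.mk_ker, sup_eq_left.mpr hp]
  have h4 : p.IsMaximal := by
    rw [h3]; exact Ideal.comap_isMaximal_of_surjective _ Ideal.Quotient.mk_surjective
  rw [IsLocalRing.eq_maximalIdeal h4]

lemma filterRegular_reg [IsNoetherianRing A] {I : Ideal A} (hI : I ≠ ⊤) {N : Type u}
    [AddCommGroup N] [Module A N] [Module.Finite A N]
    (hsat : isat I (⊥ : Submodule A N) = ⊥) {x : A}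
    (hx : (Ideal.stableFiltration I (⊤ : Submodule A N)).FilterRegular x) (u : N)
    (hu : x • u = 0) : u = 0 := by
  obtain ⟨n0, h0⟩ := Filter.eventually_atTop.mp hx
  have : u ∈ isat I (⊥ : Submodule A N) := by
    refine ⟨n0, fun c hc => ?_⟩
    rw [← Ideal.iInf_pow_smul_eq_bot_of_isLocalRing (M := N) I hI]
    have key : ∀ j, c • u ∈ I ^ (n0 + j) • (⊤ : Submodule A N) := by
      intro j
      induction j with
      | zero => exact Submodule.smul_mem_smul hc trivial
      | succ j ih =>
        have h1 := h0 (n0 + j) (by omega)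
        simp only [Ideal.stableFiltration_N] at h1
        rw [← add_assoc, ← h1]
        refine ⟨?_, ih⟩
        rw [SetLike.mem_coe, Submodule.mem_comap, LinearMap.lsmul_apply, smul_comm, hu, smul_zero]
        exact zero_mem _
    rw [Submodule.mem_iInf]
    intro i
    exact Submodule.smul_mono (Ideal.pow_le_pow_right (by omega)) le_rfl (key i)
  rw [hsat] at this
  exact this

theorem PD_of_extDeg [IsNoetherianRing A] {I : Ideal A} (hI : IsMaxPrimary I)
    {D : (N : Type u) → [AddCommGroup N] → [Module A N] → ℕ} (hD : IsExtendedDegree I D) (d : ℕ)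
    (N : Type u) [AddCommGroup N] [Module A N] [Module.Finite A N]
    (hdim : Module.supportDim A N ≤ (d : WithBot ℕ∞)) : PD I d (D N) (⊥ : Submodule A N) := by
  induction d generalizing N with
  | zero =>
    change rl _ _ ≤ _
    obtain ⟨k, hk⟩ := pow_smul_eq_bot_of_dim_zero (A := A) (N := N) (by exact_mod_cast hdim)
    have htop : lcZero (maximalIdeal A) N = ⊤ := by
      rw [eq_top_iff]
      intro u _
      refine Submodule.mem_iSup_of_mem k ?_
      rw [Submodule.mem_torsionBySet_iff]
      intro c
      exact Module.mem_annihilator.mp (hk c.2) u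
    have h1 := hD.h0_add N
    rw [moduleLength, ← Module.coe_length] at h1
    have h2 : (D N : ℕ∞) = (D (N ⧸ lcZero (maximalIdeal A) N) : ℕ∞) +
        Module.length A (lcZero (maximalIdeal A) N) := by exact_mod_cast h1
    rw [rl_bot, ← htop, h2]
    exact le_add_self
  | succ d ih =>
    have hT := lcZero_eq hI N
    have h1 := hD.h0_add N
    rw [moduleLength, ← Module.coe_length, hT] at h1
    have h2 : (D N : ℕ∞) = (D (N ⧸ isat I (⊥ : Submodule A N)) : ℕ∞) +
        Module.length A (isat I (⊥ : Submodule A N)) := by exact_mod_cast h1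
    rw [← rl_bot] at h2
    obtain ⟨l, hl⟩ : ∃ l : ℕ, (l : ℕ∞) = rl ⊥ (isat I (⊥ : Submodule A N)) := by
      apply ENat.ne_top_iff_exists.mp
      intro h
      rw [h, add_top] at h2
      exact ENat.natCast_ne_top _ h2
    rw [← hl] at h2
    have h2' : D N = D (N ⧸ isat I (⊥ : Submodule A N)) + l := by exact_mod_cast h2
    by_cases hs : Subsingleton (N ⧸ isat I (⊥ : Submodule A N))
    · have htop : isat I (⊥ : Submodule A N) = ⊤ := (Submodule.Quotient.subsingleton_iff).mp hs
      refine ⟨0, I.zero_mem, l, 0, by omega, hl.ge, ?_, ?_⟩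
      · intro u _; rw [htop]; trivial
      · rw [htop, top_sup_eq]; exact PD_top _ _
    · have hnt : Nontrivial (N ⧸ isat I (⊥ : Submodule A N)) := not_subsingleton_iff_nontrivial.mp hs
      obtain ⟨x, hxI, -, hfr, hDle⟩ := hD.generic (N ⧸ isat I (⊥ : Submodule A N)) hnt
      have hsat := isat_bot_quot I (⊥ : Submodule A N)
      have hreg := filterRegular_reg hI.1 hsat hfr
      have hregS : IsSMulRegular (N ⧸ isat I (⊥ : Submodule A N)) x := by
        rw [isSMulRegular_iff_right_eq_zero_of_smul]
        exact hreg
      have hd1 := Module.supportDim_quotSMulTop_succ_eq_supportDim hregS (hI.le hxI)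
      have hd2 : Module.supportDim A (N ⧸ isat I (⊥ : Submodule A N)) ≤ Module.supportDim A N :=
        Module.supportDim_le_of_surjective _ (Submodule.mkQ_surjective _)
      have hspan : (Ideal.span {x} • ⊤ : Submodule A (N ⧸ isat I (⊥ : Submodule A N))) = xm x ⊤ := by
        rw [Submodule.ideal_span_singleton_smul]; rfl
      have hd3 : Module.supportDim A ((N ⧸ isat I (⊥ : Submodule A N)) ⧸
          (Ideal.span {x} • ⊤ : Submodule A (N ⧸ isat I (⊥ : Submodule A N)))) ≤
          (d : WithBot ℕ∞) := by
        rw [Submodule.ideal_span_singleton_smul]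
        have : Module.supportDim A (QuotSMulTop x (N ⧸ isat I (⊥ : Submodule A N))) + 1
            ≤ (d : WithBot ℕ∞) + 1 := by
          rw [hd1]; exact hd2.trans (by exact_mod_cast hdim)
        revert this
        generalize Module.supportDim A (QuotSMulTop x (N ⧸ isat I (⊥ : Submodule A N))) = w
        intro this
        induction w using WithBot.recBotCoe with
        | bot => exact bot_le
        | coe w =>
          have h' : w + 1 ≤ (d : ℕ∞) + 1 := by exact_mod_cast this
          have : w ≤ (d : ℕ∞) := (ENat.add_le_add_iff_right (by simp)).mp h'
          exact_mod_cast this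
      have hP := (ih _ hd3).mono hDle
      rw [← PD_comap (Submodule.mkQ_surjective _)] at hP
      change PD I d _ (LinearMap.ker _) at hP
      rw [Submodule.ker_mkQ, hspan, ← PD_comap (Submodule.mkQ_surjective _),
        ← bot_sup_eq (xm x ⊤), comap_sup_xm_top (Submodule.mkQ_surjective _)] at hP
      change PD I d _ (LinearMap.ker _ ⊔ _) at hP
      rw [Submodule.ker_mkQ] at hP
      refine ⟨x, hxI, l, _, by omega, hl.ge, ?_, hP⟩
      intro u hu
      rw [← Submodule.Quotient.mk_eq_zero] at hu ⊢
      exact hreg _ hu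

end ExtDeg


open Filter IsLocalRing
set_option linter.unusedSectionVars false

section RegThm

variable {A : Type*} [CommRing A] {M : Type*} [AddCommGroup M] [Module A M]

lemma Fil.le_pow {I : Ideal A} {N : ℕ → Submodule A M} {R : ℕ} (hF : Fil I N R) (j : ℕ) :
    N (R + j) ≤ I ^ j • ⊤ := by
  induction j with
  | zero => simp
  | succ j ih =>
    refine (hF.stab (R + j) (by omega)).trans ((smr I ih).trans ?_)
    rw [← Submodule.mul_smul, pow_succ']

lemma Fil.pow_le {I : Ideal A} {N : ℕ → Submodule A M} {R : ℕ} (hF : Fil I N R) (h0 : N 0 = ⊤)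
    (j : ℕ) : I ^ j • (⊤ : Submodule A M) ≤ N j := by
  rw [Submodule.smul_le]
  intro c hc u _
  have := hF.pow_smul_mem hc (n := 0) (u := u) (by rw [h0]; trivial)
  rwa [zero_add] at this

/-- choose a superficial element keeping the length data -/
lemma exists_superficial [IsLocalRing A] [IsNoetherianRing A] [Infinite (ResidueField A)]
    [Module.Finite A M] {I : Ideal A} (hIm : I ≤ maximalIdeal A) {N : ℕ → Submodule A M} {R : ℕ}
    (hN : Fil I N R) (h0 : N 0 = ⊤) {K : Submodule A M} {x : A} (hx : x ∈ I)
    (hreg : ∀ u, x • u ∈ isat I K → u ∈ isat I K) {d e : ℕ}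
    (hP : PD I d e (isat I K ⊔ xm x ⊤)) :
    ∃ y ∈ I, (∀ u, y • u ∈ isat I K → u ∈ isat I K) ∧
      (∃ N0, ∀ n, N0 ≤ n → ∀ u, y • u ∈ isat I K ⊔ N (n + 1) → u ∈ isat I K ⊔ N n) ∧
      PD I d e (isat I K ⊔ xm y ⊤) := by
  set L := isat I K with hL
  have hs := Submodule.mkQ_surjective L
  have key : ∀ y : A, PD I d e (L ⊔ xm y ⊤) ↔ PD I d e (xm y (⊤ : Submodule A (M ⧸ L))) := by
    intro y
    rw [← PD_comap hs, ← bot_sup_eq (xm y (⊤ : Submodule A (M ⧸ L))), comap_sup_xm_top hs]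
    change _ ↔ PD I d e (LinearMap.ker _ ⊔ _)
    rw [Submodule.ker_mkQ]
  have hsat : isat I (⊥ : Submodule A (M ⧸ L)) = ⊥ := isat_bot_quot I K
  obtain ⟨z, hz, h⟩ := superficial (hN.map L.mkQ) (by rw [h0, Submodule.map_top, Submodule.range_mkQ])
    hsat
  have h2 := semiS (x := x) hIm z (N := M ⧸ L) (d := d) (δ := e) (by
    intro u hu
    obtain ⟨u, rfl⟩ := hs u
    rw [← map_smul, Submodule.mkQ_apply, Submodule.Quotient.mk_eq_zero] at hu
    rw [Submodule.mkQ_apply, Submodule.Quotient.mk_eq_zero]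
    exact hreg u hu) ((key x).mp hP)
  have := gen_neBot (A := A)
  obtain ⟨τ, ⟨t1, N0, t2⟩, t3⟩ := ((h x hx).and h2).exists
  have hmem : ∀ n (u : M), L.mkQ u ∈ (N n).map L.mkQ ↔ u ∈ L ⊔ N n := by
    intro n u
    rw [← Submodule.mem_comap, Submodule.comap_map_eq, Submodule.ker_mkQ, sup_comm]
  refine ⟨x + τ * z, I.add_mem hx (I.mul_mem_left _ hz), ?_, ⟨N0, ?_⟩, (key _).mpr t3⟩
  · intro u hu
    rw [← Submodule.Quotient.mk_eq_zero] at hu ⊢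
    exact t1 _ hu
  · intro n hn u hu
    rw [← hmem] at hu ⊢
    apply t2 n hn
    rwa [map_smul] at hu

lemma exists_MS {I : Ideal A} {N : ℕ → Submodule A M} {R N0 : ℕ} (hN : Fil I N R)
    {L : Submodule A M} {y : A} (hy : y ∈ I)
    (h1 : ∀ u, y • u ∈ L → u ∈ L)
    (h2 : ∀ n, N0 ≤ n → ∀ u, y • u ∈ L ⊔ N (n + 1) → u ∈ L ⊔ N n) :
    ∃ f : M →ₗ[A] LocalizedModule (Submonoid.powers y) (M ⧸ L), LinearMap.ker f = L ∧
      MS I (fun n => (N n).map f) R N0 y := by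
  let g := LocalizedModule.mkLinearMap (Submonoid.powers y) (M ⧸ L)
  let f := g ∘ₗ L.mkQ
  have hker : LinearMap.ker f = L := by
    ext u
    constructor
    · intro hu
      have hu' : g (L.mkQ u) = 0 := hu
      obtain ⟨⟨_, k, rfl⟩, hk⟩ := (IsLocalizedModule.eq_zero_iff (Submonoid.powers y) g).mp hu'
      change (y ^ k) • L.mkQ u = 0 at hk
      rw [← map_smul, Submodule.mkQ_apply, Submodule.Quotient.mk_eq_zero] at hk
      clear hu hu'
      induction k with
      | zero => simpa using hk
      | succ k ih =>
        apply ih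
        apply h1
        rwa [← mul_smul, ← pow_succ']
    · intro hu
      change g (L.mkQ u) = 0
      rw [Submodule.mkQ_apply, (Submodule.Quotient.mk_eq_zero _).mpr hu, map_zero]
  have hbij : Function.Bijective
      (fun u : LocalizedModule (Submonoid.powers y) (M ⧸ L) => y • u) := by
    have := IsLocalizedModule.map_units g (⟨y, Submonoid.mem_powers y⟩ : Submonoid.powers y)
    exact (Module.End.isUnit_iff _).mp this
  have hmem : ∀ n (u : M), f u ∈ (N n).map f ↔ u ∈ L ⊔ N n := by
    intro n u
    rw [← Submodule.mem_comap, Submodule.comap_map_eq, hker, sup_comm]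
  refine ⟨f, hker, hN.map f, hy, fun u hu => hbij.1 (by simpa using hu),
    fun u => hbij.2 u, ?_⟩
  rintro n hn _ ⟨u, -, rfl⟩ hu
  rw [← map_smul] at hu
  exact (hmem _ _).mpr (h2 n hn u ((hmem _ _).mp hu))

/-- bounds -/
def bnd (R : ℕ) : ℕ → ℕ → ℕ
  | 0, δ => R + δ
  | d + 1, δ => bnd R d δ + 1 + δ * (bnd R d δ + (d + 1)).choose (d + 1)

lemma bnd_mono (R d : ℕ) {e l δ : ℕ} (h : l + e ≤ δ) : bnd R d e + l ≤ bnd R d δ := by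
  have mono0 : ∀ d : ℕ, ∀ {e δ : ℕ}, e ≤ δ → bnd R d e ≤ bnd R d δ := by
    intro d
    induction d with
    | zero => intro e δ h; simp only [bnd]; omega
    | succ d ih =>
      intro e δ h
      simp only [bnd]
      have h1 := ih h
      have h2 : (bnd R d e + (d + 1)).choose (d + 1) ≤ (bnd R d δ + (d + 1)).choose (d + 1) :=
        Nat.choose_le_choose _ (by omega)
      have h3 := Nat.mul_le_mul h h2
      omega
  cases d with
  | zero => simp only [bnd]; omega
  | succ d =>
    simp only [bnd]
    have h1 := mono0 d (show e ≤ δ by omega)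
    have h2 : (bnd R d e + (d + 1)).choose (d + 1) ≤ (bnd R d δ + (d + 1)).choose (d + 1) :=
      Nat.choose_le_choose _ (by omega)
    have h3 : 1 ≤ (bnd R d δ + (d + 1)).choose (d + 1) := Nat.choose_pos (by omega)
    have h4 : e * (bnd R d e + (d + 1)).choose (d + 1) + l ≤
        δ * (bnd R d δ + (d + 1)).choose (d + 1) := by
      calc _ ≤ e * (bnd R d δ + (d + 1)).choose (d + 1) + l * (bnd R d δ + (d + 1)).choose (d + 1) :=
            Nat.add_le_add (Nat.mul_le_mul_left _ h2) (Nat.le_mul_of_pos_right _ h3)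
        _ = (l + e) * (bnd R d δ + (d + 1)).choose (d + 1) := by ring
        _ ≤ _ := Nat.mul_le_mul_right _ h
    omega

lemma le_bnd (R d δ : ℕ) : R ≤ bnd R d δ := by
  induction d with
  | zero => simp only [bnd]; omega
  | succ d ih => simp only [bnd]; omega

theorem exists_Reg [IsLocalRing A] [IsNoetherianRing A] [Infinite (ResidueField A)]
    [Module.Finite A M] {I : Ideal A} (hIm : I ≤ maximalIdeal A) {N : ℕ → Submodule A M} {R : ℕ}
    (hN : Fil I N R) (h0 : N 0 = ⊤) (hR : 1 ≤ R) (d : ℕ) (δ : ℕ) (K : Submodule A M)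
    (hP : PD I (d + 1) δ K) :
    ∃ x xs, (∀ z ∈ x :: xs, z ∈ I) ∧ Reg N (bnd R d δ) (x :: xs) (fun _ => K) := by
  have hIfg : I.FG := (isNoetherianRing_iff_ideal_fg A).mp inferInstance _
  induction d generalizing δ K with
  | zero =>
    have hlen := PD_length hP
    obtain ⟨x, hx, l, e, hle, hl, hreg, hP⟩ := hP
    obtain ⟨y, hy, hyreg, ⟨N0, hsup⟩, hPy⟩ := exists_superficial hIm hN h0 hx hreg hP
    obtain ⟨f, hker, hMS⟩ := exists_MS hN hy hyreg hsup
    have hPy' : rl (isat I K ⊔ xm y ⊤) ⊤ ≤ (e : ℕ∞) := hPy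
    have hLf : (isat I K).map f = ⊥ := by
      rw [eq_bot_iff, Submodule.map_le_iff_le_comap]; exact hker.ge
    have hfin : ∀ n, rl ((N n).map f) ((N 0).map f) ≠ ⊤ := by
      intro n htop
      have h1 : rl ((N n).map f) ((N 0).map f) ≤ rl (K ⊔ I ^ (n + 1) • ⊤) ⊤ := by
        refine rl_le_of_map f ?_ ?_
        · rw [h0]; exact le_sup_left
        · intro u _ hu
          obtain ⟨a, ha, b, hb, rfl⟩ := Submodule.mem_sup.mp hu
          have : f a = 0 := by
            have : a ∈ LinearMap.ker f := hker.ge (le_isat I K ha)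
            exact this
          rw [map_add, this, zero_add]
          exact Submodule.mem_map_of_mem (hN.anti n (hN.pow_le h0 _ hb))
      rw [htop] at h1
      exact ENat.natCast_ne_top _ (top_le_iff.mp (h1.trans (hlen n)))
    have hnk := nk (Q := isat I K ⊔ xm y ⊤) (W0 := (⊤ : Submodule A M)) Module.Finite.fg_top
      (b := e) (by
        rw [sup_top_eq]
        exact (rl_mono le_sup_left le_rfl).trans hPy')
    have hmap : (isat I K ⊔ xm y ⊤).map f = xm y ((N 0).map f) := by
      rw [Submodule.map_sup, hLf, bot_sup_eq, map_xm, h0]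
    have hm1 := hMS.main1 (hIm.trans (maximalIdeal_le_jacobson _))
      (Submodule.FG.map f (by rw [h0]; exact Module.Finite.fg_top)) (n1 := R + e) (by
        intro n hn
        rw [← hmap]
        apply Submodule.map_mono
        refine (hN.antitone hn).trans ((hN.le_pow e).trans (le_trans ?_ hnk.1))
        exact Submodule.smul_mono (Ideal.pow_right_mono hIm e) le_rfl) hfin (lam := e) (by
        refine le_trans (rl_le_of_map f ?_ ?_) hPy'
        · rw [h0]; exact le_sup_left
        · intro u _ hu
          rw [← hmap]
          exact Submodule.mem_map_of_mem hu)
    have hm2 : Reg (fun n => (N n).map f) (R + e) [y] (fun _ => (isat I K).map f) := by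
      rw [hLf]; exact hm1
    rw [Reg.map (fun _ => hker.le)] at hm2
    have hxs : ∀ z ∈ [y], z ∈ I := by simpa using hy
    have hm3 := Reg.torsion hN (by omega) (by omega) hxs hm2 hl
    exact ⟨y, [], hxs, hm3.mono (bnd_mono R 0 hle)⟩
  | succ d ih =>
    have hlen := PD_length hP
    obtain ⟨x, hx, l, e, hle, hl, hreg, hP⟩ := hP
    obtain ⟨y, hy, hyreg, ⟨N0, hsup⟩, hPy⟩ := exists_superficial hIm hN h0 hx hreg hP
    obtain ⟨f, hker, hMS⟩ := exists_MS hN hy hyreg hsup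
    have hLf : (isat I K).map f = ⊥ := by
      rw [eq_bot_iff, Submodule.map_le_iff_le_comap]; exact hker.ge
    have hfin : ∀ n, rl ((N n).map f) ((N 0).map f) ≠ ⊤ := by
      intro n htop
      have h1 : rl ((N n).map f) ((N 0).map f) ≤ rl (K ⊔ I ^ (n + 1) • ⊤) ⊤ := by
        refine rl_le_of_map f ?_ ?_
        · rw [h0]; exact le_sup_left
        · intro u _ hu
          obtain ⟨a, ha, b, hb, rfl⟩ := Submodule.mem_sup.mp hu
          have : f a = 0 := by
            have : a ∈ LinearMap.ker f := hker.ge (le_isat I K ha)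
            exact this
          rw [map_add, this, zero_add]
          exact Submodule.mem_map_of_mem (hN.anti n (hN.pow_le h0 _ hb))
      rw [htop] at h1
      exact ENat.natCast_ne_top _ (top_le_iff.mp (h1.trans (hlen n)))
    have hmap : (isat I K ⊔ xm y ⊤).map f = xm y ((N 0).map f) := by
      rw [Submodule.map_sup, hLf, bot_sup_eq, map_xm, h0]
    obtain ⟨x', xs, hxs, hR1⟩ := ih e _ hPy
    have hR2 : Reg (fun n => (N n).map f) (bnd R d e) (x' :: xs)
        (fun _ => xm y ((N 0).map f)) := by
      rw [← hmap]
      exact (Reg.map (fun _ => hker.le.trans le_sup_left)).mpr hR1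
    have hRb := le_bnd R d e
    have hm1 := hMS.main2 hxs hR2 hIfg hfin (by omega) hRb
      (c := e * (bnd R d e + (d + 1)).choose (d + 1)) (by
        refine le_trans (rl_le_of_map f ?_ ?_) (PD_length hPy (bnd R d e))
        · rw [h0]; exact le_sup_left
        · intro u _ hu
          rw [← hmap]
          obtain ⟨a, ha, b, hb, rfl⟩ := Submodule.mem_sup.mp hu
          rw [map_add]
          exact Submodule.add_mem_sup (Submodule.mem_map_of_mem ha)
            (Submodule.mem_map_of_mem (hN.pow_le h0 _ hb)))
    have hm2 : Reg (fun n => (N n).map f)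
        (bnd R d e + e * (bnd R d e + (d + 1)).choose (d + 1) + 1) (y :: x' :: xs)
        (fun _ => (isat I K).map f) := by
      rw [hLf]; exact hm1
    rw [Reg.map (fun _ => hker.le)] at hm2
    have hxs' : ∀ z ∈ y :: x' :: xs, z ∈ I := by
      intro z hz
      rcases List.mem_cons.mp hz with rfl | hz
      · exact hy
      · exact hxs z hz
    have hm3 := Reg.torsion hN (by omega) (by omega) hxs' hm2 hl
    refine ⟨y, x' :: xs, hxs', hm3.mono (le_trans ?_ (bnd_mono R (d + 1) hle))⟩
    simp only [bnd]
    omega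

end RegThm

open Filter IsLocalRing
set_option linter.unusedSectionVars false

section FinalSec

variable {A : Type*} [CommRing A] {M : Type*} [AddCommGroup M] [Module A M]

lemma Reg.h0_one {I : Ideal A} {N : ℕ → Submodule A M} {R : ℕ} (hN : Fil I N R) {m : ℕ}
    {x : A} {xs : List A} (hxs : ∀ z ∈ x :: xs, z ∈ I)
    (h : Reg N m (x :: xs) (fun _ => (⊥ : Submodule A M))) {n : ℕ} (hn : m ≤ n) {u : M}
    (hu : u ∈ N n) (hc : ∀ c ∈ I, c • u ∈ N (n + 2)) : u ∈ N (n + 1) := by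
  have hx : x ∈ I := hxs x (by simp)
  have h1 := h.1
  have h2 := h.2
  have hg : x • u ∈ (⊥ : Submodule A M) ⊔ xm x (N (n + 1)) := by
    cases xs with
    | nil => exact h2 (n + 2) (by omega) (hc x hx)
    | cons y ys =>
      refine h2.1 (n + 2) (by omega) (x • u) (hc x hx) ?_
      rw [smul_comm]
      exact Submodule.mem_sup_right (smul_mem_xm (hc y (hxs y (by simp))))
  rw [bot_sup_eq, mem_xm] at hg
  obtain ⟨v, hv, hvx⟩ := hg
  have h3 : u - v ∈ (⊥ : Submodule A M) := by
    refine h1 n hn (u - v) (sub_mem hu (hN.anti n hv)) ?_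
    rw [smul_sub, ← hvx, sub_self]
    exact Submodule.zero_mem _
  have h4 : u = v := sub_eq_zero.mp ((Submodule.mem_bot A).mp h3)
  rwa [h4]

lemma Reg.h0 {I : Ideal A} {N : ℕ → Submodule A M} {R : ℕ} (hN : Fil I N R) {m : ℕ}
    {x : A} {xs : List A} (hxs : ∀ z ∈ x :: xs, z ∈ I)
    (h : Reg N m (x :: xs) (fun _ => (⊥ : Submodule A M))) {n : ℕ} (hn : m ≤ n) {u : M}
    (hu : u ∈ N n) (k : ℕ) (hc : ∀ c ∈ I ^ k, c • u ∈ N (n + k + 1)) : u ∈ N (n + 1) := by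
  induction k with
  | zero => simpa using hc 1 (by simp)
  | succ k ih =>
    refine ih fun c hck => ?_
    refine Reg.h0_one hN hxs h (n := n + k) (by omega) (hN.pow_smul_mem hck hu) fun b hb => ?_
    rw [← mul_smul]
    exact hc _ (by rw [pow_succ']; exact Ideal.mul_mem_mul hb hck)

lemma choose_le_aux (N d : ℕ) (hd : 2 ≤ d) : (N + 1).choose d ≤ N ^ d := by
  induction d, hd using Nat.le_induction generalizing N with
  | base =>
    induction N with
    | zero => simp
    | succ N ih => rw [Nat.choose_succ_succ, Nat.choose_one_right]; nlinarith
  | succ d hd ih =>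
    induction N with
    | zero => rw [Nat.choose_eq_zero_of_lt (by omega)]; exact Nat.zero_le _
    | succ N ihN =>
      rw [Nat.choose_succ_succ]
      have h1 : (N + 1).choose d ≤ N ^ d := ih N
      have h2 : N ^ d ≤ (N + 1) ^ d := Nat.pow_le_pow_left (by omega) _
      calc (N + 1).choose d + (N + 1).choose (d + 1) ≤ N ^ d + N ^ (d + 1) := by omega
        _ = N ^ d * (N + 1) := by ring
        _ ≤ (N + 1) ^ d * (N + 1) := Nat.mul_le_mul_right _ h2
        _ = _ := by ring

/-- numerical estimate -/
lemma bnd_le (R δ : ℕ) (hR : 1 ≤ R) (d : ℕ) (hd : 1 ≤ d) :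
    bnd R d δ + d ≤ (δ + R + 1) ^ (3 * d.factorial - 1) := by
  induction d, hd using Nat.le_induction with
  | base =>
    simp only [bnd, Nat.factorial]
    norm_num
    nlinarith
  | succ d hd ih =>
    set Y := δ + R + 1 with hY
    set e := 3 * d.factorial - 1 with he
    set b := bnd R d δ with hb
    have hfac : 1 ≤ d.factorial := Nat.factorial_pos d
    have hbY : b + (d + 1) ≤ Y ^ e + 1 := by omega
    have h1 : (b + (d + 1)).choose (d + 1) ≤ (Y ^ e) ^ (d + 1) :=
      (Nat.choose_le_choose _ hbY).trans (choose_le_aux _ _ (by omega))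
    have h2 : bnd R (d + 1) δ = b + 1 + δ * (b + (d + 1)).choose (d + 1) := rfl
    have hexp : e * (d + 1) + 1 ≤ 3 * (d + 1).factorial - 1 := by
      rw [Nat.factorial_succ]
      obtain ⟨f, hf⟩ : ∃ f, d.factorial = f + 1 := ⟨d.factorial - 1, by omega⟩
      have : e = 3 * f + 2 := by omega
      rw [this, hf]
      have : 3 * ((d + 1) * (f + 1)) = (3 * f + 2) * (d + 1) + (d + 1) := by ring
      omega
    have hY2 : 2 ≤ Y := by omega
    have hP : Y ^ e ≤ (Y ^ e) ^ (d + 1) := Nat.le_self_pow (by omega) _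
    have h2d : 2 ≤ (Y ^ e) ^ (d + 1) :=
      (hY2.trans (Nat.le_self_pow (by omega) _)).trans hP
    calc bnd R (d + 1) δ + (d + 1) ≤ 2 * (Y ^ e) ^ (d + 1) + δ * (Y ^ e) ^ (d + 1) := by
          have := Nat.mul_le_mul_left δ h1
          rw [h2]
          omega
      _ = (δ + 2) * (Y ^ e) ^ (d + 1) := by ring
      _ ≤ Y * (Y ^ e) ^ (d + 1) := Nat.mul_le_mul_right _ (by omega)
      _ = Y ^ (e * (d + 1) + 1) := by rw [← pow_mul, pow_succ]; ring
      _ ≤ _ := Nat.pow_le_pow_right (by omega) hexp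

end FinalSec

section FinalSec2

variable {A : Type u} [CommRing A] [IsLocalRing A] [IsNoetherianRing A]
  {M : Type u} [AddCommGroup M] [Module A M] [Module.Finite A M]

lemma genDeg_spec {I : Ideal A} (F : I.Filtration M) (hF : F.IsGood) :
    ∀ n, F.genDeg ≤ n → F.N (n + 1) = I • F.N n := by
  have hne : {t | ∀ n, t ≤ n → F.N (n + 1) = I • F.N n}.Nonempty := by
    obtain ⟨t, ht⟩ := hF.2
    exact ⟨t, fun n hn => (ht n hn).symm⟩
  exact Nat.sInf_mem hne

/-- shifted fiber filtration -/
def shiftFil {I : Ideal A} (F : I.Filtration M) (q : Ideal A) : ℕ → Submodule A M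
  | 0 => ⊤
  | n + 1 => q • F.N n

lemma shiftFil_Fil {I : Ideal A} (F : I.Filtration M) (hF : F.IsGood) (q : Ideal A)
    (hIq : I ≤ q) : Fil I (shiftFil F q) (F.genDeg + 1) where
  anti n := by
    cases n with
    | zero => exact le_top
    | succ n => exact smr q (F.mono n)
  smul n := by
    cases n with
    | zero =>
      change I • (⊤ : Submodule A M) ≤ q • F.N 0
      rw [hF.1]
      exact Submodule.smul_mono hIq le_rfl
    | succ n =>
      change I • (q • F.N n) ≤ q • F.N (n + 1)
      rw [← mul_smul, mul_comm, mul_smul]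
      exact smr q (F.smul_le n)
  stab n hn := by
    obtain ⟨n, rfl⟩ : ∃ k, n = k + 1 := ⟨n - 1, by omega⟩
    change q • F.N (n + 1) ≤ I • (q • F.N n)
    rw [genDeg_spec F hF n (by omega), ← mul_smul, mul_comm, mul_smul]

lemma fiber_vanish [Infinite (ResidueField A)]
    (I : Ideal A) (hI : IsMaxPrimary I)
    (F : I.Filtration M) (hF : F.IsGood) (d : ℕ)
    (hdim : ringKrullDim (A ⧸ Module.annihilator A M) = ((d + 1 : ℕ) : WithBot ℕ∞))
    (D : (N : Type u) → [AddCommGroup N] → [Module A N] → ℕ)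
    (hD : IsExtendedDegree I D)
    (q : Ideal A) (hIq : I ≤ q)
    (hqF : ∀ n : ℕ, F.N (n + 1) ≤ q • F.N n) (n : ℕ)
    (hn : bnd (F.genDeg + 1) d (D M) ≤ n) : F.FiberH0Vanish q n := by
  have hFil := shiftFil_Fil F hF q hIq
  have hP : PD I (d + 1) (D M) (⊥ : Submodule A M) := by
    refine PD_of_extDeg hI hD (d + 1) M ?_
    rw [Module.supportDim_eq_ringKrullDim_quotient_annihilator]
    exact hdim.le
  obtain ⟨x, xs, hxs, hReg⟩ := exists_Reg hI.le hFil rfl (by omega) d (D M) ⊥ hP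
  have hR := le_bnd (F.genDeg + 1) d (D M)
  intro m hm
  rintro ⟨k, hk⟩
  obtain ⟨p, rfl⟩ : ∃ p, n = p + 1 := ⟨n - 1, by omega⟩
  exact Reg.h0 hFil hxs hReg (n := p + 1) hn (hqF p hm) k hk

end FinalSec2


/-- **Lemma 3.1.** Let `dim M = d ≥ 1`, `𝓜` a good `I`-filtration, `D` an extended
degree, and `q ⊇ I` an ideal with `M_{n+1} ⊆ q•M_n` for all `n ≥ 0`.  Then for the
fiber cone `F_q(𝓜) = ⊕ M_n/q•M_n`:
(i)  `a₀(F_q(𝓜)) ≤ D(I,M) + r(𝓜)` if `d = 1`;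
(ii) `a₀(F_q(𝓜)) ≤ (D(I,M) + r(𝓜) + 2)^(3(d-1)!-1) - d` if `d ≥ 2`.
The bound `a₀(F_q(𝓜)) ≤ B` is expressed concretely as the vanishing of the degree-`n`
graded piece of `H⁰_{G₊}(F_q(𝓜))` for every `n > B`. -/
theorem a0_fiberCone_le
    {A : Type u} [CommRing A] [IsLocalRing A] [IsNoetherianRing A]
    [Infinite (ResidueField A)]
    {M : Type u} [AddCommGroup M] [Module A M] [Module.Finite A M]
    (I : Ideal A) (hI : IsMaxPrimary I)
    (F : I.Filtration M) (hF : F.IsGood)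
    (d : ℕ) (hd : 1 ≤ d)
    (hdim : ringKrullDim (A ⧸ Module.annihilator A M) = (d : WithBot ℕ∞))
    (D : (N : Type u) → [AddCommGroup N] → [Module A N] → ℕ)
    (hD : IsExtendedDegree I D)
    (q : Ideal A) (hIq : I ≤ q)
    (hqF : ∀ n : ℕ, F.N (n + 1) ≤ q • F.N n) :
    (d = 1 → ∀ n : ℕ, (D M : ℤ) + (F.genDeg : ℤ) < (n : ℤ) → F.FiberH0Vanish q n) ∧
    (2 ≤ d → ∀ n : ℕ,
      ((D M : ℤ) + (F.genDeg : ℤ) + 2) ^ (3 * (d - 1).factorial - 1) - d < (n : ℤ) →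
      F.FiberH0Vanish q n) := by
  refine ⟨?_, ?_⟩
  · rintro rfl n hn
    refine fiber_vanish I hI F hF 0 hdim D hD q hIq hqF n ?_
    simp only [bnd]
    omega
  · intro h2 n hn
    obtain ⟨e, rfl⟩ : ∃ e, d = e + 1 := ⟨d - 1, by omega⟩
    refine fiber_vanish I hI F hF e hdim D hD q hIq hqF n ?_
    have h := bnd_le (F.genDeg + 1) (D M) (by omega) e (by omega)
    have h' : ((bnd (F.genDeg + 1) e (D M) : ℕ) : ℤ) + e ≤
        ((D M : ℤ) + (F.genDeg : ℤ) + 2) ^ (3 * e.factorial - 1) := by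
      have h3 : ((bnd (F.genDeg + 1) e (D M) + e : ℕ) : ℤ) ≤
        ((D M + (F.genDeg + 1) + 1 : ℕ) ^ (3 * e.factorial - 1) : ℕ) := by exact_mod_cast h
      push_cast at h3
      convert h3 using 2
      ring
    rw [Nat.add_sub_cancel] at hn
    push_cast at hn
    omega
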